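/- arXiv:2206.04175 — 2 statements merged into one kernel-verified Lean document; each statement's English description precedes it below -/
import Mathlib

section
/- Let P ⊂ ℝ^d be a full-dimensional lattice polytope and write h*_{∂P}(z) = h*_{∂P,d} z^d + ⋯ + h*_{∂P,1} z + h*_{∂P,0}. Then h*_{∂P,0} = 1, h*_{∂P,0} ≤ h*_{∂P,1}, and h*_{∂P,1} ≤ h*_{∂P,j} for every j = 2, …, d−1. In particular, all coefficients h*_{∂P,0}, …, h*_{∂P,d} are positive. -/
open Pointwise

/-- `x ∈ ℤ^d`, i.e. every coordinate of `x` is an integer. -/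
def IsLatticePt {d : ℕ} (x : Fin d → ℝ) : Prop := ∀ i, ∃ a : ℤ, x i = (a : ℝ)

/-- `x ∈ ℚ^d`, i.e. every coordinate of `x` is rational. -/
def IsRationalPt {d : ℕ} (x : Fin d → ℝ) : Prop := ∀ i, ∃ a : ℚ, x i = (a : ℝ)

/-- `P` is a lattice polytope: the convex hull of finitely many points of `ℤ^d`. -/
def IsLatticePolytope {d : ℕ} (P : Set (Fin d → ℝ)) : Prop :=
  ∃ V : Finset (Fin d → ℝ), (∀ v ∈ V, IsLatticePt v) ∧ P = convexHull ℝ (V : Set (Fin d → ℝ))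

/-- `P` is a rational polytope: the convex hull of finitely many points of `ℚ^d`. -/
def IsRationalPolytope {d : ℕ} (P : Set (Fin d → ℝ)) : Prop :=
  ∃ V : Finset (Fin d → ℝ), (∀ v ∈ V, IsRationalPt v) ∧ P = convexHull ℝ (V : Set (Fin d → ℝ))

/-- A convex subset of `ℝ^d` is full-dimensional iff its interior is nonempty. -/
def IsFullDim {d : ℕ} (P : Set (Fin d → ℝ)) : Prop := (interior P).Nonempty

/-- The number of lattice points in `S`. -/
noncomputable def latCount {d : ℕ} (S : Set (Fin d → ℝ)) : ℕ :=
  Set.ncard {x ∈ S | IsLatticePt x}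

/-- The Ehrhart series `Ehr_P(z) = 1 + ∑_{n ≥ 1} #(nP ∩ ℤ^d) zⁿ`. -/
noncomputable def ehrSeries {d : ℕ} (P : Set (Fin d → ℝ)) : PowerSeries ℤ :=
  PowerSeries.mk fun n => if n = 0 then 1 else (latCount ((n : ℝ) • P) : ℤ)

/-- The interior Ehrhart series `∑_{n ≥ 1} #(nP° ∩ ℤ^d) zⁿ`. -/
noncomputable def ehrIntSeries {d : ℕ} (P : Set (Fin d → ℝ)) : PowerSeries ℤ :=
  PowerSeries.mk fun n => if n = 0 then 0 else (latCount (interior ((n : ℝ) • P)) : ℤ)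

/-- The boundary Ehrhart series `1 + ∑_{n ≥ 1} #(n ∂P ∩ ℤ^d) zⁿ`. -/
noncomputable def ehrBdSeries {d : ℕ} (P : Set (Fin d → ℝ)) : PowerSeries ℤ :=
  PowerSeries.mk fun n => if n = 0 then 1 else (latCount (frontier ((n : ℝ) • P)) : ℤ)

/-- `q` is the denominator of `P`: the smallest positive integer such that `qP` is a
lattice polytope. -/
def IsDenominator {d : ℕ} (P : Set (Fin d → ℝ)) (q : ℕ) : Prop :=
  0 < q ∧ IsLatticePolytope ((q : ℝ) • P) ∧
    ∀ k : ℕ, 0 < k → IsLatticePolytope ((k : ℝ) • P) → q ≤ k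

/-- `l` is the smallest positive integer such that the interior of `lP` contains a
lattice point. -/
def IsMinInteriorDilate {d : ℕ} (P : Set (Fin d → ℝ)) (l : ℕ) : Prop :=
  0 < l ∧ (∃ x, IsLatticePt x ∧ x ∈ interior ((l : ℝ) • P)) ∧
    ∀ k : ℕ, 0 < k → (∃ x, IsLatticePt x ∧ x ∈ interior ((k : ℝ) • P)) → l ≤ k

/-- The homogenization of the half-open simplex with vertices `w 0, …, w (k-1)`
where the facets opposite the first `r` vertices are removed:
`hom(Δ) = Σ_{j<r} ℝ_{>0} (w j, 1) + Σ_{j≥r} ℝ_{≥0} (w j, 1) ⊆ ℝ^{d+1}`. -/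
def homog {d k : ℕ} (w : Fin k → (Fin d → ℝ)) (r : ℕ) : Set (Fin (d + 1) → ℝ) :=
  {y | ∃ c : Fin k → ℝ, (∀ j : Fin k, (j : ℕ) < r → 0 < c j) ∧
    (∀ j : Fin k, r ≤ (j : ℕ) → 0 ≤ c j) ∧
    y = ∑ j : Fin k, c j • (Fin.snoc (w j) 1 : Fin (d + 1) → ℝ)}

/-- The fundamental parallelepiped
`F'_Δ = Σ_{j<r} (0,1] (q_j w_j, q_j) + Σ_{j≥r} [0,1) (q_j w_j, q_j) ⊆ ℝ^{d+1}`. -/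
def fpar {d k : ℕ} (w : Fin k → (Fin d → ℝ)) (r : ℕ) (q : Fin k → ℕ) :
    Set (Fin (d + 1) → ℝ) :=
  {y | ∃ c : Fin k → ℝ, (∀ j : Fin k, (j : ℕ) < r → c j ∈ Set.Ioc (0 : ℝ) 1) ∧
    (∀ j : Fin k, r ≤ (j : ℕ) → c j ∈ Set.Ico (0 : ℝ) 1) ∧
    y = ∑ j : Fin k, c j • ((q j : ℝ) • (Fin.snoc (w j) 1 : Fin (d + 1) → ℝ))}

/-- The generating function `∑_{x ∈ S ∩ ℤ^{d+1}} z^{x_{d+1}}` of a subset `S ⊆ ℝ^{d+1}`,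
graded by the last coordinate. -/
noncomputable def sliceSeries {d : ℕ} (S : Set (Fin (d + 1) → ℝ)) : PowerSeries ℤ :=
  PowerSeries.mk fun n =>
    (Set.ncard {y ∈ S | IsLatticePt y ∧ y (Fin.last d) = (n : ℝ)} : ℤ)

/-- A polynomial is palindromic if `z^{deg f} f(1/z) = f(z)`,
i.e. `f_i = f_{deg f − i}` for all `i ≤ deg f`. -/
def IsPalin (f : Polynomial ℤ) : Prop :=
  ∀ i ≤ f.natDegree, f.coeff i = f.coeff (f.natDegree - i)

/-- `P` is rational reflexive: the origin is an interior point and `P = {x : A x ≤ 𝟙}`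
for some integer matrix `A`. -/
def IsRationalReflexive {d : ℕ} (P : Set (Fin d → ℝ)) : Prop :=
  IsRationalPolytope P ∧ (0 : Fin d → ℝ) ∈ interior P ∧
    ∃ (m : ℕ) (A : Fin m → Fin d → ℤ),
      P = {x : Fin d → ℝ | ∀ j, (∑ i, (A j i : ℝ) * x i) ≤ 1}

/-- `P` is a reflexive (lattice) polytope. -/
def IsReflexive {d : ℕ} (P : Set (Fin d → ℝ)) : Prop :=
  IsLatticePolytope P ∧ (0 : Fin d → ℝ) ∈ interior P ∧
    ∃ (m : ℕ) (A : Fin m → Fin d → ℤ),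
      P = {x : Fin d → ℝ | ∀ j, (∑ i, (A j i : ℝ) * x i) ≤ 1}

/-- `P` is an integral translate of a reflexive polytope. -/
def IsTranslatedReflexive {d : ℕ} (P : Set (Fin d → ℝ)) : Prop :=
  ∃ (Q : Set (Fin d → ℝ)) (t : Fin d → ℤ), IsReflexive Q ∧
    P = (fun y => y + fun i => (t i : ℝ)) '' Q

/-- The rational Ehrhart series `1 + ∑_{n ≥ 1} #((n/r) P ∩ ℤ^d) wⁿ`. -/
noncomputable def ratEhrSeries {d : ℕ} (P : Set (Fin d → ℝ)) (r : ℕ) : PowerSeries ℤ :=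
  PowerSeries.mk fun n => if n = 0 then 1 else (latCount (((n : ℝ) / (r : ℝ)) • P) : ℤ)

/-- The rational boundary Ehrhart series `1 + ∑_{n ≥ 1} #((n/r) ∂P ∩ ℤ^d) wⁿ`. -/
noncomputable def ratEhrBdSeries {d : ℕ} (P : Set (Fin d → ℝ)) (r : ℕ) : PowerSeries ℤ :=
  PowerSeries.mk fun n =>
    if n = 0 then 1 else (latCount (frontier (((n : ℝ) / (r : ℝ)) • P)) : ℤ)

/-- `r` is the codenominator of `P`: given an irredundant halfspace description
`P = {x : A x ≤ b}` with integer data and `gcd(b_j, A_{j,1}, …, A_{j,d}) = 1` for each `j`,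
`r` is the least common multiple of the nonzero entries of `b`. -/
def IsCodenominator {d : ℕ} (P : Set (Fin d → ℝ)) (r : ℕ) : Prop :=
  ∃ (m : ℕ) (A : Fin m → Fin d → ℤ) (b : Fin m → ℤ),
    P = {x : Fin d → ℝ | ∀ j, (∑ i, (A j i : ℝ) * x i) ≤ (b j : ℝ)} ∧
    (∀ j₀ : Fin m,
      P ≠ {x : Fin d → ℝ | ∀ j, j ≠ j₀ → (∑ i, (A j i : ℝ) * x i) ≤ (b j : ℝ)}) ∧
    (∀ j, Int.gcd (b j) (Finset.univ.gcd fun i => A j i) = 1) ∧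
    (r : ℤ) = (Finset.univ.filter fun j => b j ≠ 0).lcm b


open Finset Module

set_option linter.all false

section FanBasics

variable {d : ℕ} {ι : Type} [Fintype ι] [DecidableEq ι]

/-- `F` indexes a basis (with dual system). -/
def Bas (u : ι → Fin d → ℝ) (F : Finset ι) : Prop :=
  ∃ z : ι → Dual ℝ (Fin d → ℝ), (∀ i ∈ F, ∀ j ∈ F, z i (u j) = if i = j then 1 else 0) ∧
    ∀ v, ∑ i ∈ F, z i v • u i = v

open Classical in
/-- dual coordinates -/
noncomputable def co (u : ι → Fin d → ℝ) (F : Finset ι) : ι → Dual ℝ (Fin d → ℝ) :=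
  if hF : Bas u F then hF.choose else 0

/-- the linear function on the cone of `F` -/
noncomputable def ht (u : ι → Fin d → ℝ) (h : ι → ℝ) (F : Finset ι) : Dual ℝ (Fin d → ℝ) :=
  ∑ i ∈ F, h i • co u F i

/-- Basic data of a generic convex system. -/
structure Sys (u : ι → Fin d → ℝ) (h : ι → ℝ) : Prop where
  pos : ∀ w, ∃ c : ι → ℝ, (∀ i, 0 ≤ c i) ∧ ∑ i, c i • u i = w
  hpos : ∀ i, 0 < h i
  gen : ∀ F, Bas u F → ∀ j, j ∉ F → ht u h F (u j) ≠ h j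

/-- facets -/
def Facet (u : ι → Fin d → ℝ) (h : ι → ℝ) (F : Finset ι) : Prop :=
  Bas u F ∧ ∀ j, j ∉ F → ht u h F (u j) < h j

/-- faces -/
def Face (u : ι → Fin d → ℝ) (h : ι → ℝ) (s : Finset ι) : Prop :=
  ∃ F, Facet u h F ∧ s ⊆ F

variable {u : ι → Fin d → ℝ} {h : ι → ℝ} {F G : Finset ι}

lemma Bas.co_eq (hF : Bas u F) {i j : ι} (hi : i ∈ F) (hj : j ∈ F) :
    co u F i (u j) = if i = j then 1 else 0 := by
  unfold co; rw [dif_pos hF]; exact hF.choose_spec.1 i hi j hj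

lemma Bas.co_self (hF : Bas u F) {i : ι} (hi : i ∈ F) : co u F i (u i) = 1 := by
  rw [hF.co_eq hi hi, if_pos rfl]

lemma Bas.co_ne (hF : Bas u F) {i j : ι} (hi : i ∈ F) (hj : j ∈ F) (hij : i ≠ j) :
    co u F i (u j) = 0 := by
  rw [hF.co_eq hi hj, if_neg hij]

lemma Bas.sum_co (hF : Bas u F) (v : Fin d → ℝ) : ∑ i ∈ F, co u F i v • u i = v := by
  unfold co; rw [dif_pos hF]; exact hF.choose_spec.2 v

lemma Bas.dual_apply (hF : Bas u F) (y : Dual ℝ (Fin d → ℝ)) (v : Fin d → ℝ) :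
    y v = ∑ i ∈ F, co u F i v * y (u i) := by
  conv_lhs => rw [← hF.sum_co v]
  simp [map_sum]

lemma Bas.dual_ext (hF : Bas u F) {y y' : Dual ℝ (Fin d → ℝ)} (hy : ∀ i ∈ F, y (u i) = y' (u i)) :
    y = y' := by
  refine LinearMap.ext fun v => ?_
  rw [hF.dual_apply y, hF.dual_apply y']
  exact Finset.sum_congr rfl fun i hi => by rw [hy i hi]

lemma ht_apply (v : Fin d → ℝ) : ht u h F v = ∑ i ∈ F, h i * co u F i v := by
  simp [ht]

lemma Bas.ht_eq (hF : Bas u F) {i : ι} (hi : i ∈ F) : ht u h F (u i) = h i := by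
  rw [ht_apply, Finset.sum_eq_single i]
  · rw [hF.co_self hi, mul_one]
  · intro j hj hji; rw [hF.co_ne hj hi hji, mul_zero]
  · intro hh; exact absurd hi hh

lemma Facet.ht_le (hF : Facet u h F) (j : ι) : ht u h F (u j) ≤ h j := by
  by_cases hj : j ∈ F
  · exact (hF.1.ht_eq hj).le
  · exact (hF.2 j hj).le

lemma Bas.coeff_eq (hF : Bas u F) (c : ι → ℝ) {i : ι} (hi : i ∈ F) :
    co u F i (∑ j ∈ F, c j • u j) = c i := by
  rw [map_sum, Finset.sum_eq_single i]
  · rw [map_smul, hF.co_self hi]; simp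
  · intro j hj hji; rw [map_smul, hF.co_ne hi hj (Ne.symm hji)]; simp
  · intro hh; exact absurd hi hh

lemma Bas.eq_of_subset (hF : Bas u F) (hG : Bas u G) (hFG : F ⊆ G) : F = G := by
  refine Finset.Subset.antisymm hFG ?_
  intro j hj
  by_contra hjF
  have h1 := hF.dual_apply (co u G j) (u j)
  rw [hG.co_self hj, Finset.sum_eq_zero] at h1
  · exact one_ne_zero h1
  · intro i hi
    rw [hG.co_ne hj (hFG hi) (by rintro rfl; exact hjF hi), mul_zero]

lemma Facet.ht_mono (hF : Facet u h F) (hG : Facet u h G) {w : Fin d → ℝ}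
    (hw : ∀ i ∈ F, 0 ≤ co u F i w ∨ i ∈ G) : ht u h G w ≤ ht u h F w := by
  rw [hF.1.dual_apply (ht u h G), ht_apply]
  refine Finset.sum_le_sum fun i hi => ?_
  rw [mul_comm (h i)]
  rcases hw i hi with h1 | h1
  · exact mul_le_mul_of_nonneg_left (hG.ht_le i) h1
  · rw [hG.1.ht_eq h1]

lemma Facet.ht_strict (hF : Facet u h F) (hG : Facet u h G) {w : Fin d → ℝ}
    (hw : ∀ i ∈ F, 0 < co u F i w ∨ i ∈ G) (hne : F ≠ G) : ht u h G w < ht u h F w := by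
  have hns : ¬ F ⊆ G := fun hs => hne (hF.1.eq_of_subset hG.1 hs)
  obtain ⟨i, hi, hiG⟩ := Finset.not_subset.1 hns
  rw [hF.1.dual_apply (ht u h G), ht_apply]
  refine Finset.sum_lt_sum (fun i hi => ?_) ⟨i, hi, ?_⟩
  · rw [mul_comm (h i)]
    rcases hw i hi with h1 | h1
    · exact mul_le_mul_of_nonneg_left (hG.ht_le i) h1.le
    · rw [hG.1.ht_eq h1]
  · rw [mul_comm (h i)]
    rcases hw i hi with h1 | h1
    · exact mul_lt_mul_of_pos_left (hG.2 i hiG) h1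
    · exact absurd h1 hiG

lemma Facet.unique (hF : Facet u h F) (hG : Facet u h G) {w : Fin d → ℝ}
    (hw : ∀ i ∈ F, 0 < co u F i w) (hw' : ∀ i ∈ G, 0 < co u G i w) : F = G := by
  by_contra hne
  have h1 := hF.ht_strict hG (fun i hi => Or.inl (hw i hi)) hne
  have h2 := hG.ht_strict hF (fun i hi => Or.inl (hw' i hi)) (Ne.symm hne)
  exact absurd h1 (not_lt.2 h2.le)

/-- pivoting -/
lemma Bas.pivot (hF : Bas u F) {i j : ι} (hi : i ∈ F) (hj : j ∉ F) (hij : co u F i (u j) ≠ 0) :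
    Bas u (insert j (F.erase i)) := by
  refine ⟨fun k => if k = j then (co u F i (u j))⁻¹ • co u F i else
    co u F k - (co u F k (u j) * (co u F i (u j))⁻¹) • co u F i, ?_, ?_⟩
  · intro k hk l hl
    have hji : j ≠ i := by rintro rfl; exact hj hi
    simp only [Finset.mem_insert, Finset.mem_erase] at hk hl
    by_cases hkj : k = j
    · subst hkj
      beta_reduce
      rw [if_pos rfl]
      rcases hl with rfl | ⟨hl1, hl2⟩
      · simp [hij]
      · have : k ≠ l := by rintro rfl; exact hj hl2
        simp [this, hF.co_ne hi hl2 (Ne.symm hl1)]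
    · beta_reduce
      rw [if_neg hkj]
      rcases hk with hk | ⟨hk1, hk2⟩
      · exact absurd hk hkj
      rcases hl with rfl | ⟨hl1, hl2⟩
      · simp [hkj, hij]
      · simp [hF.co_ne hi hl2 (Ne.symm hl1), hF.co_eq hk2 hl2]
  · intro v
    have hj' : j ∉ F.erase i := fun hh => hj (Finset.mem_of_mem_erase hh)
    rw [Finset.sum_insert hj']
    beta_reduce
    rw [if_pos rfl]
    have e1 : ∑ k ∈ F.erase i, (if k = j then (co u F i (u j))⁻¹ • co u F i else
        co u F k - (co u F k (u j) * (co u F i (u j))⁻¹) • co u F i) v • u k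
        = ∑ k ∈ F.erase i, co u F k v • u k
          - ((co u F i (u j))⁻¹ * co u F i v) • ∑ k ∈ F.erase i, co u F k (u j) • u k := by
      rw [Finset.smul_sum, ← Finset.sum_sub_distrib]
      refine Finset.sum_congr rfl fun k hk => ?_
      have : k ≠ j := by rintro rfl; exact hj' hk
      rw [if_neg this]
      simp only [LinearMap.sub_apply, LinearMap.smul_apply, smul_eq_mul, sub_smul, smul_smul]
      congr 2; ring
    have e2 := hF.sum_co v
    have e3 := hF.sum_co (u j)
    rw [← Finset.add_sum_erase _ _ hi] at e2 e3
    rw [e1, eq_sub_of_add_eq' e2, eq_sub_of_add_eq' e3]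
    simp only [LinearMap.smul_apply, smul_eq_mul, smul_sub, smul_smul]
    have : (co u F i (u j))⁻¹ * co u F i v * co u F i (u j) = co u F i v := by field_simp
    rw [this]; abel

/-- ridge neighbours -/
lemma Facet.neighbor (S : Sys u h) (hF : Facet u h F) {i : ι} (hi : i ∈ F) :
    ∃ j, j ∉ F ∧ Facet u h (insert j (F.erase i)) ∧ co u F i (u j) < 0 ∧
      ∃ s : ℝ, 0 < s ∧ ht u h (insert j (F.erase i)) = ht u h F - s • co u F i := by
  classical
  obtain ⟨c, hc, hcw⟩ := S.pos (-(u i))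
  have hex : ∃ j, co u F i (u j) < 0 := by
    by_contra! hcon
    have h1 : co u F i (∑ j, c j • u j) = -1 := by rw [hcw, map_neg, hF.1.co_self hi]
    rw [map_sum] at h1
    have h2 : 0 ≤ ∑ j, co u F i (c j • u j) := Finset.sum_nonneg fun j _ => by
      rw [map_smul]; exact mul_nonneg (hc j) (hcon j)
    linarith
  obtain ⟨j0, hj0⟩ := hex
  obtain ⟨j, hjm, hjmin⟩ := (univ.filter fun j => co u F i (u j) < 0).exists_min_image
    (fun j => (h j - ht u h F (u j)) / (- co u F i (u j))) ⟨j0, by simpa using hj0⟩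
  have hjneg : co u F i (u j) < 0 := by simpa using hjm
  have hjF : j ∉ F := by
    intro hj
    rw [hF.1.co_eq hi hj] at hjneg
    split_ifs at hjneg <;> linarith
  set s := (h j - ht u h F (u j)) / (- co u F i (u j)) with hs
  have hspos : 0 < s := div_pos (by linarith [hF.2 j hjF]) (by linarith)
  have hB := hF.1.pivot hi hjF hjneg.ne
  have hht : ht u h (insert j (F.erase i)) = ht u h F - s • co u F i := by
    apply hB.dual_ext
    intro k hk
    rw [hB.ht_eq hk]
    rcases Finset.mem_insert.1 hk with rfl | hk'
    · have h7 : - co u F i (u k) ≠ 0 := by linarith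
      have h8 : s * (- co u F i (u k)) = h k - ht u h F (u k) := by rw [hs, div_mul_cancel₀ _ h7]
      simp only [LinearMap.sub_apply, LinearMap.smul_apply, smul_eq_mul]
      linarith
    · simp only [LinearMap.sub_apply, LinearMap.smul_apply, smul_eq_mul]
      rw [hF.1.ht_eq (Finset.mem_of_mem_erase hk'),
        hF.1.co_ne hi (Finset.mem_of_mem_erase hk') (Finset.ne_of_mem_erase hk').symm]
      ring
  refine ⟨j, hjF, ⟨hB, fun k hk => lt_of_le_of_ne ?_ (S.gen _ hB k hk)⟩, hjneg, s, hspos, hht⟩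
  rw [hht]
  simp only [LinearMap.sub_apply, LinearMap.smul_apply, smul_eq_mul]
  by_cases hkn : co u F i (u k) < 0
  · have := hjmin k (by simpa using hkn)
    rw [le_div_iff₀ (by linarith)] at this
    linarith
  · have := mul_nonneg hspos.le (not_lt.1 hkn)
    linarith [hF.ht_le k]

/-- generic vectors -/
def GenV (u : ι → Fin d → ℝ) (w : Fin d → ℝ) : Prop :=
  ∀ J : Finset ι, w ∈ Submodule.span ℝ (u '' (J : Set ι)) →
    Submodule.span ℝ (u '' (J : Set ι)) = ⊤

lemma bas_of_linInd (hl : LinearIndepOn ℝ u (F : Set ι))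
    (hs : Submodule.span ℝ (u '' (F : Set ι)) = ⊤) : Bas u F := by
  classical
  let b : Basis (F : Set ι) ℝ (Fin d → ℝ) := Basis.mk hl (by
    rw [← hs, Set.image_eq_range])
  have hb : ∀ i, b i = u i := fun i => by simp [b]
  refine ⟨fun i => if hi : i ∈ F then b.coord ⟨i, hi⟩ else 0, ?_, ?_⟩
  · intro i hi j hj
    beta_reduce
    rw [dif_pos hi, ← hb ⟨j, hj⟩]
    rw [Basis.coord_apply, Basis.repr_self, Finsupp.single_apply]
    simp [eq_comm]
  · intro v
    have h1 := b.sum_repr v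
    conv_rhs => rw [← h1]
    rw [← Finset.sum_attach]
    refine Finset.sum_congr rfl fun i _ => ?_
    simp [hb]

lemma exists_bas (J : Finset ι) (hs : Submodule.span ℝ (u '' (J : Set ι)) = ⊤) :
    ∃ F ⊆ J, Bas u F := by
  classical
  have h0 := linearIndepOn_empty ℝ u
  have hsub : (∅ : Set ι) ⊆ (J : Set ι) := Set.empty_subset _
  have h1 := h0.linearIndepOn_extend hsub
  have h2 := h0.span_image_extend_eq_span_image hsub
  have h3 := h0.extend_subset hsub
  set e := h0.extend hsub
  have hfin : e.Finite := J.finite_toSet.subset h3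
  refine ⟨hfin.toFinset, by simpa using h3, ?_⟩
  apply bas_of_linInd
  · simpa using h1
  · rw [← hs, ← h2]; simp

open Filter Topology in
/-- existence of the cone containing a generic vector -/
lemma exists_facet (S : Sys u h) {w : Fin d → ℝ} (hw : GenV u w) :
    ∃ F, Facet u h F ∧ ∀ i ∈ F, 0 < co u F i w := by
  classical
  obtain ⟨c0, hc0, hcw0⟩ := S.pos w
  set C := ∑ i, c0 i * h i with hC
  let K : Set (ι → ℝ) := {c | (∀ i, 0 ≤ c i) ∧ ∑ i, c i • u i = w ∧ ∑ i, c i * h i ≤ C}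
  have hKc : IsCompact K := by
    refine IsCompact.of_isClosed_subset (isCompact_Icc (a := (0 : ι → ℝ)) (b := fun i => C / h i)) ?_ ?_
    · have : K = (⋂ i, {c : ι → ℝ | 0 ≤ c i}) ∩ ({c : ι → ℝ | ∑ i, c i • u i = w} ∩
          {c | ∑ i, c i * h i ≤ C}) := by
        ext c; simp [K]
      rw [this]
      refine (isClosed_iInter fun i => isClosed_le continuous_const (continuous_apply i)).inter
        ((isClosed_eq (by fun_prop) continuous_const).inter
          (isClosed_le (by fun_prop) continuous_const))
    · rintro c ⟨h1, h2, h3⟩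
      refine ⟨fun i => h1 i, fun i => ?_⟩
      rw [le_div_iff₀ (S.hpos i)]
      exact (Finset.single_le_sum (f := fun i => c i * h i)
        (fun i _ => mul_nonneg (h1 i) (S.hpos i).le) (Finset.mem_univ i)).trans h3
  obtain ⟨c, ⟨hc, hcw, hcC⟩, hmin⟩ := hKc.exists_isMinOn ⟨c0, hc0, hcw0, le_rfl⟩
    (f := fun c => ∑ i, c i * h i) (by fun_prop)
  have hmin' : ∀ c' : ι → ℝ, (∀ i, 0 ≤ c' i) → ∑ i, c' i • u i = w →
      ∑ i, c i * h i ≤ ∑ i, c' i * h i := by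
    intro c' h1 h2
    by_cases h3 : ∑ i, c' i * h i ≤ C
    · exact hmin ⟨h1, h2, h3⟩
    · exact hcC.trans (not_le.1 h3).le
  let J : Finset ι := univ.filter fun i => c i ≠ 0
  have hJ : Submodule.span ℝ (u '' (J : Set ι)) = ⊤ := by
    apply hw
    rw [← hcw]
    refine Submodule.sum_mem _ fun i _ => ?_
    by_cases hi : c i = 0
    · simp [hi]
    · exact Submodule.smul_mem _ _ (Submodule.subset_span ⟨i, by simp [J, hi], rfl⟩)
  obtain ⟨F, hFJ, hF⟩ := exists_bas J hJ
  have hFpos : ∀ i ∈ F, 0 < c i := fun i hi =>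
    lt_of_le_of_ne (hc i) (Ne.symm (by simpa [J] using hFJ hi))
  -- moving in direction of `j`
  have key : ∀ j, j ∉ F → ∀ e : ℝ, (e = 1 ∨ (e = -1 ∧ 0 < c j)) →
      0 ≤ e * (h j - ht u h F (u j)) := by
    intro j hj e he
    let b : ι → ℝ := fun i => if i = j then e else if i ∈ F then - e * co u F i (u j) else 0
    have hbsum : ∀ (V : Type) [AddCommGroup V] [Module ℝ V] (g : ι → V),
        ∑ i, b i • g i = e • (g j - ∑ i ∈ F, co u F i (u j) • g i) := by
      intro V _ _ g
      rw [← Finset.add_sum_erase _ _ (Finset.mem_univ j)]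
      have : ∑ i ∈ univ.erase j, b i • g i = ∑ i ∈ F, (- e * co u F i (u j)) • g i := by
        symm
        apply Finset.sum_subset_zero_on_sdiff
        · intro i hi; simp; rintro rfl; exact hj hi
        · intro i hi
          simp only [Finset.mem_sdiff, Finset.mem_erase] at hi
          simp [b, hi.1.1, hi.2]
        · intro i hi
          have : i ≠ j := by rintro rfl; exact hj hi
          simp [b, this, hi]
      rw [this, smul_sub, Finset.smul_sum, sub_eq_add_neg, ← Finset.sum_neg_distrib]
      congr 1
      · simp [b]
      · refine Finset.sum_congr rfl fun i _ => ?_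
        rw [smul_smul, ← neg_smul]; congr 1; ring
    have hev : ∀ᶠ s in 𝓝[>] (0:ℝ), ∀ i, 0 ≤ c i + s * b i := by
      rw [eventually_all]
      intro i
      by_cases hci : 0 < c i
      · have : Tendsto (fun s : ℝ => c i + s * b i) (𝓝[>] 0) (𝓝 (c i + 0 * b i)) :=
          ((by fun_prop : Continuous fun s : ℝ => c i + s * b i).tendsto 0).mono_left
            nhdsWithin_le_nhds
        rw [zero_mul, add_zero] at this
        exact (this.eventually (lt_mem_nhds hci)).mono fun s hs => hs.le
      · have hci0 : c i = 0 := le_antisymm (not_lt.1 hci) (hc i)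
        have hbi : 0 ≤ b i := by
          by_cases hij : i = j
          · subst hij
            rcases he with rfl | ⟨_, h2⟩
            · simp [b]
            · exact absurd h2 hci
          · have : i ∉ F := fun hh => hci (hFpos i hh)
            simp [b, hij, this]
        filter_upwards [self_mem_nhdsWithin] with s hs
        rw [hci0, zero_add]; exact mul_nonneg (le_of_lt hs) hbi
    obtain ⟨s, hs1, hs2⟩ := (hev.and self_mem_nhdsWithin).exists
    have h3 := hmin' (fun i => c i + s * b i) hs1 (by
      simp only [add_smul, Finset.sum_add_distrib, mul_smul, ← Finset.smul_sum]
      rw [hcw, hbsum, hF.sum_co]; simp)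
    have h4 := hbsum ℝ h
    simp only [smul_eq_mul] at h4
    simp only [add_mul, Finset.sum_add_distrib, mul_assoc, ← Finset.mul_sum] at h3
    rw [h4] at h3
    have h5 : ∑ i ∈ F, co u F i (u j) * h i = ht u h F (u j) := by
      rw [ht_apply]; exact Finset.sum_congr rfl fun i _ => mul_comm _ _
    rw [h5] at h3
    have h6 : 0 ≤ s * (e * (h j - ht u h F (u j))) := by linarith
    exact nonneg_of_mul_nonneg_right h6 hs2
  have hJF : ∀ j, j ∉ F → c j = 0 := by
    intro j hj
    by_contra hcj
    have hcj' : 0 < c j := lt_of_le_of_ne (hc j) (Ne.symm hcj)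
    have h1 := key j hj 1 (Or.inl rfl)
    have h2 := key j hj (-1) (Or.inr ⟨rfl, hcj'⟩)
    exact S.gen F hF j hj (by linarith)
  refine ⟨F, ⟨hF, fun j hj => lt_of_le_of_ne ?_ (S.gen F hF j hj)⟩, ?_⟩
  · have := key j hj 1 (Or.inl rfl); linarith
  · intro i hi
    have : w = ∑ i ∈ F, c i • u i := by
      rw [← hcw]; symm
      exact Finset.sum_subset (Finset.subset_univ _) fun j _ hj => by simp [hJF j hj]
    rw [this, hF.coeff_eq c hi]; exact hFpos i hi

end FanBasics


section FanTwo

variable {d : ℕ} {ι : Type} [Fintype ι] [DecidableEq ι]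
variable {u : ι → Fin d → ℝ} {h : ι → ℝ} {F G : Finset ι}

lemma exists_avoid (W : Set (Submodule ℝ (Fin d → ℝ))) (hW : W.Finite) (hT : ∀ p ∈ W, p ≠ ⊤) :
    ∃ x : Fin d → ℝ, ∀ p ∈ W, x ∉ p := by
  have h1 := Subspace.biUnion_ne_univ_of_top_notMem (k := ℝ) (s := hW.toFinset) (by
    intro hh
    exact hT ⊤ (hW.mem_toFinset.1 hh) rfl)
  obtain ⟨x, hx⟩ := (Set.ne_univ_iff_exists_notMem _).1 h1
  refine ⟨x, fun p hp hxp => hx ?_⟩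
  simp only [Set.mem_iUnion]
  exact ⟨p, hW.mem_toFinset.2 hp, hxp⟩

lemma exists_genV (W : Set (Submodule ℝ (Fin d → ℝ))) (hW : W.Finite) (hT : ∀ p ∈ W, p ≠ ⊤) :
    ∃ x : Fin d → ℝ, GenV u x ∧ ∀ p ∈ W, x ∉ p := by
  obtain ⟨x, hx⟩ := exists_avoid
    (W ∪ {p | p ≠ ⊤ ∧ p ∈ Set.range fun J : Finset ι => Submodule.span ℝ (u '' (J : Set ι))})
    (hW.union ((Set.finite_range _).subset fun p hp => hp.2))
    (by
      rintro p (hp | hp)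
      · exact hT p hp
      · exact hp.1)
  refine ⟨x, fun J hJ => ?_, fun p hp => hx p (Or.inl hp)⟩
  by_contra hne
  exact hx _ (Or.inr ⟨hne, J, rfl⟩) hJ

lemma GenV.neg {w : Fin d → ℝ} (hw : GenV u w) : GenV u (-w) := fun J hJ =>
  hw J (by simpa using Submodule.neg_mem _ hJ)

open Filter Topology in
lemma GenV.eventually {ξ : Fin d → ℝ} (hξ : GenV u ξ) (v : Fin d → ℝ) :
    ∀ᶠ t in 𝓝[>] (0:ℝ), GenV u (v + t • ξ) := by
  unfold GenV
  rw [eventually_all]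
  intro J
  by_cases hJ : Submodule.span ℝ (u '' (J : Set ι)) = ⊤
  · simp [hJ]
  · have h1 : {t : ℝ | v + t • ξ ∈ Submodule.span ℝ (u '' (J : Set ι))}.Subsingleton := by
      intro s hs t ht
      by_contra hne
      have h2 := Submodule.sub_mem (Submodule.span ℝ (u '' (J : Set ι))) (Set.mem_setOf_eq ▸ hs) (Set.mem_setOf_eq ▸ ht)
      have h3 : (s - t) • ξ ∈ Submodule.span ℝ (u '' (J : Set ι)) := by
        convert h2 using 1; rw [sub_smul]; abel
      have h4 := Submodule.smul_mem _ (s - t)⁻¹ h3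
      rw [smul_smul, inv_mul_cancel₀ (sub_ne_zero.2 hne), one_smul] at h4
      exact hJ (hξ J h4)
    have h2 : {t : ℝ | v + t • ξ ∈ Submodule.span ℝ (u '' (J : Set ι))} \ {0} =
        {t : ℝ | v + t • ξ ∈ Submodule.span ℝ (u '' (J : Set ι))} ∩ {0}ᶜ := rfl
    have h3 : (({t : ℝ | v + t • ξ ∈ Submodule.span ℝ (u '' (J : Set ι))} \ {0})ᶜ) ∈ 𝓝 (0:ℝ) :=
      (h1.finite.subset Set.sdiff_subset).isClosed.isOpen_compl.mem_nhds (by simp)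
    filter_upwards [nhdsWithin_le_nhds h3, self_mem_nhdsWithin] with t ht1 ht2 ht3
    exact absurd ⟨ht3, ne_of_gt ht2⟩ ht1

lemma Bas.span (hF : Bas u F) : Submodule.span ℝ (u '' (F : Set ι)) = ⊤ := by
  rw [eq_top_iff]
  intro v _
  rw [← hF.sum_co v]
  exact Submodule.sum_mem _ fun i hi => Submodule.smul_mem _ _ (Submodule.subset_span ⟨i, hi, rfl⟩)

lemma Bas.linInd (hF : Bas u F) : LinearIndependent ℝ (fun i : F => u i) := by
  rw [Fintype.linearIndependent_iff]
  intro g hg i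
  classical
  have h1 := hF.coeff_eq (fun j => if hj : j ∈ F then g ⟨j, hj⟩ else 0) i.2
  rw [← Finset.sum_attach] at h1
  simp only [Finset.coe_mem, dif_pos, Subtype.coe_eta] at h1
  rw [← h1]
  have : ∑ x ∈ F.attach, g x • u x = 0 := hg
  rw [this, map_zero]

lemma Bas.card (hF : Bas u F) : F.card = d := by
  have h1 := finrank_span_eq_card hF.linInd
  have h2 : Set.range (fun i : F => u i) = u '' (F : Set ι) := by
    rw [Set.image_eq_range]; rfl
  rw [h2, hF.span] at h1
  simpa using h1.symm

lemma Bas.co_gen_ne (hF : Bas u F) {w : Fin d → ℝ} (hw : GenV u w) {i : ι} (hi : i ∈ F) :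
    co u F i w ≠ 0 := by
  intro h0
  have h1 : w ∈ Submodule.span ℝ (u '' ((F.erase i : Finset ι) : Set ι)) := by
    rw [← hF.sum_co w, ← Finset.add_sum_erase _ _ hi, h0, zero_smul, zero_add]
    exact Submodule.sum_mem _ fun j hj =>
      Submodule.smul_mem _ _ (Submodule.subset_span ⟨j, hj, rfl⟩)
  have h2 := hw _ h1
  have h3 : u i ∈ Submodule.span ℝ (u '' ((F.erase i : Finset ι) : Set ι)) := by rw [h2]; trivial
  have h4 : Submodule.span ℝ (u '' ((F.erase i : Finset ι) : Set ι)) ≤ LinearMap.ker (co u F i) := by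
    rw [Submodule.span_le]
    rintro _ ⟨j, hj, rfl⟩
    have hj' : j ∈ F.erase i := hj
    exact hF.co_ne hi (Finset.mem_of_mem_erase hj') (Finset.ne_of_mem_erase hj').symm
  have h5 := h4 h3
  rw [LinearMap.mem_ker, hF.co_self hi] at h5
  exact one_ne_zero h5

/-- restriction set -/
noncomputable def Rs (u : ι → Fin d → ℝ) (ξ : Fin d → ℝ) (F : Finset ι) : Finset ι :=
  F.filter fun i => co u F i ξ < 0

lemma mem_Rs {ξ : Fin d → ℝ} {i : ι} : i ∈ Rs u ξ F ↔ i ∈ F ∧ co u F i ξ < 0 := by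
  simp [Rs]

/-- half-open cone -/
def InC (u : ι → Fin d → ℝ) (ξ : Fin d → ℝ) (F : Finset ι) (v : Fin d → ℝ) : Prop :=
  ∀ i ∈ F, 0 ≤ co u F i v ∧ (co u F i ξ < 0 → 0 < co u F i v)

open Filter Topology in
lemma exists_InC (S : Sys u h) {ξ : Fin d → ℝ} (hξ : GenV u ξ) (v : Fin d → ℝ) :
    ∃ F, Facet u h F ∧ InC u ξ F v := by
  have h1 : ∃ᶠ t in 𝓝[>] (0:ℝ), ∃ F, Facet u h F ∧ ∀ i ∈ F, 0 < co u F i (v + t • ξ) :=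
    ((hξ.eventually v).mono fun t ht => exists_facet S ht).frequently
  have h2 : ∃ F, ∃ᶠ t in 𝓝[>] (0:ℝ), Facet u h F ∧ ∀ i ∈ F, 0 < co u F i (v + t • ξ) := by
    by_contra! hcon
    have : ∀ᶠ t in 𝓝[>] (0:ℝ), ∀ F, ¬ (Facet u h F ∧ ∀ i ∈ F, 0 < co u F i (v + t • ξ)) := by
      rw [eventually_all]; intro F; simpa [Filter.Frequently] using hcon F
    exact h1 (this.mono fun t ht ⟨F, hF⟩ => ht F hF)
  obtain ⟨F, hF⟩ := h2
  obtain ⟨t0, ht0⟩ := hF.exists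
  refine ⟨F, ht0.1, fun i hi => ⟨?_, fun hneg => ?_⟩⟩
  · by_contra! hlt
    have hc : Tendsto (fun t : ℝ => co u F i (v + t • ξ)) (𝓝[>] 0) (𝓝 (co u F i v)) := by
      have : (fun t : ℝ => co u F i (v + t • ξ)) = fun t => co u F i v + t * co u F i ξ := by
        ext t; simp
      rw [this]
      have h3 : Tendsto (fun t : ℝ => co u F i v + t * co u F i ξ) (𝓝[>] 0)
          (𝓝 (co u F i v + 0 * co u F i ξ)) :=
        ((by fun_prop : Continuous fun t : ℝ => co u F i v + t * co u F i ξ).tendsto 0).mono_left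
            nhdsWithin_le_nhds
      simpa using h3
    obtain ⟨t, ht1, ht2⟩ := (hF.and_eventually (hc.eventually (gt_mem_nhds hlt))).exists
    have := ht1.2 i hi
    linarith
  · obtain ⟨t, ht1, ht2⟩ := (hF.and_eventually (self_mem_nhdsWithin)).exists
    have h3 := ht1.2 i hi
    rw [map_add, map_smul, smul_eq_mul] at h3
    have h4 : t * co u F i ξ < 0 := mul_neg_of_pos_of_neg ht2 hneg
    linarith

open Filter Topology in
lemma InC.eventually (hF : Bas u F) {ξ v : Fin d → ℝ} (hξ : GenV u ξ) (hv : InC u ξ F v) :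
    ∀ᶠ t in 𝓝[>] (0:ℝ), ∀ i ∈ F, 0 < co u F i (v + t • ξ) := by
  rw [Filter.eventually_all_finset]
  intro i hi
  by_cases h0 : 0 < co u F i v
  · have h3 : Tendsto (fun t : ℝ => co u F i v + t * co u F i ξ) (𝓝[>] 0)
          (𝓝 (co u F i v + 0 * co u F i ξ)) :=
        ((by fun_prop : Continuous fun t : ℝ => co u F i v + t * co u F i ξ).tendsto 0).mono_left
            nhdsWithin_le_nhds
    rw [zero_mul, add_zero] at h3
    filter_upwards [h3.eventually (lt_mem_nhds h0)] with t ht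
    simpa using ht
  · have h1 : 0 < co u F i ξ := by
      rcases lt_trichotomy (co u F i ξ) 0 with h2 | h2 | h2
      · exact absurd ((hv i hi).2 h2) h0
      · exact absurd h2 (hF.co_gen_ne hξ hi)
      · exact h2
    filter_upwards [self_mem_nhdsWithin] with t ht
    rw [map_add, map_smul, smul_eq_mul]
    have := mul_pos (show 0 < t from ht) h1
    linarith [(hv i hi).1]

lemma InC.unique (hF : Facet u h F) (hG : Facet u h G) {ξ v : Fin d → ℝ} (hξ : GenV u ξ)
    (hv : InC u ξ F v) (hv' : InC u ξ G v) : F = G := by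
  obtain ⟨t, h1, h2⟩ := ((hv.eventually hF.1 hξ).and (hv'.eventually hG.1 hξ)).exists
  exact hF.unique hG h1 h2

lemma Face.mono {s t : Finset ι} (ht : Face u h t) (hst : s ⊆ t) : Face u h s := by
  obtain ⟨F, hF, h1⟩ := ht
  exact ⟨F, hF, hst.trans h1⟩

lemma Facet.face (hF : Facet u h F) : Face u h F := ⟨F, hF, Finset.Subset.refl _⟩

open Filter Topology in
/-- strictly tight functional -/
lemma Face.tight {s : Finset ι} (hs : Face u h s) :
    ∃ y : Dual ℝ (Fin d → ℝ), (∀ i ∈ s, y (u i) = h i) ∧ ∀ i, i ∉ s → y (u i) < h i := by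
  obtain ⟨F, hF, hsF⟩ := hs
  set z : Dual ℝ (Fin d → ℝ) := ∑ i ∈ F \ s, co u F i with hz
  have hev : ∀ᶠ t in 𝓝[>] (0:ℝ), ∀ k, k ∉ F → ht u h F (u k) - t * z (u k) < h k := by
    rw [eventually_all]; intro k
    by_cases hk : k ∈ F
    · simp [hk]
    · have h3 : Tendsto (fun t : ℝ => ht u h F (u k) - t * z (u k)) (𝓝[>] 0)
          (𝓝 (ht u h F (u k) - 0 * z (u k))) :=
        ((by fun_prop : Continuous fun t : ℝ => ht u h F (u k) - t * z (u k)).tendsto 0).mono_left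
            nhdsWithin_le_nhds
      rw [zero_mul, sub_zero] at h3
      exact (h3.eventually (gt_mem_nhds (hF.2 k hk))).mono fun t ht _ => ht
  obtain ⟨t, h1, h2⟩ := (hev.and self_mem_nhdsWithin).exists
  have hzs : ∀ i ∈ F, z (u i) = if i ∈ s then 0 else 1 := by
    intro i hi
    rw [hz, LinearMap.sum_apply]
    split_ifs with his
    · refine Finset.sum_eq_zero fun j hj => ?_
      rw [Finset.mem_sdiff] at hj
      exact hF.1.co_ne hj.1 hi (by rintro rfl; exact hj.2 his)
    · rw [Finset.sum_eq_single i]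
      · exact hF.1.co_self hi
      · intro j hj hji
        rw [Finset.mem_sdiff] at hj
        exact hF.1.co_ne hj.1 hi hji
      · intro hh; exact absurd (Finset.mem_sdiff.2 ⟨hi, his⟩) hh
  refine ⟨ht u h F - t • z, fun i hi => ?_, fun i hi => ?_⟩
  · simp [hF.1.ht_eq (hsF hi), hzs i (hsF hi), hi]
  · by_cases hiF : i ∈ F
    · simp [hF.1.ht_eq hiF, hzs i hiF, hi]; exact h2
    · exact h1 i hiF

/-- restriction set interval -/
lemma Face.exists_Rs (S : Sys u h) (ξ : Fin d → ℝ) {s : Finset ι} (hs : Face u h s) :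
    ∃ F, Facet u h F ∧ Rs u ξ F ⊆ s ∧ s ⊆ F := by
  classical
  obtain ⟨F0, hF0, hs0⟩ := hs
  obtain ⟨F, hFm, hmax⟩ := (univ.filter fun F => Facet u h F ∧ s ⊆ F).exists_max_image
    (fun F => ht u h F ξ) ⟨F0, by simp [hF0, hs0]⟩
  simp only [Finset.mem_filter, Finset.mem_univ, true_and] at hFm hmax
  refine ⟨F, hFm.1, fun i hi => ?_, hFm.2⟩
  rw [mem_Rs] at hi
  by_contra his
  obtain ⟨j, hj, hF', -, r, hr, hht⟩ := hFm.1.neighbor S hi.1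
  have := hmax _ ⟨hF', fun k hk => Finset.mem_insert_of_mem (Finset.mem_erase.2
    ⟨by rintro rfl; exact his hk, hFm.2 hk⟩)⟩
  rw [hht] at this
  simp only [LinearMap.sub_apply, LinearMap.smul_apply, smul_eq_mul] at this
  nlinarith [mul_neg_of_pos_of_neg hr hi.2]

/-- connectivity of stars -/
lemma star_connected (S : Sys u h) {X : Type*} (x : Finset ι → X) (t : Finset ι)
    (hx : ∀ F, Facet u h F → t ⊆ F → ∀ i ∈ F, i ∉ t → ∀ j, j ∉ F →
      Facet u h (insert j (F.erase i)) → x (insert j (F.erase i)) = x F)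
    (hF : Facet u h F) (hG : Facet u h G) (htF : t ⊆ F) (htG : t ⊆ G) : x F = x G := by
  classical
  by_contra hne
  set w := ∑ k ∈ G, (1:ℝ) • u k with hw
  have hGw : ∀ i ∈ G, co u G i w = 1 := fun i hi => hG.1.coeff_eq (fun _ => 1) hi
  obtain ⟨K, hKm, hmax⟩ := (univ.filter fun F => (Facet u h F ∧ t ⊆ F) ∧ x F ≠ x G).exists_max_image
    (fun F => ht u h F w) ⟨F, by simp [hF, htF, hne]⟩
  simp only [Finset.mem_filter, Finset.mem_univ, true_and] at hKm hmax
  obtain ⟨⟨hK, htK⟩, hxK⟩ := hKm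
  have hKG : G ≠ K := by rintro rfl; exact hxK rfl
  have h1 := hG.ht_strict hK (w := w) (fun i hi => Or.inl (by rw [hGw i hi]; norm_num)) hKG
  have h2 : ∃ i ∈ K, i ∉ t ∧ co u K i w < 0 := by
    by_contra! hcon
    have := hK.ht_mono hG (w := w) (fun i hi => by
      by_cases hit : i ∈ t
      · exact Or.inr (htG hit)
      · exact Or.inl (hcon i hi hit))
    linarith
  obtain ⟨i, hi, hit, hneg⟩ := h2
  obtain ⟨j, hj, hF', -, r, hr, hht⟩ := hK.neighbor S hi
  have := hmax _ ⟨⟨hF', fun k hk => Finset.mem_insert_of_mem (Finset.mem_erase.2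
    ⟨by rintro rfl; exact hit hk, htK hk⟩)⟩, by rw [hx K hK htK i hi hit j hj hF']; exact hxK⟩
  rw [hht] at this
  simp only [LinearMap.sub_apply, LinearMap.smul_apply, smul_eq_mul] at this
  nlinarith [mul_neg_of_pos_of_neg hr hneg]

/-- connectivity of link vertices -/
lemma link_connected (S : Sys u h) {X : Type*} (x : ι → X) (t : Finset ι) (hd : t.card + 2 ≤ d)
    (hx : ∀ i j, i ∉ t → j ∉ t → i ≠ j → Face u h (insert j (insert i t)) → x i = x j)
    {i j : ι} (hi : i ∉ t) (hj : j ∉ t) (hFi : Face u h (insert i t)) (hFj : Face u h (insert j t)) :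
    x i = x j := by
  classical
  obtain ⟨F, hF, hiF⟩ := hFi
  obtain ⟨G, hG, hjG⟩ := hFj
  have hin : ∀ F, Facet u h F → t ⊆ F → ∀ i ∈ F, i ∉ t → ∀ j ∈ F, j ∉ t → x i = x j := by
    intro F hF htF i hi hit j hj hjt
    by_cases hij : i = j
    · rw [hij]
    · refine hx i j hit hjt hij ⟨F, hF, ?_⟩
      intro k hk
      simp only [Finset.mem_insert] at hk
      rcases hk with rfl | rfl | hk
      · exact hj
      · exact hi
      · exact htF hk
  have key := star_connected S (fun F => {a | ∃ i ∈ F, i ∉ t ∧ x i = a}) t (F := F) (G := G) (by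
    intro F hF htF i hi hit j hj hF'
    have hjt : j ∉ t := fun hh => hj (htF hh)
    obtain ⟨k, hk⟩ : ((F \ t).erase i).Nonempty := by
      rw [← Finset.card_pos, Finset.card_erase_of_mem (by simp [hi, hit]),
        Finset.card_sdiff_of_subset htF, hF.1.card]
      omega
    simp only [Finset.mem_erase, Finset.mem_sdiff] at hk
    have htF' : t ⊆ insert j (F.erase i) := fun l hl => Finset.mem_insert_of_mem
      (Finset.mem_erase.2 ⟨by rintro rfl; exact hit hl, htF hl⟩)
    have hkF' : k ∈ insert j (F.erase i) := by simp [hk]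
    ext a
    constructor
    · rintro ⟨l, hl, hlt, rfl⟩
      exact ⟨k, hk.2.1, hk.2.2, hin _ hF' htF' k hkF' hk.2.2 l hl hlt⟩
    · rintro ⟨l, hl, hlt, rfl⟩
      exact ⟨k, hkF', hk.2.2, hin _ hF htF k hk.2.1 hk.2.2 l hl hlt⟩) hF hG
      ((Finset.subset_insert _ _).trans hiF) ((Finset.subset_insert _ _).trans hjG)
  have h1 : x i ∈ {a | ∃ i ∈ F, i ∉ t ∧ x i = a} := ⟨i, hiF (Finset.mem_insert_self _ _), hi, rfl⟩
  have key' : {a | ∃ i ∈ F, i ∉ t ∧ x i = a} = {a | ∃ i ∈ G, i ∉ t ∧ x i = a} := key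
  rw [key'] at h1
  obtain ⟨l, hl, hlt, hla⟩ := h1
  rw [← hla]
  exact hin G hG ((Finset.subset_insert _ _).trans hjG) l hl hlt j
    (hjG (Finset.mem_insert_self _ _)) hj

end FanTwo


section Weights

variable {d : ℕ} {ι : Type} [Fintype ι] [DecidableEq ι]
variable {u : ι → Fin d → ℝ} {h : ι → ℝ} {F G : Finset ι}

/-- balanced weights -/
structure Bal (u : ι → Fin d → ℝ) (h : ι → ℝ) (ω : Finset ι → ℝ) : Prop where
  supp : ∀ s, ¬ Face u h s → ω s = 0
  bal : ∀ t, Face u h t → ∀ z : Dual ℝ (Fin d → ℝ), (∀ i ∈ t, z (u i) = 0) →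
    ∑ i ∈ tᶜ, ω (insert i t) * z (u i) = 0

open Classical in
/-- a linear extension of `φ` restricted to `t` -/
noncomputable def lext (u : ι → Fin d → ℝ) (φ : ι → ℝ) (t : Finset ι) : Dual ℝ (Fin d → ℝ) :=
  if hy : ∃ y : Dual ℝ (Fin d → ℝ), ∀ i ∈ t, y (u i) = φ i then hy.choose else 0

open Classical in
/-- product of piecewise linear function with a weight -/
noncomputable def prd (u : ι → Fin d → ℝ) (h : ι → ℝ) (φ : ι → ℝ) (ω : Finset ι → ℝ)
    (t : Finset ι) : ℝ :=
  if Face u h t then ∑ i ∈ tᶜ, ω (insert i t) * (φ i - lext u φ t (u i)) else 0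

lemma Face.exists_ext {t : Finset ι} (ht : Face u h t) (φ : ι → ℝ) :
    ∃ y : Dual ℝ (Fin d → ℝ), ∀ i ∈ t, y (u i) = φ i := by
  obtain ⟨F, hF, htF⟩ := ht
  exact ⟨_root_.ht u φ F, fun i hi => hF.1.ht_eq (htF hi)⟩

lemma prd_eq {ω : Finset ι → ℝ} (hω : Bal u h ω) {t : Finset ι} (ht : Face u h t) (φ : ι → ℝ)
    (y : Dual ℝ (Fin d → ℝ)) (hy : ∀ i ∈ t, y (u i) = φ i) :
    prd u h φ ω t = ∑ i ∈ tᶜ, ω (insert i t) * (φ i - y (u i)) := by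
  have hex := ht.exists_ext φ
  have h1 : ∀ i ∈ t, lext u φ t (u i) = φ i := by
    unfold lext; rw [dif_pos hex]; exact hex.choose_spec
  have h2 := hω.bal t ht (lext u φ t - y) (fun i hi => by simp [h1 i hi, hy i hi])
  unfold prd
  rw [if_pos ht, ← sub_eq_zero, ← neg_eq_zero, ← h2, ← Finset.sum_sub_distrib,
    ← Finset.sum_neg_distrib]
  refine Finset.sum_congr rfl fun i _ => ?_
  simp only [LinearMap.sub_apply]; ring

lemma prd_not {ω : Finset ι → ℝ} {t : Finset ι} (ht : ¬ Face u h t) (φ : ι → ℝ) :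
    prd u h φ ω t = 0 := by
  unfold prd; rw [if_neg ht]

lemma prd_lin {ω : Finset ι → ℝ} (hω : Bal u h ω) (y : Dual ℝ (Fin d → ℝ)) :
    prd u h (fun i => y (u i)) ω = 0 := by
  funext t
  by_cases ht : Face u h t
  · rw [prd_eq hω ht _ y (fun _ _ => rfl)]; simp
  · rw [prd_not ht]; rfl

lemma prd_comb {ω : Finset ι → ℝ} (hω : Bal u h ω) (a b : ι → ℝ) (r s : ℝ) (t : Finset ι) :
    prd u h (fun i => r * a i + s * b i) ω t = r * prd u h a ω t + s * prd u h b ω t := by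
  by_cases ht : Face u h t
  · obtain ⟨y, hy⟩ := ht.exists_ext a
    obtain ⟨z, hz⟩ := ht.exists_ext b
    rw [prd_eq hω ht a y hy, prd_eq hω ht b z hz, prd_eq hω ht _ (r • y + s • z)
      (fun i hi => by simp [hy i hi, hz i hi]), Finset.mul_sum, Finset.mul_sum,
      ← Finset.sum_add_distrib]
    refine Finset.sum_congr rfl fun i _ => ?_
    simp only [LinearMap.add_apply, LinearMap.smul_apply, smul_eq_mul]; ring
  · simp [prd_not ht]

lemma prd_comb_right {ω ω' : Finset ι → ℝ} (a : ι → ℝ) (r s : ℝ) (t : Finset ι) :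
    prd u h a (fun x => r * ω x + s * ω' x) t = r * prd u h a ω t + s * prd u h a ω' t := by
  unfold prd
  split_ifs
  · rw [Finset.mul_sum, Finset.mul_sum, ← Finset.sum_add_distrib]
    refine Finset.sum_congr rfl fun i _ => ?_
    ring
  · simp

/-- The matrix of a weight around a face. -/
lemma exists_matrix {ω : Finset ι → ℝ} (hω : Bal u h ω) {t : Finset ι} (ht : Face u h t) :
    ∃ M : ι → ι → ℝ, (∀ i j, M i j = M j i) ∧
      (∀ i j, i ∉ t → j ∉ t → i ≠ j → M i j = ω (insert j (insert i t))) ∧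
      (∀ i j, (i ∈ t ∨ ¬ Face u h (insert i t)) → M i j = 0) ∧
      (∀ (φ : ι → ℝ) (y : Dual ℝ (Fin d → ℝ)), (∀ i ∈ t, y (u i) = φ i) → ∀ i, i ∉ t →
        prd u h φ ω (insert i t) = ∑ j, M i j * (φ j - y (u j))) := by
  classical
  have hE : ∀ i, ∃ e : Dual ℝ (Fin d → ℝ), i ∉ t → Face u h (insert i t) →
      e (u i) = 1 ∧ ∀ k ∈ t, e (u k) = 0 := by
    intro i
    by_cases hi : i ∉ t ∧ Face u h (insert i t)
    · obtain ⟨y, hy⟩ := hi.2.exists_ext (fun k => if k = i then 1 else 0)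
      refine ⟨y, fun _ _ => ⟨by rw [hy i (by simp)]; simp, fun k hk => ?_⟩⟩
      rw [hy k (by simp [hk]), if_neg (by rintro rfl; exact hi.1 hk)]
    · exact ⟨0, fun h1 h2 => absurd ⟨h1, h2⟩ hi⟩
  choose e he using hE
  let M : ι → ι → ℝ := fun i j => if i ∈ t ∨ j ∈ t then 0 else
    if i = j then - ∑ k ∈ (insert i t)ᶜ, ω (insert k (insert i t)) * e i (u k)
    else ω (insert j (insert i t))
  have hcl : ∀ i j, ¬ Face u h (insert i t) → ω (insert j (insert i t)) = 0 := fun i j hn =>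
    hω.supp _ fun hf => hn (hf.mono (Finset.subset_insert _ _))
  refine ⟨M, ?_, ?_, ?_, ?_⟩
  · intro i j
    by_cases hij : i = j
    · rw [hij]
    · simp only [M, hij, Ne.symm hij, if_false, or_comm (a := i ∈ t), Finset.insert_comm i j]
  · intro i j hi hj hij
    simp [M, hi, hj, hij]
  · rintro i j (hi | hi)
    · simp [M, hi]
    · simp only [M]
      split_ifs
      · rfl
      · rw [Finset.sum_eq_zero, neg_zero]
        intro k _; rw [hcl i k hi, zero_mul]
      · exact hcl i j hi
  · intro φ y hy i hi
    by_cases hf : Face u h (insert i t)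
    · obtain ⟨he1, he2⟩ := he i hi hf
      rw [prd_eq hω hf φ (y + (φ i - y (u i)) • e i)]
      · have h1 : ∑ j, M i j * (φ j - y (u j)) =
            ∑ j ∈ insert i (insert i t)ᶜ, M i j * (φ j - y (u j)) := by
          symm
          apply Finset.sum_subset (Finset.subset_univ _)
          intro j _ hj
          have : j ∈ t := by
            by_contra hjt
            apply hj
            simp only [Finset.mem_insert, Finset.mem_compl, not_or]
            tauto
          simp [M, this]
        rw [h1, Finset.sum_insert (by simp)]
        have h2 : M i i = - ∑ k ∈ (insert i t)ᶜ, ω (insert k (insert i t)) * e i (u k) := by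
          simp [M, hi]
        rw [h2, neg_mul, Finset.sum_mul, ← Finset.sum_neg_distrib, ← Finset.sum_add_distrib]
        refine Finset.sum_congr rfl fun j hj => ?_
        simp only [Finset.mem_compl, Finset.mem_insert, not_or] at hj
        have h3 : M i j = ω (insert j (insert i t)) := by simp [M, hi, hj.2, Ne.symm hj.1]
        rw [h3]
        simp only [LinearMap.add_apply, LinearMap.smul_apply, smul_eq_mul]
        ring
      · intro k hk
        rcases Finset.mem_insert.1 hk with rfl | hk
        · simp [he1]
        · simp [he2 k hk, hy k hk]
    · rw [prd_not hf, Finset.sum_eq_zero]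
      intro j _
      have : M i j = 0 := by
        simp only [M]
        split_ifs
        · rfl
        · rw [Finset.sum_eq_zero, neg_zero]
          intro k _; rw [hcl i k hf, zero_mul]
        · exact hcl i j hf
      rw [this, zero_mul]

lemma matrix_kill {ω : Finset ι → ℝ} (hω : Bal u h ω) {t : Finset ι} {M : ι → ι → ℝ}
    (hM : (∀ (φ : ι → ℝ) (y : Dual ℝ (Fin d → ℝ)), (∀ i ∈ t, y (u i) = φ i) → ∀ i, i ∉ t →
        prd u h φ ω (insert i t) = ∑ j, M i j * (φ j - y (u j))))
    (z : Dual ℝ (Fin d → ℝ)) (hz : ∀ i ∈ t, z (u i) = 0) (i : ι) (hi : i ∉ t) :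
    ∑ j, M i j * z (u j) = 0 := by
  have h1 := hM (fun k => z (u k)) 0 (fun i hi => by simp [hz i hi]) i hi
  rw [prd_lin hω] at h1
  simpa using h1.symm

lemma sum_compl_mat {t : Finset ι} {M : ι → ι → ℝ} (hM0 : ∀ i j, i ∈ t → M i j = 0) (f g : ι → ℝ) :
    ∑ i ∈ tᶜ, (∑ j, M i j * f j) * g i = ∑ i, ∑ j, g i * M i j * f j := by
  have : ∑ i, ∑ j, g i * M i j * f j = ∑ i ∈ tᶜ, ∑ j, g i * M i j * f j := by
    symm
    apply Finset.sum_subset (Finset.subset_univ _)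
    intro i _ hi
    simp only [Finset.mem_compl, not_not] at hi
    exact Finset.sum_eq_zero fun j _ => by rw [hM0 i j hi]; ring
  rw [this]
  refine Finset.sum_congr rfl fun i _ => ?_
  rw [Finset.sum_mul]
  refine Finset.sum_congr rfl fun j _ => by ring

lemma Bal.prd {ω : Finset ι → ℝ} (hω : Bal u h ω) (φ : ι → ℝ) : Bal u h (prd u h φ ω) := by
  refine ⟨fun s hs => prd_not hs φ, fun t ht z hz => ?_⟩
  obtain ⟨M, hsym, hoff, h0, hM⟩ := exists_matrix hω ht
  obtain ⟨y, hy⟩ := ht.exists_ext φ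
  have h1 : ∑ i ∈ tᶜ, _root_.prd u h φ ω (insert i t) * z (u i) =
      ∑ i ∈ tᶜ, (∑ j, M i j * (φ j - y (u j))) * z (u i) :=
    Finset.sum_congr rfl fun i hi => by rw [hM φ y hy i (by simpa using hi)]
  rw [h1, sum_compl_mat (fun i j hi => h0 i j (Or.inl hi)), Finset.sum_comm]
  refine Finset.sum_eq_zero fun j _ => ?_
  rw [← Finset.sum_mul]
  by_cases hj : j ∈ t
  · rw [hy j hj]; simp
  · have := matrix_kill hω hM z hz j hj
    rw [Finset.sum_congr rfl (fun i _ => by rw [hsym i j, mul_comm]), this, zero_mul]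

/-- quadratic form formula -/
lemma prd_prd {ω : Finset ι → ℝ} (hω : Bal u h ω) {t : Finset ι} (ht : Face u h t)
    {M : ι → ι → ℝ} (h0 : ∀ i j, (i ∈ t ∨ ¬ Face u h (insert i t)) → M i j = 0)
    (hM : (∀ (φ : ι → ℝ) (y : Dual ℝ (Fin d → ℝ)), (∀ i ∈ t, y (u i) = φ i) → ∀ i, i ∉ t →
        prd u h φ ω (insert i t) = ∑ j, M i j * (φ j - y (u j))))
    (φ ψ : ι → ℝ) (y z : Dual ℝ (Fin d → ℝ)) (hy : ∀ i ∈ t, y (u i) = φ i)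
    (hz : ∀ i ∈ t, z (u i) = ψ i) :
    prd u h ψ (prd u h φ ω) t =
      ∑ i, ∑ j, (ψ i - z (u i)) * M i j * (φ j - y (u j)) := by
  rw [prd_eq (hω.prd φ) ht ψ z hz, ← sum_compl_mat (fun i j hi => h0 i j (Or.inl hi))]
  exact Finset.sum_congr rfl fun i hi => by rw [hM φ y hy i (by simpa using hi)]

lemma prd_comm {ω : Finset ι → ℝ} (hω : Bal u h ω) (φ ψ : ι → ℝ) :
    prd u h ψ (prd u h φ ω) = prd u h φ (prd u h ψ ω) := by
  funext t
  by_cases ht : Face u h t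
  · obtain ⟨M, hsym, hoff, h0, hM⟩ := exists_matrix hω ht
    obtain ⟨y, hy⟩ := ht.exists_ext φ
    obtain ⟨z, hz⟩ := ht.exists_ext ψ
    rw [prd_prd hω ht h0 hM φ ψ y z hy hz, prd_prd hω ht h0 hM ψ φ z y hz hy, Finset.sum_comm]
    refine Finset.sum_congr rfl fun i _ => Finset.sum_congr rfl fun j _ => ?_
    rw [hsym]; ring
  · rw [prd_not ht, prd_not ht]

/-- determination by restriction sets -/
lemma Bal.determined (S : Sys u h) {ω : Finset ι → ℝ} (hω : Bal u h ω) {ξ : Fin d → ℝ}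
    (hξ : GenV u ξ) (k : ℕ)
    (hR : ∀ F, Facet u h F → (Rs u ξ F).card = k → ω (Rs u ξ F) = 0)
    (s : Finset ι) (hs : s.card = k) : ω s = 0 := by
  classical
  by_contra hne
  have hsf : Face u h s := by
    by_contra hh; exact hne (hω.supp s hh)
  obtain ⟨F0, hF0, h1, h2⟩ := hsf.exists_Rs S ξ
  obtain ⟨F, hFm, hmin⟩ := (univ.filter fun F => Facet u h F ∧
      ∃ s, Rs u ξ F ⊆ s ∧ s ⊆ F ∧ s.card = k ∧ ω s ≠ 0).exists_min_image
    (fun F => ht u h F ξ) ⟨F0, by simp only [Finset.mem_filter, Finset.mem_univ, true_and]; exact ⟨hF0, s, h1, h2, hs, hne⟩⟩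
  simp only [Finset.mem_filter, Finset.mem_univ, true_and] at hFm hmin
  obtain ⟨hF, s, hRs, hsF, hsk, hsω⟩ := hFm
  have hnR : s ≠ Rs u ξ F := by
    rintro rfl; exact hsω (hR F hF hsk)
  obtain ⟨i, his, hiR⟩ := Finset.not_subset.1 fun hh => hnR (Finset.Subset.antisymm hh hRs)
  set t := s.erase i with ht
  have htF : t ⊆ F := (Finset.erase_subset _ _).trans hsF
  have hins : insert i t = s := Finset.insert_erase his
  have hbal := hω.bal t ⟨F, hF, htF⟩ (co u F i) (fun j hj =>
    hF.1.co_ne (hsF his) (htF hj) (Finset.ne_of_mem_erase hj).symm)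
  rw [Finset.sum_eq_single i] at hbal
  · rw [hins, hF.1.co_self (hsF his), mul_one] at hbal
    exact hsω hbal
  · intro j hj hji
    have hjt : j ∉ t := by simpa using hj
    by_cases hjF : j ∈ F
    · rw [hF.1.co_ne (hsF his) hjF (Ne.symm hji), mul_zero]
    · have : ω (insert j t) = 0 := by
        by_contra hjω
        have hjf : Face u h (insert j t) := by
          by_contra hh; exact hjω (hω.supp _ hh)
        obtain ⟨G, hG, h3, h4⟩ := hjf.exists_Rs S ξ
        have hck : (insert j t).card = k := by
          rw [Finset.card_insert_of_notMem hjt, ht, Finset.card_erase_of_mem his, hsk]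
          have : 0 < s.card := Finset.card_pos.2 ⟨i, his⟩
          omega
        have h5 := hmin G ⟨hG, _, h3, h4, hck, hjω⟩
        have h6 := hF.ht_strict hG (w := ξ) (fun l hl => by
          rcases lt_trichotomy (co u F l ξ) 0 with hlt | hlt | hlt
          · right
            have hlR : l ∈ Rs u ξ F := mem_Rs.2 ⟨hl, hlt⟩
            apply h4
            apply Finset.mem_insert_of_mem
            exact Finset.mem_erase.2 ⟨by rintro rfl; exact hiR hlR, hRs hlR⟩
          · exact absurd hlt (hF.1.co_gen_ne hξ hl)
          · exact Or.inl hlt) (by rintro rfl; exact hjF (h4 (Finset.mem_insert_self _ _)))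
        linarith
      rw [this, zero_mul]
  · intro hh
    exact absurd (by simp [ht]) hh

end Weights


section SigmaW

variable {d : ℕ} {ι : Type} [Fintype ι] [DecidableEq ι]
variable {u : ι → Fin d → ℝ} {h : ι → ℝ} {F G : Finset ι}

/-- enumerations -/
def Enum (F : Finset ι) (e : Fin d → ι) : Prop :=
  Function.Injective e ∧ Finset.univ.image e = F

lemma Enum.det_abs {e e' : Fin d → ι} (he : Enum F e) (he' : Enum F e') (u : ι → Fin d → ℝ) :
    |(Matrix.of fun a => u (e a)).det| = |(Matrix.of fun a => u (e' a)).det| := by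
  have hr : Set.range e = Set.range e' := by
    have h1 : (F : Set ι) = Set.range e := by rw [← he.2]; simp
    have h2 : (F : Set ι) = Set.range e' := by rw [← he'.2]; simp
    rw [← h1, h2]
  let σ : Equiv.Perm (Fin d) := (Equiv.ofInjective e he.1).trans
    ((Equiv.setCongr hr).trans (Equiv.ofInjective e' he'.1).symm)
  have hσ : ∀ a, e' (σ a) = e a := fun a => by
    exact Equiv.apply_ofInjective_symm he'.1 _
  have h3 : (Matrix.of fun a => u (e a)) = (Matrix.of fun a => u (e' a)).submatrix σ id := by
    ext a b; simp [hσ]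
  rw [h3, Matrix.det_permute, abs_mul]
  rcases Int.units_eq_one_or (Equiv.Perm.sign σ) with hs | hs <;> simp [hs]

open Classical in
/-- normalized volume -/
noncomputable def vol (u : ι → Fin d → ℝ) (F : Finset ι) : ℝ :=
  if hF : ∃ e : Fin d → ι, Enum F e then |(Matrix.of fun a => u (hF.choose a)).det| else 0

lemma Enum.vol_eq {e : Fin d → ι} (he : Enum F e) :
    vol u F = |(Matrix.of fun a => u (e a)).det| := by
  have hF : ∃ e : Fin d → ι, Enum F e := ⟨e, he⟩
  unfold vol; rw [dif_pos hF]
  exact Enum.det_abs hF.choose_spec he u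

lemma Bas.exists_enum (hF : Bas u F) : ∃ e : Fin d → ι, Enum F e := by
  let e := (F.equivFinOfCardEq hF.card).symm
  refine ⟨fun a => (e a : ι), fun a b hab => e.injective (Subtype.ext hab), ?_⟩
  ext i
  simp only [Finset.mem_image, Finset.mem_univ, true_and]
  constructor
  · rintro ⟨a, rfl⟩; exact (e a).2
  · intro hi; exact ⟨e.symm ⟨i, hi⟩, by simp⟩

lemma Enum.sum {e : Fin d → ι} (he : Enum F e) {V : Type*} [AddCommMonoid V] (f : ι → V) :
    ∑ i ∈ F, f i = ∑ a, f (e a) := by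
  rw [← he.2, Finset.sum_image (fun a _ b _ hab => he.1 hab)]

lemma Bas.vol_pos (hF : Bas u F) : 0 < vol u F := by
  obtain ⟨e, he⟩ := hF.exists_enum
  rw [he.vol_eq, abs_pos]
  have h1 : LinearIndependent ℝ (fun a => u (e a)) := by
    have hm : ∀ a, e a ∈ F := fun a => by rw [← he.2]; simp
    exact hF.linInd.comp (fun a => (⟨e a, hm a⟩ : F)) (fun a b hab => he.1 (by simpa using hab))
  have h2 : IsUnit (Matrix.of fun a => u (e a)) :=
    Matrix.linearIndependent_rows_iff_isUnit.1 h1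
  exact ((Matrix.isUnit_iff_isUnit_det _).1 h2).ne_zero

lemma Bas.vol_pivot (hF : Bas u F) {i j : ι} (hi : i ∈ F) (hj : j ∉ F) :
    vol u (insert j (F.erase i)) = |co u F i (u j)| * vol u F := by
  obtain ⟨e, he⟩ := hF.exists_enum
  have hi' := hi
  rw [← he.2] at hi'
  simp only [Finset.mem_image, Finset.mem_univ, true_and] at hi'
  obtain ⟨a, ha⟩ := hi'
  have hm : ∀ a, e a ∈ F := fun a => by rw [← he.2]; simp
  have he' : Enum (insert j (F.erase i)) (Function.update e a j) := by
    constructor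
    · intro b c hbc
      by_cases hb : b = a <;> by_cases hc : c = a
      · rw [hb, hc]
      · subst hb; simp [Function.update_of_ne hc] at hbc
        exact absurd (hbc ▸ hm c) hj
      · subst hc; simp [Function.update_of_ne hb] at hbc
        exact absurd (hbc ▸ hm b) hj
      · simp only [Function.update_of_ne hb, Function.update_of_ne hc] at hbc
        exact he.1 hbc
    · ext k
      simp only [Finset.mem_image, Finset.mem_univ, true_and, Finset.mem_insert, Finset.mem_erase]
      constructor
      · rintro ⟨b, rfl⟩
        by_cases hb : b = a
        · subst hb; simp
        · right
          rw [Function.update_of_ne hb]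
          exact ⟨fun hh => hb (he.1 (hh.trans ha.symm)), hm b⟩
      · rintro (rfl | ⟨hk, hkF⟩)
        · exact ⟨a, by simp⟩
        · rw [← he.2] at hkF
          simp only [Finset.mem_image, Finset.mem_univ, true_and] at hkF
          obtain ⟨b, rfl⟩ := hkF
          exact ⟨b, by rw [Function.update_of_ne]; rintro rfl; exact hk ha⟩
  rw [he'.vol_eq, he.vol_eq]
  have h1 : (Matrix.of fun b => u (Function.update e a j b)) =
      (Matrix.of fun b => u (e b)).updateRow a
        (∑ b, co u F (e b) (u j) • (Matrix.of fun b => u (e b)) b) := by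
    have : ∑ b, co u F (e b) (u j) • (Matrix.of fun b => u (e b)) b = u j := by
      refine Eq.trans ?_ (hF.sum_co (u j))
      rw [he.sum]; rfl
    rw [this]
    ext b c
    by_cases hb : b = a
    · subst hb; simp
    · simp [Matrix.updateRow_apply, hb]
  rw [h1, Matrix.det_updateRow_sum, smul_eq_mul, abs_mul, ha]

open Classical in
/-- fundamental weight -/
noncomputable def Sig (u : ι → Fin d → ℝ) (h : ι → ℝ) (F : Finset ι) : ℝ :=
  if Facet u h F then (vol u F)⁻¹ else 0

lemma Facet.two (hF : Facet u h F) {i j k : ι} (hi : i ∈ F) (hj : j ∉ F)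
    (hF' : Facet u h (insert j (F.erase i))) (hneg : co u F i (u j) < 0)
    (hk : k ∉ F.erase i) (hG : Facet u h (insert k (F.erase i))) : k = i ∨ k = j := by
  by_contra! hcon
  have hkF : k ∉ F := fun hh => hk (Finset.mem_erase.2 ⟨hcon.1, hh⟩)
  have hjm : j ∉ F.erase i := fun hh => hj (Finset.mem_of_mem_erase hh)
  have hone : ∀ (G : Finset ι), Facet u h G → F.erase i ⊆ G → k ∉ G → ∃ K0 : ℝ, ∀ K, K0 < K →
      ∀ l ∈ F.erase i, 0 < co u G l (u k + ∑ m ∈ F.erase i, K • u m) := by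
    intro G hG hs hkG
    refine ⟨∑ l ∈ F.erase i, |co u G l (u k)|, fun K hK l hl => ?_⟩
    rw [map_add, map_sum, Finset.sum_eq_single l]
    · rw [map_smul, hG.1.co_self (hs hl), smul_eq_mul, mul_one]
      have h1 := Finset.single_le_sum (f := fun l => |co u G l (u k)|) (fun _ _ => abs_nonneg _) hl
      have h2 := neg_abs_le (co u G l (u k))
      linarith
    · intro m hm hml
      rw [map_smul, hG.1.co_ne (hs hl) (hs hm) hml.symm, smul_zero]
    · intro hh; exact absurd hl hh
  have hvan : ∀ K : ℝ, co u F i (∑ m ∈ F.erase i, K • u m) = 0 := by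
    intro K
    rw [map_sum]
    refine Finset.sum_eq_zero fun m hm => ?_
    rw [map_smul, hF.1.co_ne hi (Finset.mem_of_mem_erase hm) (Finset.ne_of_mem_erase hm).symm,
      smul_zero]
  have hGco : ∀ K : ℝ, 0 < K → ∀ l ∈ insert k (F.erase i), 0 < co u (insert k (F.erase i)) l
      (u k + ∑ m ∈ F.erase i, K • u m) := by
    intro K hK l hl
    have : u k + ∑ m ∈ F.erase i, K • u m =
        ∑ m ∈ insert k (F.erase i), (if m = k then 1 else K) • u m := by
      rw [Finset.sum_insert hk, if_pos rfl, one_smul]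
      congr 1
      refine Finset.sum_congr rfl fun m hm => ?_
      rw [if_neg (by rintro rfl; exact hk hm)]
    rw [this, hG.1.coeff_eq _ hl]
    split_ifs <;> linarith
  rcases lt_trichotomy (co u F i (u k)) 0 with hlt | hlt | hlt
  · -- same as F'
    have hkF' : k ∉ insert j (F.erase i) := by
      simp only [Finset.mem_insert, not_or]; exact ⟨hcon.2, hk⟩
    obtain ⟨K0, hK0⟩ := hone _ hF' (Finset.subset_insert _ _) hkF'
    set K := |K0| + 1 with hK
    have hKp : 0 < K := by positivity
    have hKK : K0 < K := by have := le_abs_self K0; linarith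
    have hco : co u (insert j (F.erase i)) j = (co u F i (u j))⁻¹ • co u F i := by
      apply hF'.1.dual_ext
      intro l hl
      rcases Finset.mem_insert.1 hl with rfl | hl'
      · rw [hF'.1.co_self hl]; simp [hneg.ne]
      · rw [hF'.1.co_ne (Finset.mem_insert_self _ _) hl (by rintro rfl; exact hjm hl')]
        simp [hF.1.co_ne hi (Finset.mem_of_mem_erase hl') (Finset.ne_of_mem_erase hl').symm]
    have := hF'.unique hG (w := u k + ∑ m ∈ F.erase i, K • u m) (fun l hl => by
      rcases Finset.mem_insert.1 hl with rfl | hl'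
      · rw [hco, LinearMap.smul_apply, map_add, hvan, add_zero, smul_eq_mul]
        exact mul_pos_of_neg_of_neg (inv_lt_zero.2 hneg) hlt
      · exact hK0 K hKK l hl') (hGco K hKp)
    exact hkF' (this ▸ Finset.mem_insert_self _ _)
  · have h1 := hG.1.dual_apply (co u F i) (u i)
    rw [hF.1.co_self hi, Finset.sum_eq_zero] at h1
    · exact one_ne_zero h1
    · intro l hl
      rcases Finset.mem_insert.1 hl with rfl | hl'
      · rw [hlt, mul_zero]
      · rw [hF.1.co_ne hi (Finset.mem_of_mem_erase hl') (Finset.ne_of_mem_erase hl').symm, mul_zero]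
  · obtain ⟨K0, hK0⟩ := hone _ hF (Finset.erase_subset _ _) hkF
    set K := |K0| + 1 with hK
    have hKp : 0 < K := by positivity
    have hKK : K0 < K := by have := le_abs_self K0; linarith
    have := hF.unique hG (w := u k + ∑ m ∈ F.erase i, K • u m) (fun l hl => by
      by_cases hli : l = i
      · rw [hli, map_add, hvan, add_zero]; exact hlt
      · exact hK0 K hKK l (Finset.mem_erase.2 ⟨hli, hl⟩)) (hGco K hKp)
    exact hkF (this ▸ Finset.mem_insert_self _ _)

lemma Sig.bal (S : Sys u h) : Bal u h (Sig u h) := by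
  refine ⟨fun s hs => ?_, fun t ht z hz => ?_⟩
  · unfold Sig; rw [if_neg]; exact fun hh => hs hh.face
  · by_cases hall : ∀ i ∈ tᶜ, ¬ Facet u h (insert i t)
    · refine Finset.sum_eq_zero fun i hi => ?_
      unfold Sig; rw [if_neg (hall i hi), zero_mul]
    · push Not at hall
      obtain ⟨i, hi, hF⟩ := hall
      have hit : i ∉ t := by simpa using hi
      set F := insert i t with hFdef
      have hiF : i ∈ F := Finset.mem_insert_self _ _
      have hte : t = F.erase i := by rw [hFdef, Finset.erase_insert hit]
      obtain ⟨j, hj, hF', hneg, -⟩ := hF.neighbor S hiF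
      have hjt : j ∉ t := fun hh => hj (Finset.mem_insert_of_mem hh)
      have hij : i ≠ j := by rintro rfl; exact hj hiF
      rw [← Finset.sum_subset (s₁ := {i, j})]
      · rw [Finset.sum_pair hij]
        have hzz : z = z (u i) • co u F i := by
          apply hF.1.dual_ext
          intro l hl
          rcases Finset.mem_insert.1 hl with rfl | hl'
          · simp [hF.1.co_self hiF]
          · rw [hz l hl', LinearMap.smul_apply, hF.1.co_ne hiF hl (by rintro rfl; exact hit hl'),
              smul_zero]
        have h1 : z (u j) = z (u i) * co u F i (u j) := by
          conv_lhs => rw [hzz]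
          rfl
        have h2 : Sig u h (insert i t) = (vol u F)⁻¹ := by unfold Sig; rw [if_pos hF]
        have h3 : Sig u h (insert j t) = (- co u F i (u j) * vol u F)⁻¹ := by
          rw [hte]; unfold Sig; rw [if_pos hF', hF.1.vol_pivot hiF hj, abs_of_neg hneg]
        rw [h2, h3, h1]
        have h4 := hF.1.vol_pos.ne'
        have h5 := hneg.ne
        field_simp
        ring
      · intro k hk
        simp only [Finset.mem_insert, Finset.mem_singleton] at hk
        rcases hk with rfl | rfl <;> simpa
      · intro k hk hkn
        simp only [Finset.mem_insert, Finset.mem_singleton] at hkn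
        have : ¬ Facet u h (insert k t) := by
          intro hG
          rw [hte] at hG
          exact hkn (hF.two hiF hj hF' hneg (by rw [← hte]; simpa using hk) hG)
        unfold Sig; rw [if_neg this, zero_mul]

/-- iterated weights -/
noncomputable def Om (u : ι → Fin d → ℝ) (h : ι → ℝ) : ℕ → Finset ι → ℝ
  | 0 => Sig u h
  | m + 1 => prd u h h (Om u h m)

lemma Om.bal (S : Sys u h) : ∀ m, Bal u h (Om u h m)
  | 0 => Sig.bal S
  | m + 1 => (Om.bal S m).prd h

lemma Om.pos (S : Sys u h) : ∀ (m : ℕ) (t : Finset ι), Face u h t → t.card + m = d →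
    0 < Om u h m t
  | 0, t, ht, hc => by
    obtain ⟨F, hF, htF⟩ := ht
    have : t = F := Finset.eq_of_subset_of_card_le htF (by rw [hF.1.card]; omega)
    subst this
    unfold Om Sig; rw [if_pos hF]
    exact inv_pos.2 hF.1.vol_pos
  | m + 1, t, ht, hc => by
    obtain ⟨y, hy1, hy2⟩ := ht.tight
    unfold Om
    rw [prd_eq (Om.bal S m) ht h y hy1]
    obtain ⟨F, hF, htF⟩ := ht
    obtain ⟨i, hi⟩ : (F \ t).Nonempty := by
      rw [← Finset.card_pos, Finset.card_sdiff_of_subset htF, hF.1.card]; omega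
    rw [Finset.mem_sdiff] at hi
    have hpos : ∀ i, i ∉ t → Face u h (insert i t) → 0 < Om u h m (insert i t) := by
      intro i hi hf
      exact Om.pos S m _ hf (by rw [Finset.card_insert_of_notMem hi]; omega)
    refine Finset.sum_pos' (fun j hj => ?_) ⟨i, by simpa using hi.2, ?_⟩
    · have hjt : j ∉ t := by simpa using hj
      refine mul_nonneg ?_ (by linarith [hy2 j hjt])
      by_cases hf : Face u h (insert j t)
      · exact (hpos j hjt hf).le
      · rw [(Om.bal S m).supp _ hf]
    · exact mul_pos (hpos i hi.2 ⟨F, hF, Finset.insert_subset hi.1 htF⟩) (by linarith [hy2 i hi.2])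

end SigmaW


section HRbase

variable {d : ℕ} {ι : Type} [Fintype ι] [DecidableEq ι]
variable {u : ι → Fin d → ℝ} {h : ι → ℝ} {F G : Finset ι}

/-- Hodge-Riemann statement in degree one -/
def HR (u : ι → Fin d → ℝ) (h : ι → ℝ) (m : ℕ) : Prop :=
  ∀ t, Face u h t → t.card + m + 2 = d → ∀ a : ι → ℝ, prd u h a (Om u h (m + 1)) t = 0 →
    prd u h a (prd u h a (Om u h m)) t ≤ 0 ∧
    (prd u h a (prd u h a (Om u h m)) t = 0 →
      ∃ y : Dual ℝ (Fin d → ℝ), ∀ i, Face u h (insert i t) → a i = y (u i))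

lemma quad_formula (M D q : ι → ι → ℝ) (hD : ∀ i j, D i j = D j i) (hD0 : ∀ i, D i i = 0)
    (hM : ∀ i j, i ≠ j → M i j = D i j) (hMd : ∀ i, M i i = ∑ j, D i j * (q i j / q j i))
    (hq : ∀ i j, D i j ≠ 0 → q i j ≠ 0) (b : ι → ℝ) :
    2 * ∑ i, ∑ j, b i * M i j * b j =
      ∑ i, ∑ j, D i j / (q i j * q j i) * (b i * q i j + b j * q j i) ^ 2 := by
  have h1 : ∀ i j, D i j / (q i j * q j i) * (b i * q i j + b j * q j i) ^ 2 =
      (b i * D i j * b j + b i ^ 2 * (D i j * (q i j / q j i))) +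
      (b j * D j i * b i + b j ^ 2 * (D j i * (q j i / q i j))) := by
    intro i j
    by_cases h0 : D i j = 0
    · rw [← hD i j, h0]; simp
    · have h2 := hq i j h0
      have h3 := hq j i (by rwa [← hD i j])
      rw [← hD i j]
      field_simp
      ring
  have h2 : ∑ i, ∑ j, b i * M i j * b j =
      ∑ i, ∑ j, (b i * D i j * b j + b i ^ 2 * (D i j * (q i j / q j i))) := by
    refine Finset.sum_congr rfl fun i _ => ?_
    rw [Finset.sum_add_distrib, ← Finset.mul_sum, ← hMd i,
      ← Finset.add_sum_erase _ _ (Finset.mem_univ i),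
      ← Finset.add_sum_erase univ (fun j => b i * D i j * b j) (Finset.mem_univ i), hD0]
    have : ∑ j ∈ univ.erase i, b i * M i j * b j = ∑ j ∈ univ.erase i, b i * D i j * b j :=
      Finset.sum_congr rfl fun j hj => by rw [hM i j (Finset.ne_of_mem_erase hj).symm]
    rw [this]; ring
  simp only [h1, Finset.sum_add_distrib (f := fun i => _ + _), Finset.sum_add_distrib] at h2 ⊢
  rw [h2]
  have h3 : ∑ i, ∑ j, b j * D j i * b i = ∑ i, ∑ j, b i * D i j * b j := Finset.sum_comm
  have h4 : ∑ i, ∑ j, b j ^ 2 * (D j i * (q j i / q i j)) =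
      ∑ i, ∑ j, b i ^ 2 * (D i j * (q i j / q j i)) := Finset.sum_comm
  rw [h3, h4]; ring

lemma star_unique {t : Finset ι} (hF : Facet u h F) (hG : Facet u h G) (htF : t ⊆ F) (htG : t ⊆ G)
    {w : Fin d → ℝ} (h1 : ∀ i ∈ F, i ∉ t → 0 < co u F i w) (h2 : ∀ i ∈ G, i ∉ t → 0 < co u G i w) :
    F = G := by
  have key : ∀ G, Facet u h G → t ⊆ G → (∀ i ∈ G, i ∉ t → 0 < co u G i w) →
      ∃ K0 : ℝ, ∀ K, K0 < K → ∀ i ∈ G, 0 < co u G i (w + ∑ k ∈ t, K • u k) := by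
    intro G hG htG hpos
    refine ⟨∑ l ∈ t, |co u G l w|, fun K hK i hi => ?_⟩
    rw [map_add, map_sum]
    by_cases hit : i ∈ t
    · rw [Finset.sum_eq_single i]
      · rw [map_smul, hG.1.co_self hi, smul_eq_mul, mul_one]
        have h1 := Finset.single_le_sum (f := fun l => |co u G l w|) (fun _ _ => abs_nonneg _) hit
        have h2 := neg_abs_le (co u G i w)
        linarith
      · intro m hm hml
        rw [map_smul, hG.1.co_ne hi (htG hm) hml.symm, smul_zero]
      · intro hh; exact absurd hit hh
    · rw [Finset.sum_eq_zero, add_zero]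
      · exact hpos i hi hit
      · intro m hm
        rw [map_smul, hG.1.co_ne hi (htG hm) (by rintro rfl; exact hit hm), smul_zero]
  obtain ⟨K1, hK1⟩ := key F hF htF h1
  obtain ⟨K2, hK2⟩ := key G hG htG h2
  have e1 : K1 < |K1| + |K2| + 1 := by
    have := le_abs_self K1; have := abs_nonneg K2; linarith
  have e2 : K2 < |K1| + |K2| + 1 := by
    have := le_abs_self K2; have := abs_nonneg K1; linarith
  exact hF.unique hG (hK1 _ e1) (hK2 _ e2)

lemma exists_star_max {t : Finset ι} (ht : Face u h t) (w : Fin d → ℝ) :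
    ∃ F, Facet u h F ∧ t ⊆ F ∧ ∀ G, Facet u h G → t ⊆ G →
      (∀ i ∈ G, i ∉ t → 0 < co u G i w) → G = F := by
  by_cases hex : ∃ F, Facet u h F ∧ t ⊆ F ∧ (∀ i ∈ F, i ∉ t → 0 < co u F i w)
  · obtain ⟨F, hF, htF, hpos⟩ := hex
    exact ⟨F, hF, htF, fun G hG htG hGp => star_unique hG hF htG htF hGp hpos⟩
  · obtain ⟨F, hF, htF⟩ := ht
    exact ⟨F, hF, htF, fun G hG htG hGp => absurd ⟨G, hG, htG, hGp⟩ hex⟩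

/-- main sign lemma in dimension two -/
lemma base_sign (S : Sys u h) {t : Finset ι} (ht : Face u h t) (hc : t.card + 2 = d)
    {ξ : Fin d → ℝ} (hξ : GenV u ξ) {Fp Fm : Finset ι}
    (hFm : Facet u h Fm) (htm : t ⊆ Fm)
    (hp : ∀ G, Facet u h G → t ⊆ G → (∀ i ∈ G, i ∉ t → 0 < co u G i ξ) → G = Fp)
    (hm : ∀ G, Facet u h G → t ⊆ G → (∀ i ∈ G, i ∉ t → 0 < co u G i (-ξ)) → G = Fm)
    (a : ι → ℝ) (hZ : _root_.ht u a Fp ξ = _root_.ht u a Fm ξ) :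
    prd u h a (prd u h a (Sig u h)) t ≤ 0 ∧ (prd u h a (prd u h a (Sig u h)) t = 0 →
      ∀ G, Facet u h G → t ⊆ G → _root_.ht u a G ξ = _root_.ht u a Fm ξ) := by
  classical
  have hω := Sig.bal S
  obtain ⟨M, hsym, hoff, h0, hM⟩ := exists_matrix hω ht
  set y := _root_.ht u a Fm with hy
  have hya : ∀ i ∈ t, y (u i) = a i := fun i hi => hFm.1.ht_eq (htm hi)
  rw [prd_prd hω ht h0 hM a a y y hya hya]
  set b : ι → ℝ := fun i => a i - y (u i) with hb
  have hbt : ∀ i ∈ t, b i = 0 := fun i hi => by simp [hb, hya i hi]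
  let D : ι → ι → ℝ := fun i j => if i ∉ t ∧ j ∉ t ∧ i ≠ j then Sig u h (insert j (insert i t)) else 0
  let q : ι → ι → ℝ := fun i j => co u (insert j (insert i t)) i ξ
  have hq' : ∀ i j, q j i = co u (insert j (insert i t)) j ξ := fun i j => by
    simp only [q]; rw [Finset.insert_comm]
  have hDne : ∀ i j, D i j ≠ 0 → i ∉ t ∧ j ∉ t ∧ i ≠ j ∧ Facet u h (insert j (insert i t)) := by
    intro i j hD
    simp only [D] at hD
    split_ifs at hD with hh
    · refine ⟨hh.1, hh.2.1, hh.2.2, ?_⟩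
      by_contra hn
      apply hD; unfold Sig; rw [if_neg hn]
    · exact absurd rfl hD
  have hDpos : ∀ i j, 0 ≤ D i j := by
    intro i j
    simp only [D]
    split_ifs
    · unfold Sig
      split_ifs with hf
      · exact (inv_pos.2 hf.1.vol_pos).le
      · exact le_rfl
    · exact le_rfl
  have hDpos' : ∀ i j, i ∉ t → j ∉ t → i ≠ j → Facet u h (insert j (insert i t)) → 0 < D i j := by
    intro i j hi hj hij hf
    have : D i j = Sig u h (insert j (insert i t)) := by simp [D, hi, hj, hij]
    rw [this]; unfold Sig; rw [if_pos hf]; exact inv_pos.2 hf.1.vol_pos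
  have hval : ∀ (z : ι → ℝ), (∀ k ∈ t, z k = 0) → ∀ i j, i ∉ t → j ∉ t → i ≠ j →
      ∑ k ∈ insert j (insert i t), co u (insert j (insert i t)) k ξ * z k = z i * q i j + z j * q j i := by
    intro z hz i j hi hj hij
    rw [Finset.sum_insert (by simp [hj, Ne.symm hij]), Finset.sum_insert hi,
      Finset.sum_eq_zero (s := t) (fun k hk => by rw [hz k hk, mul_zero]), hq' i j]
    simp only [q]; ring
  have hquad := quad_formula M D q (by
      intro i j
      by_cases hij : i = j
      · rw [hij]
      · simp only [D]; rw [Finset.insert_comm i j]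
        congr 1
        simp only [eq_iff_iff]; tauto) (by intro i; simp [D]) (by
      intro i j hij
      by_cases hi : i ∈ t
      · rw [h0 i j (Or.inl hi)]; simp [D, hi]
      by_cases hj : j ∈ t
      · rw [hsym, h0 j i (Or.inl hj)]; simp [D, hj]
      rw [hoff i j hi hj hij]; simp [D, hi, hj, hij]) (by
      intro i
      by_cases hi : i ∈ t ∨ ¬ Face u h (insert i t)
      · rw [h0 i i hi, Finset.sum_eq_zero]
        intro j _
        have : D i j = 0 := by
          by_contra hne
          obtain ⟨h1, h2, h3, h4⟩ := hDne i j hne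
          rcases hi with hi | hi
          · exact h1 hi
          · exact hi (h4.face.mono (Finset.subset_insert _ _))
        rw [this, zero_mul]
      · push Not at hi
        obtain ⟨hit, F, hF, hiF⟩ := hi
        obtain ⟨l, hl⟩ : (F \ insert i t).Nonempty := by
          rw [← Finset.card_pos, Finset.card_sdiff_of_subset hiF, hF.1.card,
            Finset.card_insert_of_notMem hit]; omega
        rw [Finset.mem_sdiff, Finset.mem_insert, not_or] at hl
        have hiF' : i ∈ F := hiF (Finset.mem_insert_self _ _)
        set e : Dual ℝ (Fin d → ℝ) := co u F i - (co u F i ξ / co u F l ξ) • co u F l with he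
        have he1 : e (u i) = 1 := by
          simp [he, hF.1.co_self hiF', hF.1.co_ne hl.1 hiF' hl.2.1]
        have he0 : ∀ k ∈ t, e (u k) = 0 := by
          intro k hk
          have hkF : k ∈ F := hiF (Finset.mem_insert_of_mem hk)
          simp [he, hF.1.co_ne hl.1 hkF (by rintro rfl; exact hl.2.2 hk),
            hF.1.co_ne hiF' hkF (by rintro rfl; exact hit hk)]
        have heξ : e ξ = 0 := by
          have := hF.1.co_gen_ne hξ hl.1
          simp [he, this]
        have hk := matrix_kill hω hM e he0 i hit
        rw [← Finset.add_sum_erase _ _ (Finset.mem_univ i), he1, mul_one] at hk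
        rw [eq_neg_of_add_eq_zero_left hk, ← Finset.add_sum_erase univ _ (Finset.mem_univ i)]
        have : D i i = 0 := by simp [D]
        rw [this, zero_mul, zero_add, ← Finset.sum_neg_distrib]
        refine Finset.sum_congr rfl fun j hj => ?_
        have hji := Finset.ne_of_mem_erase hj
        by_cases hjt : j ∈ t
        · rw [he0 j hjt]; simp [D, hjt]
        · have hMD : M i j = D i j := by
            rw [hoff i j hit hjt hji.symm]; simp [D, hit, hjt, hji.symm]
          rw [hMD]
          by_cases hD : D i j = 0
          · rw [hD]; ring
          · obtain ⟨-, -, -, h4⟩ := hDne i j hD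
            have h5 := h4.1.dual_apply e ξ
            rw [heξ, hval (fun k => e (u k)) he0 i j hit hjt hji.symm] at h5
            simp only [he1] at h5
            have h6 : q j i ≠ 0 := by
              rw [hq']; exact h4.1.co_gen_ne hξ (Finset.mem_insert_self _ _)
            have h7 : q i j / q j i = - e (u j) := by
              rw [div_eq_iff h6]; linarith
            rw [h7]; ring) (by
      intro i j hD
      obtain ⟨-, -, -, h4⟩ := hDne i j hD
      exact h4.1.co_gen_ne hξ (by simp)) b
  have hht : ∀ i j, i ∉ t → j ∉ t → i ≠ j → Facet u h (insert j (insert i t)) →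
      b i * q i j + b j * q j i = _root_.ht u a (insert j (insert i t)) ξ - y ξ := by
    intro i j hi hj hij hf
    rw [← hval b hbt i j hi hj hij, hf.1.dual_apply y ξ, ht_apply, ← Finset.sum_sub_distrib]
    refine Finset.sum_congr rfl fun k _ => ?_
    simp only [hb]; ring
  have hterm : ∀ i j, D i j / (q i j * q j i) * (b i * q i j + b j * q j i) ^ 2 ≤ 0 := by
    intro i j
    by_cases hD : D i j = 0
    · rw [hD]; simp
    · obtain ⟨hi, hj, hij, h4⟩ := hDne i j hD
      have hsub : t ⊆ insert j (insert i t) := (Finset.subset_insert _ _).trans (Finset.subset_insert _ _)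
      have hqi : q i j ≠ 0 := h4.1.co_gen_ne hξ (by simp)
      have hqj : q j i ≠ 0 := by rw [hq']; exact h4.1.co_gen_ne hξ (by simp)
      by_cases hs : 0 < q i j * q j i
      · have hz : b i * q i j + b j * q j i = 0 := by
          rw [hht i j hi hj hij h4]
          rcases pos_and_pos_or_neg_and_neg_of_mul_pos hs with ⟨h5, h6⟩ | ⟨h5, h6⟩
          · rw [hp _ h4 hsub, hZ, sub_self]
            intro k hk hkt
            simp only [Finset.mem_insert] at hk
            rcases hk with rfl | rfl | hk
            · rw [← hq']; exact h6
            · exact h5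
            · exact absurd hk hkt
          · rw [hm _ h4 hsub, sub_self]
            intro k hk hkt
            rw [map_neg, neg_pos]
            simp only [Finset.mem_insert] at hk
            rcases hk with rfl | rfl | hk
            · rw [← hq']; exact h6
            · exact h5
            · exact absurd hk hkt
        rw [hz]; simp
      · exact mul_nonpos_of_nonpos_of_nonneg
          (div_nonpos_of_nonneg_of_nonpos (hDpos i j) (not_lt.1 hs)) (sq_nonneg _)
  have hsum : ∑ i, ∑ j, D i j / (q i j * q j i) * (b i * q i j + b j * q j i) ^ 2 ≤ 0 :=
    Finset.sum_nonpos fun i _ => Finset.sum_nonpos fun j _ => hterm i j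
  refine ⟨by linarith, fun heq G hG htG => ?_⟩
  have hsum0 : ∑ i, ∑ j, D i j / (q i j * q j i) * (b i * q i j + b j * q j i) ^ 2 = 0 := by
    rw [← hquad, heq, mul_zero]
  obtain ⟨i, j, hij, hGij⟩ : ∃ i j, i ≠ j ∧ G \ t = {i, j} := by
    rw [← Finset.card_eq_two, Finset.card_sdiff_of_subset htG, hG.1.card]; omega
  have hiG : i ∈ G \ t := by rw [hGij]; simp
  have hjG : j ∈ G \ t := by rw [hGij]; simp
  rw [Finset.mem_sdiff] at hiG hjG
  have hGe : insert j (insert i t) = G := by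
    ext k
    by_cases hkt : k ∈ t
    · simp [hkt, htG hkt]
    · have : k ∈ G ↔ k ∈ G \ t := by simp [hkt]
      rw [this, hGij]; simp [hkt, or_comm]
  rw [Finset.sum_eq_zero_iff_of_nonpos (fun i _ => Finset.sum_nonpos fun j _ => hterm i j)] at hsum0
  have h1 := hsum0 i (Finset.mem_univ i)
  rw [Finset.sum_eq_zero_iff_of_nonpos (fun j _ => hterm i j)] at h1
  have h2 := h1 j (Finset.mem_univ j)
  have hf : Facet u h (insert j (insert i t)) := by rw [hGe]; exact hG
  have hqi : q i j ≠ 0 := hf.1.co_gen_ne hξ (by simp)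
  have hqj : q j i ≠ 0 := by rw [hq']; exact hf.1.co_gen_ne hξ (by simp)
  rcases mul_eq_zero.1 h2 with h3 | h3
  · exact absurd h3 (div_ne_zero (hDpos' i j hiG.2 hjG.2 hij hf).ne' (mul_ne_zero hqi hqj))
  · have h4 := pow_eq_zero_iff (two_ne_zero) |>.1 h3
    rw [hht i j hiG.2 hjG.2 hij hf, hGe] at h4
    linarith

lemma prd_quad {ω : Finset ι → ℝ} (hω : Bal u h ω) (a b : ι → ℝ) (r s : ℝ) (t : Finset ι) :
    prd u h (fun i => r * a i + s * b i) (prd u h (fun i => r * a i + s * b i) ω) t =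
      r ^ 2 * prd u h a (prd u h a ω) t + 2 * r * s * prd u h a (prd u h b ω) t +
      s ^ 2 * prd u h b (prd u h b ω) t := by
  have h1 : prd u h (fun i => r * a i + s * b i) ω =
      fun x => r * prd u h a ω x + s * prd u h b ω x := by
    funext x; exact prd_comb hω a b r s x
  rw [prd_comb (hω.prd _), h1, prd_comb_right, prd_comb_right, prd_comm hω a b]
  ring

lemma HR_zero (S : Sys u h) : HR u h 0 := by
  classical
  intro t ht hc a ha
  obtain ⟨ξ, hξ, hav⟩ := exists_genV (u := u)
    {p | (∃ FG : Finset ι × Finset ι, LinearMap.ker (_root_.ht u a FG.1 - _root_.ht u a FG.2) = p) ∧ p ≠ ⊤}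
    ((Set.finite_range _).subset fun p hp => hp.1) (fun p hp => hp.2)
  obtain ⟨Fp, hFp, htp, hp⟩ := exists_star_max ht ξ
  obtain ⟨Fm, hFm, htm, hm⟩ := exists_star_max ht (-ξ)
  have key := fun a hZ => base_sign S ht (by omega) hξ hFm htm hp hm a hZ
  set Z : (ι → ℝ) → ℝ := fun a => _root_.ht u a Fp ξ - _root_.ht u a Fm ξ with hZdef
  have hlin : ∀ (a b : ι → ℝ) (r s : ℝ) (F : Finset ι),
      _root_.ht u (fun i => r * a i + s * b i) F ξ = r * _root_.ht u a F ξ + s * _root_.ht u b F ξ := by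
    intro a b r s F
    simp only [ht_apply, Finset.mul_sum, ← Finset.sum_add_distrib]
    exact Finset.sum_congr rfl fun i _ => by ring
  have hω := Sig.bal S
  have hhh : 0 < prd u h h (prd u h h (Sig u h)) t := Om.pos S 2 t ht (by omega)
  have ha' : prd u h a (prd u h h (Sig u h)) t = 0 := ha
  have hk := (key (fun i => Z h * a i + (- Z a) * h i) (by
    rw [hlin, hlin]; simp only [hZdef]; ring)).1
  rw [prd_quad hω, ha'] at hk
  have hmain : 0 ≤ prd u h a (prd u h a (Sig u h)) t → Z a = 0 := by
    intro h1
    by_contra hne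
    have h2 : 0 < (Z a) ^ 2 := by positivity
    have h3 := mul_pos h2 hhh
    have h4 := mul_nonneg (sq_nonneg (Z h)) h1
    nlinarith
  show prd u h a (prd u h a (Sig u h)) t ≤ 0 ∧ (prd u h a (prd u h a (Sig u h)) t = 0 → _)
  constructor
  · by_contra! hgt
    have := (key a (sub_eq_zero.1 (hmain hgt.le))).1
    linarith
  · intro h0
    have h1 := (key a (sub_eq_zero.1 (hmain h0.ge))).2 h0
    refine ⟨_root_.ht u a Fm, fun i hi => ?_⟩
    obtain ⟨G, hG, hiG⟩ := hi
    have h2 := h1 G hG ((Finset.subset_insert _ _).trans hiG)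
    have h3 : LinearMap.ker (_root_.ht u a G - _root_.ht u a Fm) = ⊤ := by
      by_contra hne
      refine hav _ ⟨⟨(G, Fm), rfl⟩, hne⟩ ?_
      rw [LinearMap.mem_ker, LinearMap.sub_apply, h2, sub_self]
    rw [LinearMap.ker_eq_top, sub_eq_zero] at h3
    rw [← h3, hG.1.ht_eq (hiG (Finset.mem_insert_self _ _))]

end HRbase


section LinAlg

variable {ι : Type} [Fintype ι] [DecidableEq ι]

open Matrix in
lemma spec_lemma (N : Matrix ι ι ℝ) (hN : N.IsHermitian) (v : ι → ℝ)
    (h1 : ∀ x : ι → ℝ, x ⬝ᵥ (N *ᵥ x) ≤ (N *ᵥ x) ⬝ᵥ (N *ᵥ x))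
    (h2 : ∀ x : ι → ℝ, x ⬝ᵥ (N *ᵥ x) ≤ x ⬝ᵥ x)
    (h3 : ∀ x : ι → ℝ, N *ᵥ x = x → ∃ c : ℝ, x = c • v)
    (x : ι → ℝ) (hx : v ⬝ᵥ x = 0) :
    x ⬝ᵥ (N *ᵥ x) ≤ 0 ∧ (x ⬝ᵥ (N *ᵥ x) = 0 → N *ᵥ x = 0) := by
  classical
  let e : ι → ι → ℝ := fun k => (hN.eigenvectorBasis k).ofLp
  let l : ι → ℝ := hN.eigenvalues
  have he : ∀ k, N *ᵥ (e k) = l k • e k := fun k => hN.mulVec_eigenvectorBasis k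
  have hee : ∀ k, e k ⬝ᵥ e k = 1 := by
    intro k
    have := hN.eigenvectorBasis.orthonormal.1 k
    have h4 : inner ℝ (hN.eigenvectorBasis k) (hN.eigenvectorBasis k) = (1:ℝ) := by
      rw [real_inner_self_eq_norm_sq, this]; norm_num
    rw [EuclideanSpace.inner_eq_star_dotProduct] at h4
    simpa using h4
  have hpars : ∀ a b : ι → ℝ, a ⬝ᵥ b = ∑ k, (e k ⬝ᵥ a) * (e k ⬝ᵥ b) := by
    intro a b
    have := hN.eigenvectorBasis.sum_inner_mul_inner (WithLp.toLp 2 a) (WithLp.toLp 2 b)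
    simp only [EuclideanSpace.inner_eq_star_dotProduct] at this
    simp at this
    rw [dotProduct_comm a b, ← this]
    refine Finset.sum_congr rfl fun k _ => ?_
    rw [dotProduct_comm b]
  have hsym : ∀ a b : ι → ℝ, a ⬝ᵥ (N *ᵥ b) = (N *ᵥ a) ⬝ᵥ b := by
    intro a b
    rw [dotProduct_mulVec, ← mulVec_transpose]
    have : Nᵀ = N := by simpa [IsHermitian] using hN
    rw [this]
  have hek : ∀ k, e k ⬝ᵥ (N *ᵥ x) = l k * (e k ⬝ᵥ x) := by
    intro k
    rw [hsym, he, smul_dotProduct, smul_eq_mul]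
  have hl : ∀ k, l k ≤ 0 ∨ l k = 1 := by
    intro k
    have q1 := h1 (e k)
    have q2 := h2 (e k)
    rw [he] at q1 q2
    simp only [smul_dotProduct, dotProduct_smul, hee, smul_eq_mul, mul_one] at q1 q2
    by_contra! hcon
    have : l k < 1 := lt_of_le_of_ne q2 hcon.2
    nlinarith [hcon.1]
  have hterm : ∀ k, l k * (e k ⬝ᵥ x) ^ 2 ≤ 0 := by
    intro k
    rcases hl k with h | h
    · nlinarith [sq_nonneg (e k ⬝ᵥ x)]
    · obtain ⟨c, hc⟩ := h3 (e k) (by rw [he, h, one_smul])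
      rw [hc, smul_dotProduct, hx]; simp
  have hsum : x ⬝ᵥ (N *ᵥ x) = ∑ k, l k * (e k ⬝ᵥ x) ^ 2 := by
    rw [hpars]
    refine Finset.sum_congr rfl fun k _ => ?_
    rw [hek]; ring
  refine ⟨by rw [hsum]; exact Finset.sum_nonpos fun k _ => hterm k, fun h0 => ?_⟩
  rw [hsum, Finset.sum_eq_zero_iff_of_nonpos (fun k _ => hterm k)] at h0
  rw [← dotProduct_self_eq_zero, hpars]
  refine Finset.sum_eq_zero fun k _ => ?_
  rw [hek]
  have := h0 k (Finset.mem_univ k)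
  rcases mul_eq_zero.1 this with h | h
  · rw [h]; ring
  · rw [pow_eq_zero_iff two_ne_zero] at h; rw [h]; ring

lemma la_lemma (M : ι → ι → ℝ) (p l : ι → ℝ) (S : Finset ι)
    (hsym : ∀ i j, M i j = M j i) (h0 : ∀ i j, i ∉ S → M i j = 0)
    (hp : ∀ i, 0 < p i) (hl : ∀ i ∈ S, 0 < l i) (hl0 : ∀ i, i ∉ S → l i = 0)
    (hMl : ∀ i, ∑ j, M i j * l j = p i * l i)
    (hoff : ∀ i ∈ S, ∀ j ∈ S, i ≠ j → 0 ≤ M i j)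
    (hconn : ∀ f : ι → ℝ, (∀ i ∈ S, ∀ j ∈ S, i ≠ j → 0 < M i j → f i = f j) →
      ∀ i ∈ S, ∀ j ∈ S, f i = f j)
    (hQ : ∀ a : ι → ℝ, ∑ i, ∑ j, a i * M i j * a j ≤ ∑ i, (∑ j, M i j * a j) ^ 2 / p i)
    (a : ι → ℝ) (ha : ∑ i, p i * l i * a i = 0) :
    ∑ i, ∑ j, a i * M i j * a j ≤ 0 ∧
      (∑ i, ∑ j, a i * M i j * a j = 0 → ∀ i, ∑ j, M i j * a j = 0) := by
  have hcol : ∀ i j, j ∉ S → M i j = 0 := fun i j hj => by rw [hsym]; exact h0 j i hj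
  set r : ι → ℝ := fun i => Real.sqrt (p i) with hr
  have hrp : ∀ i, 0 < r i := fun i => Real.sqrt_pos.2 (hp i)
  have hr2 : ∀ i, r i * r i = p i := fun i => Real.mul_self_sqrt (hp i).le
  let N : Matrix ι ι ℝ := fun i j => M i j / (r i * r j)
  have hNH : N.IsHermitian := by
    ext i j
    rw [Matrix.conjTranspose_apply, star_trivial]
    change M j i / (r j * r i) = M i j / (r i * r j)
    rw [hsym j i, mul_comm]
  have hNx : ∀ a : ι → ℝ, ∀ i, (N.mulVec fun i => r i * a i) i = (∑ j, M i j * a j) / r i := by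
    intro a i
    simp only [Matrix.mulVec, dotProduct, N]
    rw [Finset.sum_div]
    refine Finset.sum_congr rfl fun j _ => ?_
    have := (hrp j).ne'; have := (hrp i).ne'
    field_simp
  have hxNx : ∀ a : ι → ℝ, dotProduct (fun i => r i * a i) (N.mulVec fun i => r i * a i) =
      ∑ i, ∑ j, a i * M i j * a j := by
    intro a
    simp only [dotProduct, hNx]
    refine Finset.sum_congr rfl fun i _ => ?_
    rw [mul_div_assoc', mul_assoc, mul_div_cancel_left₀ _ (hrp i).ne', Finset.mul_sum]
    exact Finset.sum_congr rfl fun j _ => by ring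
  have hrep : ∀ x : ι → ℝ, x = fun i => r i * (x i / r i) := by
    intro x; funext i; rw [mul_div_cancel₀ _ (hrp i).ne']
  -- ground state identity
  have hterm : ∀ a : ι → ℝ, ∀ i j, M i j * (l i * l j) * (a i / l i - a j / l j) ^ 2 =
      M i j * l j * (a i ^ 2 / l i) + M j i * l i * (a j ^ 2 / l j) - 2 * (a i * M i j * a j) := by
    intro a i j
    by_cases hi : i ∈ S
    · by_cases hj : j ∈ S
      · have := (hl i hi).ne'; have := (hl j hj).ne'
        rw [hsym j i]
        field_simp
        ring
      · rw [hcol i j hj, h0 j i hj]; ring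
    · rw [h0 i j hi, hcol j i hi]; ring
  have hground : ∀ a : ι → ℝ, ∑ i, p i * a i ^ 2 - ∑ i, ∑ j, a i * M i j * a j =
      (∑ i, ∑ j, M i j * (l i * l j) * (a i / l i - a j / l j) ^ 2) / 2 +
        ∑ i, (if i ∈ S then 0 else p i * a i ^ 2) := by
    intro a
    simp only [hterm, Finset.sum_sub_distrib, Finset.sum_add_distrib]
    have e1 : ∑ i, ∑ j, M j i * l i * (a j ^ 2 / l j) = ∑ i, ∑ j, M i j * l j * (a i ^ 2 / l i) :=
      Finset.sum_comm
    have e2 : ∑ i, ∑ j, M i j * l j * (a i ^ 2 / l i) + ∑ i, (if i ∈ S then 0 else p i * a i ^ 2) =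
        ∑ i, p i * a i ^ 2 := by
      rw [← Finset.sum_add_distrib]
      refine Finset.sum_congr rfl fun i _ => ?_
      rw [← Finset.sum_mul, hMl]
      split_ifs with hi
      · have := (hl i hi).ne'
        field_simp; ring
      · rw [hl0 i hi]; ring
    have e3 : ∑ i, ∑ j, 2 * (a i * M i j * a j) = 2 * ∑ i, ∑ j, a i * M i j * a j := by
      simp only [Finset.mul_sum]
    rw [e1, e3, ← e2]; ring
  have hnn : ∀ a : ι → ℝ, ∀ i j, 0 ≤ M i j * (l i * l j) * (a i / l i - a j / l j) ^ 2 := by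
    intro a i j
    by_cases hij : i = j
    · subst hij; simp
    by_cases hi : i ∈ S
    · by_cases hj : j ∈ S
      · exact mul_nonneg (mul_nonneg (hoff i hi j hj hij) (mul_pos (hl i hi) (hl j hj)).le) (sq_nonneg _)
      · rw [hcol i j hj]; simp
    · rw [h0 i j hi]; simp
  have hnn2 : ∀ a : ι → ℝ, ∀ i, 0 ≤ (if i ∈ S then 0 else p i * a i ^ 2) := by
    intro a i; split_ifs
    · exact le_rfl
    · exact mul_nonneg (hp i).le (sq_nonneg _)
  have hself : ∀ a : ι → ℝ, dotProduct (fun i => r i * a i) (fun i => r i * a i) = ∑ i, p i * a i ^ 2 := by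
    intro a
    refine Finset.sum_congr rfl fun i _ => ?_
    rw [← hr2]; ring
  have hs1 : ∀ x : ι → ℝ, dotProduct x (N.mulVec x) ≤ dotProduct (N.mulVec x) (N.mulVec x) := by
    intro x
    rw [hrep x, hxNx]
    refine (hQ _).trans (le_of_eq ?_)
    refine Finset.sum_congr rfl fun i _ => ?_
    rw [hNx, ← hr2, div_mul_div_comm, sq]
  have hs2 : ∀ x : ι → ℝ, dotProduct x (N.mulVec x) ≤ dotProduct x x := by
    intro x
    rw [hrep x, hxNx, hself]
    have q1 := hground (fun i => x i / r i)
    have q2 := Finset.sum_nonneg fun i (_ : i ∈ univ) => Finset.sum_nonneg fun j (_ : j ∈ univ) => hnn (fun i => x i / r i) i j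
    have q3 := Finset.sum_nonneg fun i (_ : i ∈ univ) => hnn2 (fun i => x i / r i) i
    linarith
  have hs3 : ∀ x : ι → ℝ, N.mulVec x = x → ∃ c : ℝ, x = c • (fun i => r i * l i) := by
    intro x hx
    have q1 := hground (fun i => x i / r i)
    set b : ι → ℝ := fun i => x i / r i with hb
    have hxb : x = fun i => r i * b i := hrep x
    have q2 := Finset.sum_nonneg fun i (_ : i ∈ univ) => Finset.sum_nonneg fun j (_ : j ∈ univ) => hnn b i j
    have q3 := Finset.sum_nonneg fun i (_ : i ∈ univ) => hnn2 b i
    have q4 : ∑ i, p i * b i ^ 2 - ∑ i, ∑ j, b i * M i j * b j = 0 := by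
      rw [← hself, ← hxNx, ← hxb, hx, sub_self]
    rw [q4] at q1
    have q5 : ∑ i, ∑ j, M i j * (l i * l j) * (b i / l i - b j / l j) ^ 2 = 0 := by linarith
    have q6 : ∑ i, (if i ∈ S then 0 else p i * b i ^ 2) = 0 := by linarith
    have hbS : ∀ i, i ∉ S → b i = 0 := by
      intro i hi
      have := (Finset.sum_eq_zero_iff_of_nonneg (fun i _ => hnn2 b i)).1 q6 i (Finset.mem_univ i)
      rw [if_neg hi] at this
      simpa [(hp i).ne'] using this
    have hc := hconn (fun i => b i / l i) (by
      intro i hi j hj hij hM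
      have h7 := (Finset.sum_eq_zero_iff_of_nonneg (fun i _ => Finset.sum_nonneg fun j _ => hnn b i j)).1 q5 i (Finset.mem_univ i)
      have h8 := (Finset.sum_eq_zero_iff_of_nonneg (fun j _ => hnn b i j)).1 h7 j (Finset.mem_univ j)
      have h9 : M i j * (l i * l j) ≠ 0 := (mul_pos hM (mul_pos (hl i hi) (hl j hj))).ne'
      rw [mul_eq_zero, or_iff_right h9, pow_eq_zero_iff two_ne_zero] at h8
      exact sub_eq_zero.1 h8)
    rcases S.eq_empty_or_nonempty with hS | ⟨k, hk⟩
    · refine ⟨0, ?_⟩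
      rw [hxb]; funext i
      simp [hbS i (by simp [hS])]
    · refine ⟨b k / l k, ?_⟩
      rw [hxb]; funext i
      simp only [Pi.smul_apply, smul_eq_mul]
      by_cases hi : i ∈ S
      · rw [hc k hk i hi]
        have := (hl i hi).ne'
        field_simp
      · rw [hbS i hi, hl0 i hi]; ring
  have hs4 : dotProduct (fun i => r i * l i) (fun i => r i * a i) = 0 := by
    rw [← ha]
    refine Finset.sum_congr rfl fun i _ => ?_
    rw [← hr2]; ring
  obtain ⟨g1, g2⟩ := spec_lemma N hNH (fun i => r i * l i) hs1 hs2 hs3 (fun i => r i * a i) hs4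
  rw [hxNx] at g1 g2
  refine ⟨g1, fun hh i => ?_⟩
  have := congrFun (g2 hh) i
  rw [hNx] at this
  simpa [(hrp i).ne'] using this

end LinAlg


section HRstep

variable {d : ℕ} {ι : Type} [Fintype ι] [DecidableEq ι]
variable {u : ι → Fin d → ℝ} {h : ι → ℝ} {F G : Finset ι}

lemma HR.quad_le (S : Sys u h) {m : ℕ} (ih : HR u h m) {t : Finset ι} (ht : Face u h t)
    (hc : t.card + m + 2 = d) (a : ι → ℝ) :
    prd u h a (prd u h a (Om u h m)) t ≤
      (prd u h a (Om u h (m + 1)) t) ^ 2 / Om u h (m + 2) t := by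
  have hL := Om.pos S (m + 2) t ht (by omega)
  set L := Om u h (m + 2) t with hLd
  set A := prd u h a (Om u h (m + 1)) t with hA
  have h1 := ih t ht hc (fun i => 1 * a i + (-(A / L)) * h i) (by
    rw [prd_comb (Om.bal S (m + 1)), ← hA]
    have : prd u h h (Om u h (m + 1)) t = L := rfl
    rw [this]; field_simp; ring)
  have h2 := h1.1
  rw [prd_quad (Om.bal S m)] at h2
  have e1 : prd u h a (prd u h h (Om u h m)) t = A := rfl
  have e2 : prd u h h (prd u h h (Om u h m)) t = L := rfl
  rw [e1, e2] at h2
  have e3 : A ^ 2 / L = 2 * (A / L) * A - (A / L) ^ 2 * L := by field_simp; ring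
  rw [e3]; linarith

open Classical in
lemma HR_step (S : Sys u h) (m : ℕ) (ih : HR u h m) : HR u h (m + 1) := by
  intro t ht hc a ha
  have hω := Om.bal S (m + 1)
  obtain ⟨M, hsym, hoff, h0, hM⟩ := exists_matrix hω ht
  obtain ⟨y, hy, hy'⟩ := ht.tight
  obtain ⟨z, hz⟩ := ht.exists_ext a
  set SS : Finset ι := univ.filter fun i => i ∉ t ∧ Face u h (insert i t) with hSS
  have hmem : ∀ i, i ∈ SS ↔ i ∉ t ∧ Face u h (insert i t) := fun i => by simp [hSS]
  have h0' : ∀ i j, i ∉ SS → M i j = 0 := by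
    intro i j hi
    apply h0
    rw [hmem] at hi
    tauto
  have hcol : ∀ i j, j ∉ SS → M i j = 0 := fun i j hj => by rw [hsym]; exact h0' j i hj
  set l : ι → ℝ := fun i => if i ∈ SS then h i - y (u i) else 0 with hl
  have hlpos : ∀ i ∈ SS, 0 < l i := by
    intro i hi
    simp only [hl, if_pos hi]
    have := hy' i ((hmem i).1 hi).1
    linarith
  set L : ι → ℝ := fun i => Om u h (m + 2) (insert i t) with hL
  have hLpos : ∀ i ∈ SS, 0 < L i := by
    intro i hi
    refine Om.pos S (m + 2) _ ((hmem i).1 hi).2 ?_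
    rw [Finset.card_insert_of_notMem ((hmem i).1 hi).1]; omega
  set p : ι → ℝ := fun i => if i ∈ SS then L i / l i else 1 with hp
  have hpl : ∀ i ∈ SS, p i * l i = L i := by
    intro i hi
    simp only [hp, if_pos hi]
    exact div_mul_cancel₀ _ (hlpos i hi).ne'
  have hMh : ∀ i ∈ SS, ∑ j, M i j * (h j - y (u j)) = L i := by
    intro i hi
    rw [← hM h y hy i ((hmem i).1 hi).1]; rfl
  have hMl : ∀ i, ∑ j, M i j * l j = p i * l i := by
    intro i
    by_cases hi : i ∈ SS
    · rw [hpl i hi, ← hMh i hi]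
      refine Finset.sum_congr rfl fun j _ => ?_
      by_cases hj : j ∈ SS
      · simp only [hl, if_pos hj]
      · rw [hcol i j hj]; ring
    · rw [Finset.sum_eq_zero fun j _ => by rw [h0' i j hi, zero_mul]]
      simp [hl, hi]
  have hoff2 : ∀ i ∈ SS, ∀ j ∈ SS, i ≠ j → Face u h (insert j (insert i t)) → 0 < M i j := by
    intro i hi j hj hij hf
    rw [hmem] at hi hj
    rw [hoff i j hi.1 hj.1 hij]
    refine Om.pos S (m + 1) _ hf ?_
    rw [Finset.card_insert_of_notMem, Finset.card_insert_of_notMem hi.1]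
    · omega
    · simp [hij.symm, hj.1]
  have hoff1 : ∀ i ∈ SS, ∀ j ∈ SS, i ≠ j → 0 ≤ M i j := by
    intro i hi j hj hij
    by_cases hf : Face u h (insert j (insert i t))
    · exact (hoff2 i hi j hj hij hf).le
    · rw [hmem] at hi hj
      rw [hoff i j hi.1 hj.1 hij, hω.supp _ hf]
  have hcard : t.card + 2 ≤ d := by omega
  have hconn : ∀ f : ι → ℝ, (∀ i ∈ SS, ∀ j ∈ SS, i ≠ j → 0 < M i j → f i = f j) →
      ∀ i ∈ SS, ∀ j ∈ SS, f i = f j := by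
    intro f hf i hi j hj
    refine link_connected S f t hcard ?_ ((hmem i).1 hi).1 ((hmem j).1 hj).1 ((hmem i).1 hi).2
      ((hmem j).1 hj).2
    intro i j hi hj hij hF
    have hi' : i ∈ SS := (hmem i).2 ⟨hi, hF.mono (Finset.subset_insert _ _)⟩
    have hj' : j ∈ SS := (hmem j).2 ⟨hj, hF.mono (by
      exact Finset.insert_subset_insert _ (Finset.subset_insert _ _))⟩
    exact hf i hi' j hj' hij (hoff2 i hi' j hj' hij hF)
  -- the main sum identity
  have hsumQ : ∀ b : ι → ℝ, prd u h b (prd u h b (Om u h (m + 1))) t =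
      ∑ i ∈ SS, prd u h b (prd u h b (Om u h m)) (insert i t) * l i := by
    intro b
    have hb := Om.bal S m
    have e1 : prd u h b (prd u h b (Om u h (m + 1))) = prd u h h (prd u h b (prd u h b (Om u h m))) := by
      change prd u h b (prd u h b (prd u h h (Om u h m))) = _
      rw [prd_comm hb h b, prd_comm (hb.prd b) h b]
    rw [e1, prd_eq ((hb.prd b).prd b) ht h y hy]
    symm
    refine (Finset.sum_subset (s₂ := tᶜ) ?_ ?_).trans (Finset.sum_congr rfl fun i hi => ?_)
    · intro i hi; rw [Finset.mem_compl]; exact ((hmem i).1 hi).1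
    · intro i _ hi; simp [hl, hi]
    · by_cases hiS : i ∈ SS
      · simp only [hl, if_pos hiS]
      · rw [prd_not, zero_mul, zero_mul]
        intro hf
        exact hiS ((hmem i).2 ⟨Finset.mem_compl.1 hi, hf⟩)
  have hQ : ∀ b : ι → ℝ, ∑ i, ∑ j, b i * M i j * b j ≤ ∑ i, (∑ j, M i j * b j) ^ 2 / p i := by
    intro b
    set b0 : ι → ℝ := fun i => if i ∈ t then 0 else b i with hb0
    have hMb0 : ∀ i j, M i j * b j = M i j * (b0 j - (0 : Dual ℝ (Fin d → ℝ)) (u j)) := by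
      intro i j
      by_cases hj : j ∈ t
      · rw [hcol i j (by rw [hmem]; tauto)]; ring
      · simp [hb0, hj]
    have hz0 : ∀ i ∈ t, (0 : Dual ℝ (Fin d → ℝ)) (u i) = b0 i := fun i hi => by simp [hb0, hi]
    have e1 : ∑ i, ∑ j, b i * M i j * b j = prd u h b0 (prd u h b0 (Om u h (m + 1))) t := by
      rw [prd_prd hω ht h0 hM b0 b0 0 0 hz0 hz0]
      refine Finset.sum_congr rfl fun i _ => Finset.sum_congr rfl fun j _ => ?_
      rw [mul_assoc, mul_assoc, ← hMb0, mul_comm (b i), mul_comm (b0 i - _), mul_right_comm,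
        mul_right_comm (M i j), hsym i j, mul_right_comm, hMb0, mul_right_comm]
    rw [e1, hsumQ]
    have e2 : ∑ i, (∑ j, M i j * b j) ^ 2 / p i = ∑ i ∈ SS, (∑ j, M i j * b j) ^ 2 / p i := by
      symm
      refine Finset.sum_subset (Finset.subset_univ _) fun i _ hi => ?_
      rw [Finset.sum_eq_zero fun j _ => by rw [h0' i j hi, zero_mul]]; simp
    rw [e2]
    refine Finset.sum_le_sum fun i hi => ?_
    have hi' := (hmem i).1 hi
    have h5 := HR.quad_le S ih hi'.2 (by rw [Finset.card_insert_of_notMem hi'.1]; omega) b0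
    have e3 : prd u h b0 (Om u h (m + 1)) (insert i t) = ∑ j, M i j * b j := by
      rw [hM b0 0 hz0 i hi'.1]
      exact Finset.sum_congr rfl fun j _ => (hMb0 i j).symm
    rw [e3] at h5
    have h6 := mul_le_mul_of_nonneg_right h5 (hlpos i hi).le
    refine h6.trans (le_of_eq ?_)
    have : Om u h (m + 2) (insert i t) = p i * l i := (hpl i hi).symm
    rw [this]
    have q1 := (hlpos i hi).ne'
    have q2 : p i ≠ 0 := by
      intro hh; have := hpl i hi; rw [hh, zero_mul] at this; exact (hLpos i hi).ne this
    field_simp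
  have hp0 : ∀ i, 0 < p i := by
    intro i
    by_cases hi : i ∈ SS
    · simp only [hp, if_pos hi]; exact div_pos (hLpos i hi) (hlpos i hi)
    · simp only [hp, if_neg hi]; exact one_pos
  have hmain := la_lemma M p l SS hsym h0' hp0 hlpos (fun i hi => by simp [hl, hi]) hMl hoff1 hconn hQ
    (fun i => a i - z (u i)) (by
      have e1 : prd u h a (Om u h (m + 1 + 1)) t = ∑ i, ∑ j, (a i - z (u i)) * M i j * (h j - y (u j)) :=
        prd_prd hω ht h0 hM h a y z hy hz
      rw [ha] at e1
      rw [e1]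
      refine Finset.sum_congr rfl fun i _ => ?_
      by_cases hi : i ∈ SS
      · rw [hpl i hi, ← hMh i hi, Finset.sum_mul]
        refine Finset.sum_congr rfl fun j _ => by ring
      · rw [Finset.sum_eq_zero fun j _ => by rw [h0' i j hi]; ring]
        simp [hl, hi])
  rw [← prd_prd hω ht h0 hM a a z z hz hz] at hmain
  refine ⟨hmain.1, fun hzero => ?_⟩
  have hMa := hmain.2 hzero
  have hA : ∀ i ∈ SS, prd u h a (Om u h (m + 1)) (insert i t) = 0 := by
    intro i hi
    rw [hM a z hz i ((hmem i).1 hi).1]; exact hMa i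
  have hih : ∀ i ∈ SS, _ := fun i hi => ih (insert i t) ((hmem i).1 hi).2
    (by rw [Finset.card_insert_of_notMem ((hmem i).1 hi).1]; omega) a (hA i hi)
  have hQ0 : ∀ i ∈ SS, prd u h a (prd u h a (Om u h m)) (insert i t) = 0 := by
    rw [hsumQ, Finset.sum_eq_zero_iff_of_nonpos] at hzero
    · intro i hi
      have := hzero i hi
      rwa [mul_eq_zero, or_iff_left (hlpos i hi).ne'] at this
    · intro i hi
      exact mul_nonpos_of_nonpos_of_nonneg (hih i hi).1 (hlpos i hi).le
  have hlin : ∀ i, ∃ w : Dual ℝ (Fin d → ℝ), i ∈ SS →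
      ∀ k, Face u h (insert k (insert i t)) → a k = w (u k) := by
    intro i
    by_cases hi : i ∈ SS
    · obtain ⟨w, hw⟩ := (hih i hi).2 (hQ0 i hi)
      exact ⟨w, fun _ => hw⟩
    · exact ⟨0, fun hh => absurd hh hi⟩
  choose w hw using hlin
  have hwc : ∀ i ∈ SS, ∀ j ∈ SS, w i = w j := by
    intro i hi j hj
    refine link_connected S w t hcard ?_ ((hmem i).1 hi).1 ((hmem j).1 hj).1 ((hmem i).1 hi).2
      ((hmem j).1 hj).2
    intro i j hi hj hij hF
    have hi' : i ∈ SS := (hmem i).2 ⟨hi, hF.mono (Finset.subset_insert _ _)⟩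
    have hj' : j ∈ SS := (hmem j).2 ⟨hj, hF.mono (by
      exact Finset.insert_subset_insert _ (Finset.subset_insert _ _))⟩
    obtain ⟨F, hF, hsub⟩ := hF
    have hiF : insert i t ⊆ F := (Finset.subset_insert _ _).trans hsub
    have hjF : insert j t ⊆ F := by
      refine Finset.Subset.trans ?_ hsub
      exact Finset.insert_subset_insert _ (Finset.subset_insert _ _)
    refine hF.1.dual_ext fun k hk => ?_
    rw [← hw i hi' k ⟨F, hF, Finset.insert_subset hk hiF⟩,
      ← hw j hj' k ⟨F, hF, Finset.insert_subset hk hjF⟩]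
  have hne : ∃ i0, i0 ∈ SS := by
    obtain ⟨F, hF, htF⟩ := ht
    have : ∃ i ∈ F, i ∉ t := by
      by_contra! hcon
      have := Finset.card_le_card hcon
      rw [hF.1.card] at this
      omega
    obtain ⟨i, hi, hit⟩ := this
    exact ⟨i, (hmem i).2 ⟨hit, F, hF, Finset.insert_subset hi htF⟩⟩
  obtain ⟨i0, hi0⟩ := hne
  refine ⟨w i0, fun i hi => ?_⟩
  by_cases hit : i ∈ t
  · exact hw i0 hi0 i (by
      rw [Finset.insert_eq_of_mem (Finset.mem_insert_of_mem hit)]; exact ((hmem i0).1 hi0).2)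
  · have hiS : i ∈ SS := (hmem i).2 ⟨hit, hi⟩
    rw [hwc i0 hi0 i hiS]
    exact hw i hiS i (by rw [Finset.insert_eq_of_mem (Finset.mem_insert_self _ _)]; exact hi)

lemma HR_all (S : Sys u h) : ∀ m, HR u h m
  | 0 => HR_zero S
  | m + 1 => HR_step S m (HR_all S m)

end HRstep


section LowerBound

variable {d : ℕ} {ι : Type} [Fintype ι] [DecidableEq ι]
variable {u : ι → Fin d → ℝ} {h : ι → ℝ} {F G : Finset ι}

lemma prd_van {ω : Finset ι → ℝ} {t : Finset ι} (φ : ι → ℝ) (h0 : ∀ i, i ∉ t → ω (insert i t) = 0) :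
    prd u h φ ω t = 0 := by
  unfold prd
  split_ifs
  · refine Finset.sum_eq_zero fun i hi => ?_
    rw [h0 i (Finset.mem_compl.1 hi), zero_mul]
  · rfl

lemma van_down (S : Sys u h) (a : ι → ℝ) (n k : ℕ)
    (h0 : ∀ s : Finset ι, s.card = k → prd u h a (Om u h n) s = 0) :
    ∀ j ≤ k, ∀ s : Finset ι, s.card = k - j → prd u h a (Om u h (n + j)) s = 0 := by
  intro j
  induction j with
  | zero => intro _ s hs; exact h0 s hs
  | succ j ih =>
    intro hj s hs
    have e : prd u h a (Om u h (n + (j + 1))) = prd u h h (prd u h a (Om u h (n + j))) := by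
      change prd u h a (prd u h h (Om u h (n + j))) = _
      rw [prd_comm (Om.bal S _)]
    rw [e]
    refine prd_van h fun i hi => ih (by omega) _ ?_
    rw [Finset.card_insert_of_notMem hi]; omega

lemma ker_lin (S : Sys u h) (hvert : ∀ i, Face u h {i}) (h0 : Face u h ∅) (a : ι → ℝ) {k : ℕ} (hk : 1 ≤ k)
    (hkd : k + 1 ≤ d) (hv : ∀ s : Finset ι, s.card = k → prd u h a (Om u h (d - k - 1)) s = 0) :
    ∃ y : Dual ℝ (Fin d → ℝ), ∀ i, a i = y (u i) := by
  have h1 := van_down S a _ k hv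
  have h2 : prd u h a (Om u h (d - 2 + 1)) ∅ = 0 := by
    have := h1 k le_rfl ∅ (by simp)
    have e : d - k - 1 + k = d - 2 + 1 := by omega
    rwa [e] at this
  have h3 : prd u h a (prd u h a (Om u h (d - 2))) ∅ = 0 := by
    refine prd_van a fun i _ => ?_
    have := h1 (k - 1) (by omega) {i} (by simp; omega)
    have e : d - k - 1 + (k - 1) = d - 2 := by omega
    rwa [e] at this
  obtain ⟨y, hy⟩ := (HR_all S (d - 2) ∅ h0 (by simp; omega) a h2).2 h3
  exact ⟨y, fun i => hy i (hvert i)⟩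

lemma face_empty (S : Sys u h) {ξ : Fin d → ℝ} (hξ : GenV u ξ) : Face u h ∅ := by
  obtain ⟨F, hF, _⟩ := exists_facet S hξ
  exact ⟨F, hF, by simp⟩

open Classical in
lemma lower_bound (S : Sys u h) {ξ : Fin d → ℝ} (hξ : GenV u ξ) (hvert : ∀ i, Face u h {i})
    {k : ℕ} (hk : 1 ≤ k) (hkd : k + 1 ≤ d) :
    Fintype.card ι ≤ d + (univ.filter fun F : Finset ι => Facet u h F ∧ (Rs u ξ F).card = k).card := by
  set FF := univ.filter fun F : Finset ι => Facet u h F ∧ (Rs u ξ F).card = k with hFF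
  have hb := Om.bal S (d - k - 1)
  let T : (ι → ℝ) →ₗ[ℝ] (FF → ℝ) :=
    { toFun := fun a F => prd u h a (Om u h (d - k - 1)) (Rs u ξ F)
      map_add' := by
        intro a b; funext F
        have := prd_comb hb a b 1 1 (Rs u ξ F)
        simp only [one_mul] at this
        exact this
      map_smul' := by
        intro r a; funext F
        have := prd_comb hb a a r 0 (Rs u ξ F)
        simp only [zero_mul, add_zero] at this
        exact this }
  let E : Dual ℝ (Fin d → ℝ) →ₗ[ℝ] (ι → ℝ) :=
    { toFun := fun y i => y (u i)
      map_add' := fun _ _ => rfl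
      map_smul' := fun _ _ => rfl }
  have hker : LinearMap.ker T ≤ LinearMap.range E := by
    intro a ha
    have ha' : ∀ F, Facet u h F → (Rs u ξ F).card = k → prd u h a (Om u h (d - k - 1)) (Rs u ξ F) = 0 := by
      intro F hF hc
      exact congrFun (LinearMap.mem_ker.1 ha) ⟨F, by simp [hFF, hF, hc]⟩
    obtain ⟨y, hy⟩ := ker_lin S hvert (face_empty S hξ) a hk hkd
      (fun s hs => (hb.prd a).determined S hξ k ha' s hs)
    exact ⟨y, funext fun i => (hy i).symm⟩
  have h1 := LinearMap.finrank_range_add_finrank_ker T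
  have h2 : finrank ℝ (LinearMap.ker T) ≤ d := by
    refine (Submodule.finrank_mono hker).trans ((LinearMap.finrank_range_le E).trans ?_)
    rw [Subspace.dual_finrank_eq]; simp
  have h3 : finrank ℝ (LinearMap.range T) ≤ FF.card := by
    refine (Submodule.finrank_le _).trans ?_
    simp
  rw [Module.finrank_fintype_fun_eq_card] at h1
  omega

lemma exists_full_Rs (S : Sys u h) {ξ : Fin d → ℝ} (hξ : GenV u ξ) :
    ∃ F, Facet u h F ∧ (Rs u ξ F).card = d := by
  obtain ⟨F, hF, hp⟩ := exists_facet S hξ.neg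
  refine ⟨F, hF, ?_⟩
  have : Rs u ξ F = F := by
    ext i
    rw [mem_Rs]
    refine ⟨fun hh => hh.1, fun hi => ⟨hi, ?_⟩⟩
    have := hp i hi
    rw [map_neg] at this; linarith
  rw [this, hF.1.card]

lemma card_gt (S : Sys u h) (hd : 1 ≤ d) {ξ : Fin d → ℝ} (hξ : GenV u ξ) : d + 1 ≤ Fintype.card ι := by
  obtain ⟨F, hF, hp⟩ := exists_facet S hξ
  have hne : F.Nonempty := by
    rw [← Finset.card_pos, hF.1.card]; omega
  obtain ⟨i, hi⟩ := hne
  obtain ⟨j, hj, _⟩ := hF.neighbor S hi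
  have := Finset.card_lt_univ_of_notMem hj
  rw [hF.1.card] at this
  omega

end LowerBound


section Heights

variable {d : ℕ} {ι : Type} [Fintype ι] [DecidableEq ι]
variable {u : ι → Fin d → ℝ} {h : ι → ℝ} {F G : Finset ι}

open Filter Topology in
lemma ev_pos {A : ℝ} (hA : 0 < A) (B : ℝ) : ∀ᶠ t in 𝓝[>] (0:ℝ), 0 < A + t * B := by
  have h3 : Tendsto (fun t : ℝ => A + t * B) (𝓝[>] 0) (𝓝 (A + 0 * B)) :=
    (Continuous.tendsto (by fun_prop) 0).mono_left nhdsWithin_le_nhds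
  exact h3.eventually (lt_mem_nhds (by simpa using hA))

open Filter Topology in
lemma ev_ne {A B : ℝ} (hA : A ≠ 0 ∨ B ≠ 0) : ∀ᶠ t in 𝓝[>] (0:ℝ), A + t * B ≠ 0 := by
  rcases lt_trichotomy A 0 with h | h | h
  · filter_upwards [ev_pos (neg_pos.2 h) (-B)] with t ht h0
    linarith
  · have hB : B ≠ 0 := by tauto
    filter_upwards [self_mem_nhdsWithin] with t ht
    rw [h, zero_add]
    exact mul_ne_zero (ne_of_gt ht) hB
  · filter_upwards [ev_pos h B] with t ht h0
    linarith

/-- defect of `g` at `j` relative to `F` -/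
noncomputable def dfc (u : ι → Fin d → ℝ) (F : Finset ι) (j : ι) : (ι → ℝ) →ₗ[ℝ] ℝ :=
  (LinearMap.proj j : (ι → ℝ) →ₗ[ℝ] ℝ) - ∑ i ∈ F, (co u F i (u j)) • (LinearMap.proj i : (ι → ℝ) →ₗ[ℝ] ℝ)

lemma dfc_apply (j : ι) (g : ι → ℝ) : dfc u F j g = g j - ht u g F (u j) := by
  rw [ht_apply]
  simp [dfc, mul_comm]

lemma exists_generic (u : ι → Fin d → ℝ) : ∃ g : ι → ℝ, ∀ F j, j ∉ F → dfc u F j g ≠ 0 := by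
  set W : Set (Submodule ℝ (ι → ℝ)) := {p | ∃ F : Finset ι, ∃ j, j ∉ F ∧ LinearMap.ker (dfc u F j) = p} with hWd
  have hW : W.Finite := by
    refine (Set.finite_range fun x : Finset ι × ι => LinearMap.ker (dfc u x.1 x.2)).subset ?_
    rintro p ⟨F, j, _, rfl⟩
    exact ⟨(F, j), rfl⟩
  have h1 := Subspace.biUnion_ne_univ_of_top_notMem (k := ℝ) (s := hW.toFinset) (by
    intro hh
    obtain ⟨F, j, hj, hF⟩ := hW.mem_toFinset.1 hh
    have h2 : Pi.single j (1:ℝ) ∈ LinearMap.ker (dfc u F j) := by rw [hF]; trivial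
    rw [LinearMap.mem_ker, dfc_apply, ht_apply, Finset.sum_eq_zero] at h2
    · simp at h2
    · intro i hi
      rw [Pi.single_eq_of_ne (by rintro rfl; exact hj hi), zero_mul])
  obtain ⟨x, hx⟩ := (Set.ne_univ_iff_exists_notMem _).1 h1
  refine ⟨x, fun F j hj h0 => hx ?_⟩
  simp only [Set.mem_iUnion]
  exact ⟨_, hW.mem_toFinset.2 ⟨F, j, hj, rfl⟩, h0⟩

open Filter Topology in
lemma exists_g (hinj : Function.Injective u) : ∃ g : ι → ℝ, (∀ F j, j ∉ F → dfc u F j g ≠ 0) ∧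
    ∀ j, ∃ (α : ℝ) (w : Dual ℝ (Fin d → ℝ)), g j < α + w (u j) ∧ ∀ k, k ≠ j → α + w (u k) < g k := by
  obtain ⟨e, he⟩ := exists_generic u
  set q : ι → ℝ := fun j => ∑ a, u j a ^ 2 with hq
  have hconv : ∀ j, ∃ (α : ℝ) (w : Dual ℝ (Fin d → ℝ)), q j < α + w (u j) ∧ ∀ k, k ≠ j → α + w (u k) < q k := by
    intro j
    have hD : ∀ k, k ≠ j → 0 < ∑ a, (u k a - u j a) ^ 2 := by
      intro k hk
      refine lt_of_le_of_ne (Finset.sum_nonneg fun _ _ => sq_nonneg _) fun h0 => hk (hinj ?_)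
      funext a
      have := (Finset.sum_eq_zero_iff_of_nonneg (fun a _ => sq_nonneg (u k a - u j a))).1 h0.symm a (Finset.mem_univ a)
      rw [pow_eq_zero_iff two_ne_zero] at this
      linarith
    have hev : ∀ᶠ t in 𝓝[>] (0:ℝ), ∀ k, k ≠ j → 0 < ∑ a, (u k a - u j a) ^ 2 + t * (-1) := by
      rw [eventually_all]; intro k
      by_cases hk : k = j
      · exact Eventually.of_forall fun t hh => absurd hk hh
      · exact (ev_pos (hD k hk) (-1)).mono fun t ht _ => ht
    obtain ⟨η, h1, h2⟩ := (hev.and self_mem_nhdsWithin).exists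
    refine ⟨η - q j, ∑ a, (2 * u j a) • LinearMap.proj a, ?_, fun k hk => ?_⟩
    · have : (∑ a, (2 * u j a) • (LinearMap.proj a : (Fin d → ℝ) →ₗ[ℝ] ℝ)) (u j) = 2 * q j := by
        simp only [LinearMap.sum_apply, LinearMap.smul_apply, LinearMap.proj_apply, smul_eq_mul, hq,
          Finset.mul_sum]
        exact Finset.sum_congr rfl fun a _ => by ring
      rw [this]; linarith
    · have : (∑ a, (2 * u j a) • (LinearMap.proj a : (Fin d → ℝ) →ₗ[ℝ] ℝ)) (u k) =
          q k + q j - ∑ a, (u k a - u j a) ^ 2 := by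
        simp only [LinearMap.sum_apply, LinearMap.smul_apply, LinearMap.proj_apply, smul_eq_mul, hq]
        rw [← Finset.sum_add_distrib, ← Finset.sum_sub_distrib]
        exact Finset.sum_congr rfl fun a _ => by ring
      rw [this]; have := h1 k hk; linarith
  choose α w hw1 hw2 using hconv
  have ev1 : ∀ᶠ t in 𝓝[>] (0:ℝ), ∀ F j, j ∉ F → dfc u F j q + t * dfc u F j e ≠ 0 := by
    rw [eventually_all]; intro F
    rw [eventually_all]; intro j
    by_cases hj : j ∈ F
    · exact Eventually.of_forall fun t hh => absurd hj hh
    · exact (ev_ne (Or.inr (he F j hj))).mono fun t ht _ => ht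
  have ev2 : ∀ᶠ t in 𝓝[>] (0:ℝ), ∀ j, 0 < (α j + w j (u j) - q j) + t * (-(e j)) := by
    rw [eventually_all]; intro j
    exact ev_pos (by linarith [hw1 j]) _
  have ev3 : ∀ᶠ t in 𝓝[>] (0:ℝ), ∀ j k, k ≠ j → 0 < (q k - (α j + w j (u k))) + t * (e k) := by
    rw [eventually_all]; intro j
    rw [eventually_all]; intro k
    by_cases hk : k = j
    · exact Eventually.of_forall fun t hh => absurd hk hh
    · exact (ev_pos (by linarith [hw2 j k hk]) _).mono fun t ht _ => ht
  obtain ⟨t, h1, h2, h3⟩ := (ev1.and (ev2.and ev3)).exists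
  refine ⟨q + t • e, fun F j hj => ?_, fun j => ⟨α j, w j, ?_, fun k hk => ?_⟩⟩
  · rw [map_add, map_smul, smul_eq_mul]; exact h1 F j hj
  · have := h2 j
    simp only [Pi.add_apply, Pi.smul_apply, smul_eq_mul]; linarith
  · have := h3 j k hk
    simp only [Pi.add_apply, Pi.smul_apply, smul_eq_mul]; linarith

open Filter Topology in
lemma exists_heights (hinj : Function.Injective u)
    (hpos : ∀ w, ∃ c : ι → ℝ, (∀ i, 0 ≤ c i) ∧ ∑ i, c i • u i = w)
    (hsupp : ∀ j, ∃ f : Dual ℝ (Fin d → ℝ), f (u j) = 1 ∧ ∀ k, f (u k) ≤ 1) :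
    ∃ h : ι → ℝ, Sys u h ∧ (∀ j, Face u h {j}) ∧
      ∀ F, Facet u h F → ∀ j, ∑ i ∈ F, co u F i (u j) ≤ 1 := by
  obtain ⟨g, hg, hconv⟩ := exists_g hinj
  choose f hf1 hf2 using hsupp
  choose α w hw1 hw2 using hconv
  have hh1 : ∀ (ε : ℝ) F j, ht u (fun i => 1 + ε * g i) F (u j) =
      ∑ i ∈ F, co u F i (u j) + ε * ht u g F (u j) := by
    intro ε F j
    rw [ht_apply, ht_apply, Finset.mul_sum, ← Finset.sum_add_distrib]
    exact Finset.sum_congr rfl fun i _ => by ring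
  have ev0 : ∀ᶠ t in 𝓝[>] (0:ℝ), ∀ i, 0 < 1 + t * g i := by
    rw [eventually_all]; intro i; exact ev_pos one_pos _
  have ev1 : ∀ᶠ t in 𝓝[>] (0:ℝ), ∀ F j, j ∉ F →
      (1 - ∑ i ∈ F, co u F i (u j)) + t * dfc u F j g ≠ 0 := by
    rw [eventually_all]; intro F
    rw [eventually_all]; intro j
    by_cases hj : j ∈ F
    · exact Eventually.of_forall fun t hh => absurd hj hh
    · exact (ev_ne (Or.inr (hg F j hj))).mono fun t ht _ => ht
  have ev2 : ∀ᶠ t in 𝓝[>] (0:ℝ), ∀ F j, 1 < ∑ i ∈ F, co u F i (u j) →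
      0 < (∑ i ∈ F, co u F i (u j) - 1) + t * (-(dfc u F j g)) := by
    rw [eventually_all]; intro F
    rw [eventually_all]; intro j
    by_cases hj : 1 < ∑ i ∈ F, co u F i (u j)
    · exact (ev_pos (by linarith) _).mono fun t ht _ => ht
    · exact Eventually.of_forall fun t hh => absurd hh hj
  have ev3 : ∀ᶠ t in 𝓝[>] (0:ℝ), ∀ j k, k ≠ j →
      0 < (1 - f j (u k)) + t * (g k - α j * f j (u k) - w j (u k)) := by
    rw [eventually_all]; intro j
    rw [eventually_all]; intro k
    by_cases hk : k = j
    · exact Eventually.of_forall fun t hh => absurd hk hh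
    · rcases (hf2 j k).lt_or_eq with h5 | h5
      · exact (ev_pos (by linarith) _).mono fun t ht _ => ht
      · filter_upwards [self_mem_nhdsWithin] with t ht _
        rw [Set.mem_Ioi] at ht
        rw [h5]
        have := hw2 j k hk
        have : 0 < t * (g k - α j * 1 - w j (u k)) := mul_pos ht (by linarith)
        linarith
  obtain ⟨ε, hε, h0, h1, h2, h3⟩ := (Filter.Eventually.and
    (self_mem_nhdsWithin : ∀ᶠ t in 𝓝[>] (0:ℝ), t ∈ Set.Ioi (0:ℝ)) (ev0.and (ev1.and (ev2.and ev3)))).exists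
  have S : Sys u (fun i => 1 + ε * g i) := by
    refine ⟨hpos, h0, fun F hF j hj heq => h1 F j hj ?_⟩
    rw [hh1] at heq
    rw [dfc_apply]; linarith
  refine ⟨fun i => 1 + ε * g i, S, fun j => ?_, fun F hF j => ?_⟩
  · obtain ⟨ξ, hξ, _⟩ := exists_genV (u := u) ∅ Set.finite_empty (by simp)
    obtain ⟨F, hF, hC⟩ := exists_InC S hξ (u j)
    refine ⟨F, hF, ?_⟩
    rw [Finset.singleton_subset_iff]
    by_contra hj
    set y : Dual ℝ (Fin d → ℝ) := (1 + ε * α j) • f j + ε • w j with hy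
    have e1 : y (u j) = 1 + ε * α j + ε * w j (u j) := by simp [hy, hf1]
    have e2 : 1 + ε * g j < y (u j) := by
      rw [e1]
      have := mul_lt_mul_of_pos_left (hw1 j) hε
      linarith
    have e3 : y (u j) ≤ ht u (fun i => 1 + ε * g i) F (u j) := by
      rw [hF.1.dual_apply y, ht_apply]
      refine Finset.sum_le_sum fun i hi => ?_
      rw [mul_comm]
      refine mul_le_mul_of_nonneg_right ?_ (hC i hi).1
      have := h3 j i (by rintro rfl; exact hj hi)
      simp only [hy, LinearMap.add_apply, LinearMap.smul_apply, smul_eq_mul]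
      linarith
    have := hF.2 j hj
    linarith
  · by_contra! hcon
    have h5 := h2 F j hcon
    have h6 := hF.ht_le j
    rw [hh1] at h6
    rw [dfc_apply] at h5
    linarith

end Heights


section Counting

variable {d : ℕ} {ι : Type} [Fintype ι] [DecidableEq ι]
variable {u : ι → Fin d → ℝ} {h : ι → ℝ} {F G : Finset ι}

lemma lattice_finite (B : Fin d → ℝ) : {x : Fin d → ℝ | IsLatticePt x ∧ ∀ k, |x k| ≤ B k}.Finite := by
  refine ((Set.finite_Icc (fun k => -⌈B k⌉) (fun k => ⌈B k⌉)).image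
    (fun (z : Fin d → ℤ) k => (z k : ℝ))).subset ?_
  rintro x ⟨hx, hb⟩
  choose z hz using hx
  refine ⟨z, ⟨fun k => ?_, fun k => ?_⟩, funext fun k => (hz k).symm⟩
  · have h1 := (abs_le.1 (hb k)).1
    rw [hz] at h1
    have h2 := Int.le_ceil (B k)
    have : ((-⌈B k⌉ : ℤ) : ℝ) ≤ (z k : ℝ) := by push_cast; linarith
    exact_mod_cast this
  · have h1 := (abs_le.1 (hb k)).2
    rw [hz] at h1
    have h2 := Int.le_ceil (B k)
    have : (z k : ℝ) ≤ (⌈B k⌉ : ℝ) := by linarith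
    exact_mod_cast this

lemma IsLatticePt.add {x y : Fin d → ℝ} (hx : IsLatticePt x) (hy : IsLatticePt y) : IsLatticePt (x + y) := by
  intro k
  obtain ⟨a, ha⟩ := hx k
  obtain ⟨b, hb⟩ := hy k
  exact ⟨a + b, by simp [ha, hb]⟩

lemma IsLatticePt.sub {x y : Fin d → ℝ} (hx : IsLatticePt x) (hy : IsLatticePt y) : IsLatticePt (x - y) := by
  intro k
  obtain ⟨a, ha⟩ := hx k
  obtain ⟨b, hb⟩ := hy k
  exact ⟨a - b, by simp [ha, hb]⟩

lemma isLatticePt_zero : IsLatticePt (0 : Fin d → ℝ) := fun k => ⟨0, by simp⟩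

lemma IsLatticePt.sum {p : ι → Fin d → ℝ} (hp : ∀ i, IsLatticePt (p i)) (s : Finset ι) :
    IsLatticePt (∑ i ∈ s, p i) := by
  induction s using Finset.induction_on with
  | empty => simpa using isLatticePt_zero
  | insert i s hi ih => rw [Finset.sum_insert hi]; exact (hp i).add ih

/-- lattice points at height `n` of the half-open cone over `F`, with box condition on `T` -/
def AS (u : ι → Fin d → ℝ) (o ξ : Fin d → ℝ) (F T : Finset ι) (n : ℕ) : Set (Fin d → ℝ) :=
  {x | IsLatticePt x ∧ InC u ξ F (x - (n : ℝ) • o) ∧ ∑ i ∈ F, co u F i (x - (n : ℝ) • o) = n ∧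
    ∀ i ∈ T, (co u F i ξ < 0 → co u F i (x - (n : ℝ) • o) ≤ 1) ∧
      (¬ co u F i ξ < 0 → co u F i (x - (n : ℝ) • o) < 1)}

lemma AS_finite (hF : Bas u F) (o ξ : Fin d → ℝ) (T : Finset ι) (n : ℕ) : (AS u o ξ F T n).Finite := by
  refine (lattice_finite (fun k => ∑ i ∈ F, (n : ℝ) * |u i k| + n * |o k|)).subset ?_
  rintro x ⟨hx, hC, hs, _⟩
  refine ⟨hx, fun k => ?_⟩
  have e : x = ∑ i ∈ F, co u F i (x - (n : ℝ) • o) • u i + (n : ℝ) • o := by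
    rw [hF.sum_co]; simp
  have hc : ∀ i ∈ F, co u F i (x - (n : ℝ) • o) ≤ n := by
    intro i hi
    refine le_of_le_of_eq (Finset.single_le_sum (f := fun i => co u F i (x - (n : ℝ) • o)) (fun i hi => (hC i hi).1) hi) hs
  have e2 := congrFun e k
  rw [e2]
  simp only [Pi.add_apply, Finset.sum_apply, Pi.smul_apply, smul_eq_mul]
  refine (abs_add_le _ _).trans (add_le_add ((Finset.abs_sum_le_sum_abs _ _).trans
    (Finset.sum_le_sum fun i hi => ?_)) ?_)
  · rw [abs_mul, abs_of_nonneg (hC i hi).1]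
    exact mul_le_mul_of_nonneg_right (hc i hi) (abs_nonneg _)
  · rw [abs_mul]; simp

lemma AS_step (hF : Bas u F) {p : ι → Fin d → ℝ} {o : Fin d → ℝ} (hu : ∀ i, u i = p i - o)
    (hp : ∀ i, IsLatticePt (p i)) (ξ : Fin d → ℝ) {T : Finset ι} (hT : T ⊆ F) {i : ι} (hi : i ∈ F) (hiT : i ∉ T)
    (n : ℕ) : (AS u o ξ F T (n + 1)).ncard =
      (AS u o ξ F (insert i T) (n + 1)).ncard + (AS u o ξ F T n).ncard := by
  have hsub : AS u o ξ F (insert i T) (n + 1) ⊆ AS u o ξ F T (n + 1) := by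
    rintro x ⟨h1, h2, h3, h4⟩
    exact ⟨h1, h2, h3, fun j hj => h4 j (Finset.mem_insert_of_mem hj)⟩
  rw [← Set.ncard_sdiff_add_ncard_of_subset hsub (AS_finite hF o ξ T (n + 1)), add_comm]
  congr 1
  have hshift : ∀ x : Fin d → ℝ, x + p i - ((n + 1 : ℕ) : ℝ) • o = (x - (n : ℝ) • o) + u i := by
    intro x; rw [hu]; push_cast; rw [add_smul, one_smul]; abel
  have hself : ∀ x : Fin d → ℝ, co u F i (x + p i - ((n + 1 : ℕ) : ℝ) • o) = co u F i (x - (n : ℝ) • o) + 1 := by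
    intro x; rw [hshift, map_add, hF.co_self hi]
  have hoth : ∀ x : Fin d → ℝ, ∀ j ∈ F, j ≠ i →
      co u F j (x + p i - ((n + 1 : ℕ) : ℝ) • o) = co u F j (x - (n : ℝ) • o) := by
    intro x j hj hji; rw [hshift, map_add, hF.co_ne hj hi hji, add_zero]
  have hsum : ∀ x : Fin d → ℝ, ∑ j ∈ F, co u F j (x + p i - ((n + 1 : ℕ) : ℝ) • o) =
      ∑ j ∈ F, co u F j (x - (n : ℝ) • o) + 1 := by
    intro x
    rw [← Finset.add_sum_erase _ _ hi, ← Finset.add_sum_erase F _ hi, hself,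
      Finset.sum_congr rfl fun j hj => hoth x j (Finset.mem_of_mem_erase hj) (Finset.ne_of_mem_erase hj)]
    ring
  have himg : AS u o ξ F T (n + 1) \ AS u o ξ F (insert i T) (n + 1) =
      (fun x => x + p i) '' AS u o ξ F T n := by
    ext z
    obtain ⟨x, rfl⟩ : ∃ x, z = x + p i := ⟨z - p i, by simp⟩
    rw [(add_left_injective (p i)).mem_set_image]
    constructor
    · rintro ⟨⟨h1, h2, h3, h4⟩, h5⟩
      refine ⟨by simpa using h1.sub (hp i), ?_, ?_, ?_⟩
      · intro j hj
        by_cases hji : j = i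
        · subst hji
          have : ¬ ((co u F j ξ < 0 → co u F j (x + p j - ((n + 1 : ℕ) : ℝ) • o) ≤ 1) ∧
              (¬ co u F j ξ < 0 → co u F j (x + p j - ((n + 1 : ℕ) : ℝ) • o) < 1)) := by
            intro hh
            refine h5 ⟨h1, h2, h3, fun k hk => ?_⟩
            rcases Finset.mem_insert.1 hk with rfl | hk
            · exact hh
            · exact h4 k hk
          rw [hself] at this
          by_cases hneg : co u F j ξ < 0
          · simp only [hneg, not_true, false_imp_iff, and_true, true_imp_iff, not_le] at this
            constructor
            · linarith
            · intro _; linarith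
          · simp only [hneg, not_false_iff, false_imp_iff, true_and, true_imp_iff, not_lt] at this
            exact ⟨by linarith, fun hh => absurd hh hneg⟩
        · have := h2 j hj
          rwa [hoth x j hj hji] at this
      · rw [hsum] at h3; push_cast at h3; linarith
      · intro j hj
        have := h4 j hj
        rwa [hoth x j (hT hj) (by rintro rfl; exact hiT hj)] at this
    · rintro ⟨h1, h2, h3, h4⟩
      refine ⟨⟨h1.add (hp i), ?_, ?_, ?_⟩, ?_⟩
      · intro j hj
        by_cases hji : j = i
        · subst hji
          rw [hself]
          have := (h2 j hj).1
          exact ⟨by linarith, fun _ => by linarith⟩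
        · rw [hoth x j hj hji]; exact h2 j hj
      · rw [hsum, h3]; push_cast; ring
      · intro j hj
        rw [hoth x j (hT hj) (by rintro rfl; exact hiT hj)]
        exact h4 j hj
      · rintro ⟨_, _, _, h5⟩
        have h6 := h5 i (Finset.mem_insert_self _ _)
        rw [hself] at h6
        have h7 := h2 i hi
        by_cases hneg : co u F i ξ < 0
        · have := h6.1 hneg; have := h7.2 hneg; linarith
        · have := h6.2 hneg; have := h7.1; linarith
  rw [himg, Set.ncard_image_of_injective _ (add_left_injective (p i))]

lemma AS_zero_coord {o ξ : Fin d → ℝ} {T : Finset ι} {x : Fin d → ℝ}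
    (hx : x ∈ AS u o ξ F T 0) : ∀ i ∈ F, co u F i x = 0 := by
  obtain ⟨_, h2, h3, _⟩ := hx
  simp only [Nat.cast_zero, zero_smul, sub_zero] at h2 h3
  exact fun i hi => (Finset.sum_eq_zero_iff_of_nonneg (fun i hi => (h2 i hi).1)).1 h3 i hi

lemma AS_step_zero (o ξ : Fin d → ℝ) {T : Finset ι} {i : ι} (hi : i ∈ F) :
    AS u o ξ F T 0 = AS u o ξ F (insert i T) 0 := by
  ext x
  constructor
  · intro hx
    have h0 := AS_zero_coord hx i hi
    obtain ⟨h1, h2, h3, h4⟩ := hx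
    refine ⟨h1, h2, h3, fun j hj => ?_⟩
    rcases Finset.mem_insert.1 hj with rfl | hj
    · simp [h0]
    · exact h4 j hj
  · rintro ⟨h1, h2, h3, h4⟩
    exact ⟨h1, h2, h3, fun j hj => h4 j (Finset.mem_insert_of_mem hj)⟩

/-- generating series -/
noncomputable def ASs (u : ι → Fin d → ℝ) (o ξ : Fin d → ℝ) (F T : Finset ι) : PowerSeries ℤ :=
  PowerSeries.mk fun n => ((AS u o ξ F T n).ncard : ℤ)

lemma ASs_eq (hF : Bas u F) {p : ι → Fin d → ℝ} {o : Fin d → ℝ} (hu : ∀ i, u i = p i - o)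
    (hp : ∀ i, IsLatticePt (p i)) (ξ : Fin d → ℝ) (T : Finset ι) (hT : T ⊆ F) :
    ASs u o ξ F T = (1 - PowerSeries.X) ^ T.card * ASs u o ξ F ∅ := by
  induction T using Finset.induction_on with
  | empty => simp
  | insert i T hi ih =>
    have hT' : T ⊆ F := (Finset.subset_insert _ _).trans hT
    have hiF : i ∈ F := hT (Finset.mem_insert_self _ _)
    rw [Finset.card_insert_of_notMem hi, pow_succ', mul_assoc, ← ih hT', sub_mul, one_mul]
    ext n
    rw [map_sub]
    cases n with
    | zero =>
      rw [PowerSeries.coeff_zero_X_mul, sub_zero]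
      simp only [ASs, PowerSeries.coeff_mk]
      rw [← AS_step_zero o ξ hiF]
    | succ n =>
      rw [PowerSeries.coeff_succ_X_mul]
      simp only [ASs, PowerSeries.coeff_mk]
      rw [AS_step hF hu hp ξ hT' hiF hi n]
      push_cast; ring

lemma AS_box (hF : Bas u F) {p : ι → Fin d → ℝ} {o : Fin d → ℝ} (hu : ∀ i, u i = p i - o)
    (hp : ∀ i, IsLatticePt (p i)) (ξ : Fin d → ℝ) :
    1 ≤ (AS u o ξ F F (Rs u ξ F).card).ncard := by
  rw [Nat.one_le_iff_ne_zero, Ne, Set.ncard_eq_zero (AS_finite hF o ξ F _), ← Ne, ← Set.nonempty_iff_ne_empty]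
  refine ⟨∑ i ∈ Rs u ξ F, p i, ?_⟩
  have hsubF : Rs u ξ F ⊆ F := fun i hi => (mem_Rs.1 hi).1
  have e1 : ∑ i ∈ Rs u ξ F, p i - ((Rs u ξ F).card : ℝ) • o =
      ∑ i ∈ F, (if i ∈ Rs u ξ F then (1:ℝ) else 0) • u i := by
    simp only [ite_smul, one_smul, zero_smul]
    rw [← Finset.sum_filter, Finset.filter_mem_eq_inter, Finset.inter_eq_right.2 hsubF]
    simp only [hu, Finset.sum_sub_distrib, Finset.sum_const]
    rw [Nat.cast_smul_eq_nsmul]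
  have hco : ∀ i ∈ F, co u F i (∑ i ∈ Rs u ξ F, p i - ((Rs u ξ F).card : ℝ) • o) =
      if i ∈ Rs u ξ F then 1 else 0 := by
    intro i hi
    rw [e1, hF.coeff_eq _ hi]
  refine ⟨IsLatticePt.sum hp _, ?_, ?_, ?_⟩
  · intro i hi
    rw [hco i hi]
    refine ⟨by split_ifs <;> norm_num, fun hh => ?_⟩
    rw [if_pos (mem_Rs.2 ⟨hi, hh⟩)]; norm_num
  · rw [Finset.sum_congr rfl hco, ← Finset.sum_filter, Finset.filter_mem_eq_inter, Finset.inter_eq_right.2 hsubF]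
    simp
  · intro i hi
    rw [hco i hi]
    refine ⟨fun _ => by split_ifs <;> norm_num, fun hh => ?_⟩
    rw [if_neg (fun hm => hh (mem_Rs.1 hm).2)]; norm_num

open Classical in
lemma AS_union {ξ : Fin d → ℝ} (hξ : GenV u ξ) (o : Fin d → ℝ) (n : ℕ) :
    ({x | ∃ F, Facet u h F ∧ x ∈ AS u o ξ F ∅ n} : Set (Fin d → ℝ)).ncard =
      ∑ F ∈ univ.filter (fun F => Facet u h F), (AS u o ξ F ∅ n).ncard := by
  have hfin : ∀ F : Finset ι, Facet u h F → (AS u o ξ F ∅ n).Finite := fun F hF => AS_finite hF.1 o ξ ∅ n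
  let t : Finset ι → Finset (Fin d → ℝ) := fun F => if hF : Facet u h F then (hfin F hF).toFinset else ∅
  have ht : ∀ F, Facet u h F → ∀ x, x ∈ t F ↔ x ∈ AS u o ξ F ∅ n := by
    intro F hF x; simp only [t, dif_pos hF, Set.Finite.mem_toFinset]
  have e1 : ({x | ∃ F, Facet u h F ∧ x ∈ AS u o ξ F ∅ n} : Set (Fin d → ℝ)) =
      ((univ.filter (fun F => Facet u h F)).biUnion t : Finset (Fin d → ℝ)) := by
    ext x
    simp only [Set.mem_setOf_eq, Finset.coe_biUnion, Set.mem_iUnion, Finset.coe_filter, Finset.mem_univ, true_and, Finset.mem_coe]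
    constructor
    · rintro ⟨F, hF, hx⟩; exact ⟨F, hF, (ht F hF x).2 hx⟩
    · rintro ⟨F, hF, hx⟩; exact ⟨F, hF, (ht F hF x).1 hx⟩
  rw [e1, Set.ncard_coe_finset, Finset.card_biUnion]
  · refine Finset.sum_congr rfl fun F hF => ?_
    have hF' : Facet u h F := (Finset.mem_filter.1 hF).2
    have : AS u o ξ F ∅ n = (t F : Set (Fin d → ℝ)) := by
      ext x; rw [Finset.mem_coe, ht F hF']
    rw [this, Set.ncard_coe_finset]
  · intro F hF G hG hne
    have hF' : Facet u h F := (Finset.mem_filter.1 hF).2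
    have hG' : Facet u h G := (Finset.mem_filter.1 hG).2
    change Disjoint (t F) (t G)
    rw [Finset.disjoint_left]
    intro x hx hx'
    rw [ht F hF'] at hx
    rw [ht G hG'] at hx'
    exact hne (InC.unique hF' hG' hξ hx.2.1 hx'.2.1)

end Counting

section Geometry

open Filter Topology

variable {d : ℕ} {ι : Type} [Fintype ι] [DecidableEq ι]
variable {P : Set (Fin d → ℝ)} {p : ι → Fin d → ℝ} {o : Fin d → ℝ}

lemma hull_repr {x : Fin d → ℝ} (hx : x ∈ convexHull ℝ (Set.range p)) :
    ∃ c : ι → ℝ, (∀ i, 0 ≤ c i) ∧ ∑ i, c i = 1 ∧ ∑ i, c i • p i = x := by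
  have : convexHull ℝ (Set.range p) ⊆
      {x | ∃ c : ι → ℝ, (∀ i, 0 ≤ c i) ∧ ∑ i, c i = 1 ∧ ∑ i, c i • p i = x} := by
    refine convexHull_min ?_ ?_
    · rintro _ ⟨j, rfl⟩
      refine ⟨fun i => if i = j then 1 else 0, fun i => by dsimp only; split_ifs <;> norm_num, by simp, by simp⟩
    · rintro x ⟨c, h1, h2, h3⟩ y ⟨e, k1, k2, k3⟩ a b ha hb hab
      refine ⟨fun i => a * c i + b * e i, fun i => add_nonneg (mul_nonneg ha (h1 i)) (mul_nonneg hb (k1 i)), ?_, ?_⟩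
      · rw [Finset.sum_add_distrib, ← Finset.mul_sum, ← Finset.mul_sum, h2, k2]; linarith
      · simp only [add_smul, mul_smul]
        rw [Finset.sum_add_distrib, ← Finset.smul_sum, ← Finset.smul_sum, h3, k3]
  exact this hx

lemma geo_pos (ho : o ∈ interior P) (hP : P ⊆ convexHull ℝ (Set.range p)) (w : Fin d → ℝ) :
    ∃ c : ι → ℝ, (∀ i, 0 ≤ c i) ∧ ∑ i, c i • (p i - o) = w := by
  have h1 : ∀ᶠ t in 𝓝[>] (0:ℝ), o + t • w ∈ P := by
    have hc : Continuous fun t : ℝ => o + t • w := by fun_prop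
    have : Tendsto (fun t : ℝ => o + t • w) (𝓝 0) (𝓝 o) := by
      simpa using hc.tendsto 0
    exact (this.eventually (mem_interior_iff_mem_nhds.1 ho)).filter_mono nhdsWithin_le_nhds
  obtain ⟨t, ht, ht0⟩ := (h1.and self_mem_nhdsWithin).exists
  have ht0 : (0:ℝ) < t := ht0
  obtain ⟨c, hc, hc1, hc2⟩ := hull_repr (hP ht)
  refine ⟨fun i => t⁻¹ * c i, fun i => mul_nonneg (inv_nonneg.2 ht0.le) (hc i), ?_⟩
  simp only [mul_smul]
  rw [← Finset.smul_sum]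
  simp only [smul_sub]
  rw [Finset.sum_sub_distrib, hc2, ← Finset.sum_smul, hc1, one_smul, add_sub_cancel_left, smul_smul,
    inv_mul_cancel₀ ht0.ne', one_smul]

lemma geo_supp (Cv : Convex ℝ P) (ho : o ∈ interior P) {q : Fin d → ℝ} (hq : q ∉ interior P) :
    ∃ f : Dual ℝ (Fin d → ℝ), f (q - o) = 1 ∧ ∀ x ∈ P, f (x - o) ≤ 1 := by
  obtain ⟨f, hf⟩ := geometric_hahn_banach_open_point Cv.interior isOpen_interior hq
  have h0 := hf o ho
  have hcl : ∀ x ∈ P, f x ≤ f q := by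
    intro x hx
    have hx' : x ∈ closure (interior P) := by
      rw [Cv.closure_interior_eq_closure_of_nonempty_interior ⟨o, ho⟩]
      exact subset_closure hx
    have hsub : closure (interior P) ⊆ {x | f x ≤ f q} :=
      closure_minimal (fun y hy => (hf y hy).le) (isClosed_le f.continuous continuous_const)
    exact hsub hx'
  have hpos : 0 < f q - f o := by linarith
  refine ⟨(f q - f o)⁻¹ • (f : (Fin d → ℝ) →ₗ[ℝ] ℝ), ?_, fun x hx => ?_⟩
  · simp only [LinearMap.smul_apply, map_sub, ContinuousLinearMap.coe_coe, smul_eq_mul]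
    rw [← mul_sub]
    exact inv_mul_cancel₀ hpos.ne'
  · simp only [LinearMap.smul_apply, map_sub, ContinuousLinearMap.coe_coe, smul_eq_mul]
    rw [← mul_sub, inv_mul_le_one₀ hpos]
    linarith [hcl x hx]

/-- a max point of a nonzero functional is not interior -/
lemma geo_max (f : Dual ℝ (Fin d → ℝ)) {q : Fin d → ℝ} (hq : f (q - o) = 1)
    (hf : ∀ x ∈ P, f (x - o) ≤ 1) : q ∉ interior P := by
  intro hi
  have h1 : ∀ᶠ t in 𝓝[>] (0:ℝ), q + t • (q - o) ∈ P := by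
    have hc : Continuous fun t : ℝ => q + t • (q - o) := by fun_prop
    have : Tendsto (fun t : ℝ => q + t • (q - o)) (𝓝 0) (𝓝 q) := by
      simpa using hc.tendsto 0
    exact (this.eventually (mem_interior_iff_mem_nhds.1 hi)).filter_mono nhdsWithin_le_nhds
  obtain ⟨t, ht, ht0⟩ := (h1.and self_mem_nhdsWithin).exists
  have ht0 : (0:ℝ) < t := ht0
  have h2 := hf _ ht
  rw [add_sub_right_comm, map_add, map_smul, hq, smul_eq_mul] at h2
  linarith

lemma poly_hull (hd : 1 ≤ d) (hlat : IsLatticePolytope P) :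
    P ⊆ convexHull ℝ {x | x ∈ frontier P ∧ IsLatticePt x} := by
  obtain ⟨V, hV, rfl⟩ := hlat
  have : Nonempty (Fin d) := ⟨⟨0, hd⟩⟩
  have hc : IsCompact (convexHull ℝ (V : Set (Fin d → ℝ))) := V.finite_toSet.isCompact_convexHull ℝ
  have hE : Set.extremePoints ℝ (convexHull ℝ (V : Set (Fin d → ℝ))) ⊆ V := extremePoints_convexHull_subset
  have hEc : IsClosed (convexHull ℝ (Set.extremePoints ℝ (convexHull ℝ (V : Set (Fin d → ℝ))))) :=
    (V.finite_toSet.subset hE).isClosed_convexHull ℝ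
  have h1 := closure_convexHull_extremePoints hc (convex_convexHull ℝ _)
  rw [hEc.closure_eq] at h1
  conv_lhs => rw [← h1]
  refine convexHull_mono fun x hx => ⟨?_, hV x (hE hx)⟩
  rw [hc.isClosed.frontier_eq]
  exact ⟨extremePoints_subset hx, fun hi =>
    Set.disjoint_left.1 (disjoint_interior_extremePoints _) hi hx⟩

lemma bd_finite (hc : IsCompact P) : {x | x ∈ P ∧ IsLatticePt x}.Finite := by
  obtain ⟨R, hR⟩ := hc.isBounded.exists_norm_le
  refine (lattice_finite (fun _ => R)).subset ?_
  rintro x ⟨hx, hl⟩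
  exact ⟨hl, fun k => (norm_le_pi_norm x k).trans (hR x hx)⟩

/-- boundary lattice points of dilates -/
lemma bd_eq {h : ι → ℝ} {u : ι → Fin d → ℝ} (hu : ∀ i, u i = p i - o) (Cv : Convex ℝ P) (hcl : IsClosed P)
    (ho : o ∈ interior P) (hpP : ∀ i, p i ∈ P) (hP : P ⊆ convexHull ℝ (Set.range p))
    (S : Sys u h) (h1 : ∀ F, Facet u h F → ∀ j, ∑ i ∈ F, co u F i (u j) ≤ 1) {ξ : Fin d → ℝ} (hξ : GenV u ξ)
    (n : ℕ) (hn : n ≠ 0) :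
    {x ∈ frontier ((n : ℝ) • P) | IsLatticePt x} = {x | ∃ F, Facet u h F ∧ x ∈ AS u o ξ F ∅ n} := by
  have hn' : (0:ℝ) < n := by positivity
  have hle : ∀ F, Facet u h F → ∀ x ∈ P, ∑ i ∈ F, co u F i (x - o) ≤ 1 := by
    intro F hF x hx
    obtain ⟨c, hc, hc1, hc2⟩ := hull_repr (hP hx)
    have e : x - o = ∑ j, c j • u j := by
      simp only [hu, smul_sub]
      rw [Finset.sum_sub_distrib, hc2, ← Finset.sum_smul, hc1, one_smul]
    have : ∑ i ∈ F, co u F i (x - o) = ∑ j, c j * ∑ i ∈ F, co u F i (u j) := by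
      rw [e]
      simp only [map_sum, map_smul, smul_eq_mul, Finset.mul_sum]
      rw [Finset.sum_comm]
    rw [this, ← hc1]
    refine Finset.sum_le_sum fun j _ => ?_
    exact mul_le_of_le_one_right (hc j) (h1 F hF j)
  have hcoord : ∀ (x : Fin d → ℝ), x - (n : ℝ) • o = (n : ℝ) • ((n : ℝ)⁻¹ • x - o) := by
    intro x; rw [smul_sub, smul_smul, mul_inv_cancel₀ hn'.ne', one_smul]
  have hcs : ∀ (F : Finset ι) x i, co u F i (x - (n : ℝ) • o) = n * co u F i ((n : ℝ)⁻¹ • x - o) := by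
    intro F x i; rw [hcoord, map_smul, smul_eq_mul]
  have hfr : ∀ x, x ∈ frontier ((n : ℝ) • P) ↔ (n : ℝ)⁻¹ • x ∈ P ∧ (n : ℝ)⁻¹ • x ∉ interior P := by
    intro x
    rw [(hcl.smul₀ (n : ℝ)).frontier_eq, interior_smul₀ hn'.ne', Set.mem_sdiff,
      Set.mem_smul_set_iff_inv_smul_mem₀ hn'.ne', Set.mem_smul_set_iff_inv_smul_mem₀ hn'.ne']
  ext x
  simp only [Set.mem_setOf_eq]
  rw [hfr]
  set y := (n : ℝ)⁻¹ • x with hy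
  have hrep : ∀ F, Facet u h F → y = ∑ i ∈ F, co u F i (y - o) • p i + (1 - ∑ i ∈ F, co u F i (y - o)) • o := by
    intro F hF
    have := hF.1.sum_co (y - o)
    simp only [hu, smul_sub] at this
    rw [Finset.sum_sub_distrib, ← Finset.sum_smul] at this
    rw [sub_smul, one_smul]
    rw [add_sub, add_sub_right_comm, this, sub_add_cancel]
  constructor
  · rintro ⟨⟨hyP, hyI⟩, hl⟩
    obtain ⟨F, hF, hC⟩ := exists_InC S hξ (x - (n : ℝ) • o)
    refine ⟨F, hF, hl, hC, ?_, by simp⟩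
    have hnn : ∀ i ∈ F, 0 ≤ co u F i (y - o) := by
      intro i hi
      have := (hC i hi).1
      rw [hcs] at this
      exact nonneg_of_mul_nonneg_right this hn'
    simp only [hcs]
    rw [← Finset.mul_sum]
    rcases (hle F hF y hyP).lt_or_eq with hlt | heq
    · exfalso
      apply hyI
      have h0 : 0 ≤ ∑ i ∈ F, co u F i (y - o) := Finset.sum_nonneg hnn
      rcases h0.lt_or_eq with h0 | h0
      · have hz : (∑ i ∈ F, co u F i (y - o))⁻¹ • ∑ i ∈ F, co u F i (y - o) • p i ∈ P := by
          have := Cv.sum_mem (t := F) (w := fun i => (∑ i ∈ F, co u F i (y - o))⁻¹ * co u F i (y - o)) (z := p)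
            (fun i hi => mul_nonneg (inv_nonneg.2 h0.le) (hnn i hi))
            (by rw [← Finset.mul_sum, inv_mul_cancel₀ h0.ne']) (fun i _ => hpP i)
          simpa only [mul_smul, ← Finset.smul_sum] using this
        have := Cv.combo_self_interior_mem_interior hz ho h0.le (by linarith : 0 < 1 - ∑ i ∈ F, co u F i (y - o)) (by ring)
        rw [smul_smul, mul_inv_cancel₀ h0.ne', one_smul, ← hrep F hF] at this
        exact this
      · have h3 : y - o = 0 := by
          rw [← hF.1.sum_co (y - o)]
          refine Finset.sum_eq_zero fun i hi => ?_
          rw [(Finset.sum_eq_zero_iff_of_nonneg hnn).1 h0.symm i hi, zero_smul]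
        rw [sub_eq_zero.1 h3]; exact ho
    · rw [heq, mul_one]
  · rintro ⟨F, hF, hl, hC, hs, _⟩
    have hnn : ∀ i ∈ F, 0 ≤ co u F i (y - o) := by
      intro i hi
      have := (hC i hi).1
      rw [hcs] at this
      exact nonneg_of_mul_nonneg_right this hn'
    simp only [hcs] at hs
    rw [← Finset.mul_sum] at hs
    have hs1 : ∑ i ∈ F, co u F i (y - o) = 1 := by
      have : (n:ℝ) * ∑ i ∈ F, co u F i (y - o) = n * 1 := by rw [mul_one]; exact hs
      exact mul_left_cancel₀ hn'.ne' this
    refine ⟨⟨?_, ?_⟩, hl⟩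
    · have := hrep F hF
      rw [hs1, sub_self, zero_smul, add_zero] at this
      rw [this]
      exact Cv.sum_mem hnn hs1 fun i _ => hpP i
    · refine geo_max (P := P) (o := o) (∑ i ∈ F, co u F i) ?_ ?_
      · simpa using hs1
      · intro z hz; simpa using hle F hF z hz

end Geometry

open Classical in
theorem main_aux {d : ℕ} (hd : 1 ≤ d) (P : Set (Fin d → ℝ))
    (hlat : IsLatticePolytope P) (hfull : IsFullDim P)
    (hB : Polynomial ℤ)
    (hBeq : (hB : PowerSeries ℤ) = (1 - PowerSeries.X) ^ d * ehrBdSeries P) :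
    hB.coeff 0 = 1 ∧
    hB.coeff 0 ≤ hB.coeff 1 ∧
    (∀ j : ℕ, 2 ≤ j → j ≤ d - 1 → hB.coeff 1 ≤ hB.coeff j) ∧
    (∀ j : ℕ, j ≤ d → 0 < hB.coeff j) := by
  have hhull := poly_hull hd hlat
  have hPc : IsCompact P := by
    obtain ⟨V, hV, rfl⟩ := hlat
    exact V.finite_toSet.isCompact_convexHull ℝ
  have Cv : Convex ℝ P := by
    obtain ⟨V, hV, rfl⟩ := hlat
    exact convex_convexHull ℝ _
  obtain ⟨o, ho⟩ := hfull
  have hfrP : frontier P ⊆ P := hPc.isClosed.frontier_subset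
  have hBfin : {x | x ∈ frontier P ∧ IsLatticePt x}.Finite :=
    (bd_finite hPc).subset fun x hx => ⟨hfrP hx.1, hx.2⟩
  let ι : Type := {x : Fin d → ℝ // x ∈ frontier P ∧ IsLatticePt x}
  have : Finite ι := hBfin.to_subtype
  have : Fintype ι := Fintype.ofFinite ι
  let p : ι → Fin d → ℝ := fun i => i.1
  let u : ι → Fin d → ℝ := fun i => p i - o
  have hu : ∀ i, u i = p i - o := fun i => rfl
  have hp : ∀ i, IsLatticePt (p i) := fun i => i.2.2
  have hpfr : ∀ i, p i ∉ interior P := fun i => by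
    have hh : p i ∈ frontier P := i.2.1
    rw [hPc.isClosed.frontier_eq] at hh
    exact hh.2
  have hpP : ∀ i, p i ∈ P := fun i => hfrP i.2.1
  have hP : P ⊆ convexHull ℝ (Set.range p) := by
    have : Set.range p = {x | x ∈ frontier P ∧ IsLatticePt x} := Subtype.range_coe
    rw [this]; exact hhull
  have hinj : Function.Injective u := fun i j hij => Subtype.ext (sub_left_injective hij)
  obtain ⟨h, S, hvert, h1⟩ := exists_heights (u := u) hinj (fun w => geo_pos ho hP w) (fun j => by
    obtain ⟨f, hf1, hf2⟩ := geo_supp Cv ho (hpfr j)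
    exact ⟨f, hf1, fun k => hf2 _ (hpP k)⟩)
  obtain ⟨ξ, hξ, -⟩ := exists_genV (u := u) ∅ Set.finite_empty (by simp)
  have hbd := bd_eq hu Cv hPc.isClosed ho hpP hP S h1 hξ
  have hser : ehrBdSeries P = ∑ F ∈ univ.filter (fun F => Facet u h F), ASs u o ξ F ∅ := by
    ext n
    rw [map_sum]
    simp only [ehrBdSeries, ASs, PowerSeries.coeff_mk]
    rw [← Nat.cast_sum, ← AS_union hξ o n]
    split_ifs with hn
    · subst hn
      have : {x | ∃ F, Facet u h F ∧ x ∈ AS u o ξ F ∅ 0} = {0} := by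
        ext x
        constructor
        · rintro ⟨F, hF, hx⟩
          have h2 := AS_zero_coord hx
          rw [Set.mem_singleton_iff, ← hF.1.sum_co x]
          exact Finset.sum_eq_zero fun i hi => by rw [h2 i hi, zero_smul]
        · intro hx
          rw [Set.mem_singleton_iff] at hx
          subst hx
          obtain ⟨F, hF, hC⟩ := exists_InC S hξ 0
          exact ⟨F, hF, isLatticePt_zero, by simpa using hC, by simp, by simp⟩
      rw [this]; simp
    · rw [latCount, hbd n hn]
  have hco : ∀ k, hB.coeff k = ∑ F ∈ univ.filter (fun F => Facet u h F), ((AS u o ξ F F k).ncard : ℤ) := by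
    intro k
    have e : (hB : PowerSeries ℤ) = ∑ F ∈ univ.filter (fun F => Facet u h F), ASs u o ξ F F := by
      rw [hBeq, hser, Finset.mul_sum]
      refine Finset.sum_congr rfl fun F hF => ?_
      have hF' : Facet u h F := (Finset.mem_filter.1 hF).2
      rw [ASs_eq hF'.1 hu hp ξ F (Finset.Subset.refl _), hF'.1.card]
    rw [← Polynomial.coeff_coe, e, map_sum]
    simp only [ASs, PowerSeries.coeff_mk]
  have hge : ∀ k, ((univ.filter fun F : Finset ι => Facet u h F ∧ (Rs u ξ F).card = k).card : ℤ) ≤ hB.coeff k := by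
    intro k
    rw [hco, ← Finset.filter_filter, Finset.card_filter, Nat.cast_sum]
    refine Finset.sum_le_sum fun F hF => ?_
    have hF' : Facet u h F := (Finset.mem_filter.1 hF).2
    split_ifs with hk
    · rw [← hk]; exact_mod_cast AS_box hF'.1 hu hp ξ
    · positivity
  have hc0 : hB.coeff 0 = 1 := by
    rw [← Polynomial.coeff_coe, hBeq, PowerSeries.coeff_zero_eq_constantCoeff_apply, map_mul, map_pow, map_sub]
    simp [ehrBdSeries, ← PowerSeries.coeff_zero_eq_constantCoeff_apply]
  have hE1 : latCount (frontier (((1:ℕ) : ℝ) • P)) = Fintype.card ι := by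
    rw [latCount, Nat.cast_one, one_smul, ← Nat.card_eq_fintype_card]
    rfl
  have hc1 : hB.coeff 1 = Fintype.card ι - d := by
    rw [← Polynomial.coeff_coe, hBeq, PowerSeries.coeff_mul]
    rw [show Finset.HasAntidiagonal.antidiagonal 1 = {(0,1),(1,0)} from rfl, Finset.sum_pair (by simp)]
    have a0 : (PowerSeries.coeff 0) ((1 - PowerSeries.X : PowerSeries ℤ) ^ d) = 1 := by
      rw [PowerSeries.coeff_zero_eq_constantCoeff_apply]; simp
    have a1 : ∀ m : ℕ, (PowerSeries.coeff 1) ((1 - PowerSeries.X : PowerSeries ℤ) ^ m) = -m := by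
      intro m
      induction m with
      | zero => simp [PowerSeries.coeff_one]
      | succ m ih =>
        rw [pow_succ', sub_mul, one_mul, map_sub, ih, show (1:ℕ) = 0 + 1 from rfl, PowerSeries.coeff_succ_X_mul,
          PowerSeries.coeff_zero_eq_constantCoeff_apply]
        simp; ring
    rw [a0, a1]
    have b1 : (PowerSeries.coeff 1) (ehrBdSeries P) = Fintype.card ι := by
      rw [ehrBdSeries, PowerSeries.coeff_mk, if_neg one_ne_zero, hE1]
    have b0 : (PowerSeries.coeff 0) (ehrBdSeries P) = 1 := by
      rw [ehrBdSeries, PowerSeries.coeff_mk, if_pos rfl]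
    rw [b0, b1]; ring
  have hgt := card_gt S hd hξ
  have hgt' : (d : ℤ) + 1 ≤ Fintype.card ι := by exact_mod_cast hgt
  have h01 : (1 : ℤ) ≤ hB.coeff 1 := by rw [hc1]; linarith
  have hlb : ∀ j : ℕ, 2 ≤ j → j ≤ d - 1 → hB.coeff 1 ≤ hB.coeff j := by
    intro j hj hjd
    have hl := lower_bound S hξ hvert (k := j) (by omega) (by omega)
    have hl' : (Fintype.card ι : ℤ) ≤ d +
      ((univ.filter fun F : Finset ι => Facet u h F ∧ (Rs u ξ F).card = j).card : ℤ) := by exact_mod_cast hl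
    have := hge j
    rw [hc1]; linarith
  refine ⟨hc0, by rw [hc0]; exact h01, hlb, fun j hj => ?_⟩
  rcases Nat.eq_zero_or_pos j with rfl | hj0
  · rw [hc0]; norm_num
  rcases Nat.lt_or_ge j 2 with hj2 | hj2
  · obtain rfl : j = 1 := by omega
    linarith
  rcases Nat.lt_or_ge j d with hjd | hjd
  · have := hlb j hj2 (by omega); linarith
  · obtain rfl : j = d := by omega
    obtain ⟨F, hF, hc⟩ := exists_full_Rs S hξ
    refine lt_of_lt_of_le ?_ (hge j)
    have : 0 < (univ.filter fun F : Finset ι => Facet u h F ∧ (Rs u ξ F).card = j).card :=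
      Finset.card_pos.2 ⟨F, Finset.mem_filter.2 ⟨Finset.mem_univ _, hF, hc⟩⟩
    exact_mod_cast this

/-- **Statement 7.** (Lower bound theorem for boundary h*-polynomials.) If `P ⊆ ℝ^d` is a
full-dimensional lattice polytope with `h*_{∂P}(z) = h*_{∂P,d} z^d + ⋯ + h*_{∂P,0}`, then
`h*_{∂P,0} = 1 ≤ h*_{∂P,1} ≤ h*_{∂P,j}` for `j = 2, …, d−1`; in particular all coefficients
`h*_{∂P,0}, …, h*_{∂P,d}` are positive. -/
theorem boundary_hstar_lower_bound {d : ℕ} (hd : 1 ≤ d) (P : Set (Fin d → ℝ))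
    (hlat : IsLatticePolytope P) (hfull : IsFullDim P)
    (hB : Polynomial ℤ)
    (hBeq : (hB : PowerSeries ℤ) = (1 - PowerSeries.X) ^ d * ehrBdSeries P) :
    hB.coeff 0 = 1 ∧
    hB.coeff 0 ≤ hB.coeff 1 ∧
    (∀ j : ℕ, 2 ≤ j → j ≤ d - 1 → hB.coeff 1 ≤ hB.coeff j) ∧
    (∀ j : ℕ, j ≤ d → 0 < hB.coeff j) := by
  exact main_aux hd P hlat hfull hB hBeq
end

section
/- Let Δ ⊂ ℝ^d be a half-open simplex with affinely independent vertices v_1, …, v_{d+1}, where the facets opposite v_1, …, v_r are removed: Δ = {λ_1 v_1 + ⋯ + λ_{d+1} v_{d+1} : λ_1, …, λ_r > 0, λ_{r+1}, …, λ_{d+1} ≥ 0, λ_1 + ⋯ + λ_{d+1} = 1}. Suppose q_1, …, q_{d+1} are positive integers with v_j ∈ (1/q_j)ℤ^d for each j. Let hom(Δ) ⊂ ℝ^{d+1} be the half-open cone Σ_{j=1}^{r} ℝ_{>0}·(v_j, 1) + Σ_{j=r+1}^{d+1} ℝ_{≥0}·(v_j, 1), and let F'_Δ := Σ_{j=1}^{r}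 (0,1]·(q_j v_j, q_j) + Σ_{j=r+1}^{d+1} [0,1)·(q_j v_j, q_j). Then Σ_{x ∈ hom(Δ) ∩ ℤ^{d+1}} z^{x_{d+1}} = (Σ_{m ∈ F'_Δ ∩ ℤ^{d+1}} z^{m_{d+1}}) / ((1−z^{q_1})⋯(1−z^{q_{d+1}})) as formal power series in z; in particular, every point of hom(Δ) is uniquely the sum of a nonnegative integer combination of the vectors (q_j v_j, q_j) and a point of F'_Δ. -/
open Pointwise

namespace HT

def pc (r j : ℕ) (x : ℝ) : Prop := (j < r → 0 < x) ∧ (r ≤ j → 0 ≤ x)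
def bc (r j : ℕ) (x : ℝ) : Prop := (j < r → x ≤ 1) ∧ (r ≤ j → x < 1)

lemma pc_nonneg {r j : ℕ} {x : ℝ} (h : pc r j x) : 0 ≤ x := by
  rcases lt_or_ge j r with hj | hj
  · exact (h.1 hj).le
  · exact h.2 hj

lemma not_bc {r j : ℕ} {x : ℝ} : ¬ bc r j x ↔ pc r j (x - 1) := by
  unfold pc bc
  rcases lt_or_ge j r with hj | hj
  · have : ¬ r ≤ j := by omega
    simp [hj, this]
  · have : ¬ j < r := by omega
    simp [hj, this]

lemma pc_add {r j : ℕ} {x y : ℝ} (h : pc r j x) (hy : 0 ≤ y) : pc r j (x + y) :=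
  ⟨fun hj => by have := h.1 hj; linarith, fun hj => by have := h.2 hj; linarith⟩

lemma pc_mul {r j : ℕ} {x y : ℝ} (h : pc r j x) (hy : 0 < y) : pc r j (x * y) :=
  ⟨fun hj => mul_pos (h.1 hj) hy, fun hj => mul_nonneg (h.2 hj) hy.le⟩

lemma exists_nat {r j : ℕ} {x : ℝ} (h : pc r j x) :
    ∃ n : ℕ, pc r j (x - n) ∧ bc r j (x - n) := by
  classical
  have hex : ∃ n : ℕ, bc r j (x - n) := by
    obtain ⟨n, hn⟩ := exists_nat_gt x
    exact ⟨n, fun _ => by linarith, fun _ => by linarith⟩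
  refine ⟨Nat.find hex, ?_, Nat.find_spec hex⟩
  rcases hm : Nat.find hex with _ | m
  · simpa using h
  · have : ¬ bc r j (x - m) := Nat.find_min hex (by omega)
    rw [not_bc] at this
    convert this using 1
    push_cast; ring

lemma nat_le {r j : ℕ} {x : ℝ} {n m : ℕ} (hn : bc r j (x - n)) (hm : pc r j (x - m)) :
    m ≤ n := by
  by_contra! hlt
  have h1 : ((n : ℝ) + 1) ≤ m := by exact_mod_cast hlt
  have : pc r j (x - n - 1) := by
    have := pc_add hm (y := m - n - 1) (by linarith)
    convert this using 1; ring
  exact not_bc.2 this hn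

section
variable {d r : ℕ} (v : Fin (d + 1) → (Fin d → ℝ)) (q : Fin (d + 1) → ℕ)

noncomputable def L (c : Fin (d + 1) → ℝ) : Fin (d + 1) → ℝ :=
  ∑ j : Fin (d + 1), c j • ((q j : ℝ) • (Fin.snoc (v j) 1 : Fin (d + 1) → ℝ))

lemma L_add (c e) : L v q (c + e) = L v q c + L v q e := by
  simp [L, add_smul, Finset.sum_add_distrib]

lemma L_sub (c e) : L v q (c - e) = L v q c - L v q e := by
  simp [L, sub_smul, Finset.sum_sub_distrib]

lemma L_last (c) : L v q c (Fin.last d) = ∑ j, c j * q j := by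
  simp [L]

lemma L_castSucc (c) (i : Fin d) : L v q c i.castSucc = ∑ j, c j * (q j * v j i) := by
  simp [L]

lemma L_inj (hind : AffineIndependent ℝ v) (hq : ∀ j, 0 < q j) :
    Function.Injective (L v q) := by
  intro c e h
  have h0 : L v q (c - e) = 0 := by rw [L_sub, h, sub_self]
  rw [affineIndependent_iff] at hind
  have := hind Finset.univ (fun j => (c - e) j * q j)
    (by rw [← L_last v q, h0]; rfl)
    (by
      ext i
      have := congrFun h0 i.castSucc
      rw [L_castSucc] at this
      simpa [mul_assoc] using this)
  ext j
  have hj := this j (Finset.mem_univ _)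
  have : (q j : ℝ) ≠ 0 := by exact_mod_cast (hq j).ne'
  simpa [this, sub_eq_zero] using hj

lemma L_single (j : Fin (d + 1)) :
    L v q (Pi.single j 1) = (q j : ℝ) • (Fin.snoc (v j) 1 : Fin (d + 1) → ℝ) := by
  unfold L
  rw [Finset.sum_eq_single j]
  · simp
  · intro b _ hb
    simp [hb]
  · simp

lemma L_single_lat (hqv : ∀ j i, ∃ a : ℤ, (q j : ℝ) * v j i = (a : ℝ)) (j) :
    IsLatticePt (L v q (Pi.single j 1)) := by
  rw [L_single]
  intro i
  refine Fin.lastCases ?_ (fun i => ?_) i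
  · exact ⟨q j, by simp⟩
  · obtain ⟨a, ha⟩ := hqv j i
    exact ⟨a, by simpa using ha⟩

variable (r) in
def A (s : Finset (Fin (d + 1))) : Set (Fin (d + 1) → ℝ) :=
  {c | (∀ j : Fin (d + 1), pc r j (c j)) ∧ ∀ j ∈ s, bc r (j : ℕ) (c j)}

variable (r) in
def T (s : Finset (Fin (d + 1))) (n : ℕ) : Set (Fin (d + 1) → ℝ) :=
  {c | c ∈ A r s ∧ IsLatticePt (L v q c) ∧ L v q c (Fin.last d) = n}

lemma slice_eq (hinj : Function.Injective (L v q)) (s) :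
    sliceSeries (L v q '' A r s) = PowerSeries.mk fun n => ((T r v q s n).ncard : ℤ) := by
  unfold sliceSeries
  congr 1
  ext n
  congr 1
  rw [← Set.ncard_image_of_injective (T r v q s n) hinj]
  congr 1
  ext y
  constructor
  · rintro ⟨⟨c, hc, rfl⟩, h⟩
    exact ⟨c, ⟨hc, h⟩, rfl⟩
  · rintro ⟨c, ⟨hc, h⟩, rfl⟩
    exact ⟨⟨c, hc, rfl⟩, h⟩

lemma T_bound (hq : ∀ j, 0 < q j) {s n c} (hc : c ∈ T r v q s n) (j) :
    0 ≤ c j ∧ c j ≤ n := by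
  have h0 : ∀ j, 0 ≤ c j := fun j => pc_nonneg (hc.1.1 j)
  refine ⟨h0 j, ?_⟩
  have h1 := hc.2.2
  rw [L_last] at h1
  rw [← h1]
  have hqj : (1 : ℝ) ≤ q j := by exact_mod_cast hq j
  calc c j ≤ c j * q j := le_mul_of_one_le_right (h0 j) hqj
    _ ≤ _ := Finset.single_le_sum (f := fun j => c j * (q j : ℝ))
        (fun i _ => mul_nonneg (h0 i) (Nat.cast_nonneg _)) (Finset.mem_univ j)

lemma T_finite (hinj : Function.Injective (L v q)) (hq : ∀ j, 0 < q j) (s n) :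
    (T r v q s n).Finite := by
  refine Set.Finite.of_finite_image (f := L v q) ?_ hinj.injOn
  let B : Fin (d + 1) → ℝ := fun i => ∑ j, n * |((q j : ℝ) • (Fin.snoc (v j) 1 : Fin (d + 1) → ℝ)) i|
  refine Set.Finite.subset ((Set.finite_Icc (fun i => ⌊-B i⌋) (fun i => ⌈B i⌉)).image
    (fun (a : Fin (d + 1) → ℤ) i => (a i : ℝ))) ?_
  rintro _ ⟨c, hc, rfl⟩
  choose a ha using hc.2.1
  have hb : ∀ i, |(a i : ℝ)| ≤ B i := by
    intro i
    rw [← ha i]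
    simp only [L, B, Finset.sum_apply, Pi.smul_apply (c _)]
    refine (Finset.abs_sum_le_sum_abs _ _).trans (Finset.sum_le_sum fun j _ => ?_)
    have := T_bound v q hq hc j
    rw [smul_eq_mul, abs_mul, abs_of_nonneg this.1]
    exact mul_le_mul_of_nonneg_right this.2 (abs_nonneg _)
  refine ⟨a, ⟨fun i => ?_, fun i => ?_⟩, by ext i; exact (ha i).symm⟩
  · have := (abs_le.1 (hb i)).1
    exact_mod_cast (Int.floor_le _).trans this
  · have := (abs_le.1 (hb i)).2
    exact_mod_cast this.trans (Int.le_ceil _)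

lemma lat_add {x y : Fin (d + 1) → ℝ} (hx : IsLatticePt x) (hy : IsLatticePt y) :
    IsLatticePt (x + y) := fun i => by
  obtain ⟨a, ha⟩ := hx i
  obtain ⟨b, hb⟩ := hy i
  exact ⟨a + b, by simp [ha, hb]⟩

lemma lat_sub {x y : Fin (d + 1) → ℝ} (hx : IsLatticePt x) (hy : IsLatticePt y) :
    IsLatticePt (x - y) := fun i => by
  obtain ⟨a, ha⟩ := hx i
  obtain ⟨b, hb⟩ := hy i
  exact ⟨a - b, by simp [ha, hb]⟩

lemma mem_A_insert {s : Finset (Fin (d + 1))} {j c} :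
    c ∈ A r (insert j s) ↔ c ∈ A r s ∧ bc r (j : ℕ) (c j) := by
  simp only [A, Set.mem_ofPred_eq, Finset.forall_mem_insert]
  tauto

lemma mem_A_sub {s : Finset (Fin (d + 1))} {j c} (hj : j ∉ s) :
    (c ∈ A r s ∧ ¬ bc r (j : ℕ) (c j)) ↔ c - Pi.single j 1 ∈ A r s := by
  rw [not_bc]
  constructor
  · rintro ⟨h, hb⟩
    refine ⟨fun i => ?_, fun i hi => ?_⟩
    · by_cases hij : i = j
      · subst hij; simpa using hb
      · simpa [hij] using h.1 i
    · have hij : i ≠ j := by rintro rfl; exact hj hi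
      simpa [hij] using h.2 i hi
  · rintro h
    have hb : pc r j (c j - 1) := by simpa using h.1 j
    refine ⟨⟨fun i => ?_, fun i hi => ?_⟩, hb⟩
    · by_cases hij : i = j
      · subst hij; simpa using pc_add hb zero_le_one
      · simpa [hij] using h.1 i
    · have hij : i ≠ j := by rintro rfl; exact hj hi
      simpa [hij] using h.2 i hi

lemma step (hinj : Function.Injective (L v q)) (hq : ∀ j, 0 < q j)
    (hqv : ∀ j i, ∃ a : ℤ, (q j : ℝ) * v j i = (a : ℝ)) {s : Finset (Fin (d + 1))} {j}
    (hj : j ∉ s) :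
    sliceSeries (L v q '' A r s) * (1 - PowerSeries.X ^ q j) =
      sliceSeries (L v q '' A r (insert j s)) := by
  rw [slice_eq v q hinj, slice_eq v q hinj]
  ext n
  rw [mul_sub, mul_one, map_sub, PowerSeries.coeff_mul_X_pow', PowerSeries.coeff_mk,
    PowerSeries.coeff_mk]
  have hlat := L_single_lat v q hqv j
  have hlast : L v q (Pi.single j 1) (Fin.last d) = q j := by rw [L_single]; simp
  have hsub : T r v q (insert j s) n ⊆ T r v q s n :=
    fun c hc => ⟨(mem_A_insert.1 hc.1).1, hc.2⟩
  have hd : (T r v q s n \ T r v q (insert j s) n).ncard + (T r v q (insert j s) n).ncard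
      = (T r v q s n).ncard :=
    Set.ncard_sdiff_add_ncard_of_subset hsub (T_finite v q hinj hq s n)
  have hmem : ∀ c, c ∈ T r v q s n \ T r v q (insert j s) n ↔
      c - Pi.single j 1 ∈ A r s ∧ IsLatticePt (L v q c) ∧ L v q c (Fin.last d) = n := by
    intro c
    rw [← mem_A_sub hj]
    simp only [Set.mem_sdiff, T, Set.mem_ofPred_eq, mem_A_insert]
    tauto
  split_ifs with hn
  · rw [PowerSeries.coeff_mk]
    have : (T r v q s n \ T r v q (insert j s) n) =
        (fun c => c + Pi.single j 1) '' T r v q s (n - q j) := by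
      ext c
      rw [hmem]
      constructor
      · rintro ⟨h1, h2, h3⟩
        refine ⟨c - Pi.single j 1, ⟨h1, ?_, ?_⟩, by simp⟩
        · rw [L_sub]; exact lat_sub h2 hlat
        · rw [L_sub, Pi.sub_apply, h3, hlast, Nat.cast_sub hn]
      · rintro ⟨e, ⟨h1, h2, h3⟩, rfl⟩
        refine ⟨by simpa using h1, ?_, ?_⟩
        · rw [L_add]; exact lat_add h2 hlat
        · rw [L_add, Pi.add_apply, h3, hlast, Nat.cast_sub hn]; ring
    rw [this, Set.ncard_image_of_injective _ (add_left_injective _)] at hd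
    rw [← hd]; push_cast; ring
  · have : (T r v q s n \ T r v q (insert j s) n) = ∅ := by
      rw [Set.eq_empty_iff_forall_notMem]
      intro c hc
      obtain ⟨h1, h2, h3⟩ := (hmem c).1 hc
      have h4 : 0 ≤ L v q (c - Pi.single j 1) (Fin.last d) := by
        rw [L_last]
        exact Finset.sum_nonneg fun i _ => mul_nonneg (pc_nonneg (h1.1 i)) (Nat.cast_nonneg _)
      rw [L_sub, Pi.sub_apply, h3, hlast, sub_nonneg] at h4
      exact hn (by exact_mod_cast h4)
    rw [this, Set.ncard_empty, zero_add] at hd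
    rw [PowerSeries.coeff_mk, hd, sub_zero]

lemma prod_step (hinj : Function.Injective (L v q)) (hq : ∀ j, 0 < q j)
    (hqv : ∀ j i, ∃ a : ℤ, (q j : ℝ) * v j i = (a : ℝ)) (s : Finset (Fin (d + 1))) :
    sliceSeries (L v q '' A r ∅) * ∏ j ∈ s, (1 - PowerSeries.X ^ q j) =
      sliceSeries (L v q '' A r s) := by
  induction s using Finset.induction_on with
  | empty => simp
  | insert j s hj ih =>
    rw [Finset.prod_insert hj, mul_comm (1 - _), ← mul_assoc, ih, step v q hinj hq hqv hj]

lemma homog_eq (hq : ∀ j, 0 < q j) : homog v r = L v q '' A r ∅ := by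
  have hq' : ∀ j, (0 : ℝ) < q j := fun j => by exact_mod_cast hq j
  ext y
  constructor
  · rintro ⟨c, h1, h2, rfl⟩
    refine ⟨fun j => c j * (q j : ℝ)⁻¹, ⟨fun j => pc_mul ⟨h1 j, h2 j⟩ (inv_pos.2 (hq' j)),
      by simp⟩, ?_⟩
    refine Finset.sum_congr rfl fun j _ => ?_
    rw [smul_smul, mul_assoc, inv_mul_cancel₀ (hq' j).ne', mul_one]
  · rintro ⟨c, hc, rfl⟩
    refine ⟨fun j => c j * q j, fun j => (pc_mul (hc.1 j) (hq' j)).1,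
      fun j => (pc_mul (hc.1 j) (hq' j)).2, ?_⟩
    exact Finset.sum_congr rfl fun j _ => smul_smul _ _ _

lemma fpar_eq : fpar v r q = L v q '' A r Finset.univ := by
  ext y
  constructor
  · rintro ⟨c, h1, h2, rfl⟩
    exact ⟨c, ⟨fun j => ⟨fun h => (h1 j h).1, fun h => (h2 j h).1⟩,
      fun j _ => ⟨fun h => (h1 j h).2, fun h => (h2 j h).2⟩⟩, rfl⟩
  · rintro ⟨c, hc, rfl⟩
    exact ⟨c, fun j h => ⟨(hc.1 j).1 h, (hc.2 j (Finset.mem_univ _)).1 h⟩,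
      fun j h => ⟨(hc.1 j).2 h, (hc.2 j (Finset.mem_univ _)).2 h⟩, rfl⟩

end
end HT

/-- **Statement 8.** (Tiling of the homogenization of a half-open simplex.) Let `Δ` be the
half-open simplex on affinely independent vertices `v 0, …, v d ∈ ℝ^d` with the facets
opposite the first `r` vertices removed, and let `q j` be positive integers with
`v j ∈ (1/q j) ℤ^d`.  Then
`∑_{x ∈ hom(Δ) ∩ ℤ^{d+1}} z^{x_{d+1}} = (∑_{m ∈ F'_Δ ∩ ℤ^{d+1}} z^{m_{d+1}}) / ∏ⱼ (1−z^{qⱼ})`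
as formal power series, and every point of `hom(Δ)` is uniquely the sum of a nonnegative
integer combination of the `(qⱼ vⱼ, qⱼ)` and a point of `F'_Δ`. -/
theorem homog_tiling {d r : ℕ} (hr : r ≤ d + 1) (v : Fin (d + 1) → (Fin d → ℝ))
    (hind : AffineIndependent ℝ v)
    (q : Fin (d + 1) → ℕ) (hq : ∀ j, 0 < q j)
    (hqv : ∀ j i, ∃ a : ℤ, (q j : ℝ) * v j i = (a : ℝ)) :
    sliceSeries (homog v r) * (∏ j : Fin (d + 1), (1 - PowerSeries.X ^ q j)) =
      sliceSeries (fpar v r q) ∧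
    ∀ y ∈ homog v r, ∃! p : (Fin (d + 1) → ℕ) × (Fin (d + 1) → ℝ),
      p.2 ∈ fpar v r q ∧
      y = (∑ j : Fin (d + 1),
            (p.1 j : ℝ) • ((q j : ℝ) • (Fin.snoc (v j) 1 : Fin (d + 1) → ℝ))) + p.2 := by
  have hinj := HT.L_inj v q hind hq
  rw [HT.homog_eq v q hq, HT.fpar_eq v q]
  refine ⟨HT.prod_step v q hinj hq hqv Finset.univ, ?_⟩
  rintro _ ⟨c, hc, rfl⟩
  choose n hn1 hn2 using fun j => HT.exists_nat (hc.1 j)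
  refine ⟨(n, HT.L v q fun j => c j - n j),
    ⟨⟨_, ⟨hn1, fun j _ => hn2 j⟩, rfl⟩, ?_⟩, ?_⟩
  · change _ = HT.L v q (fun j => (n j : ℝ)) + _
    rw [← HT.L_add]
    congr 1
    ext j
    simp
  · rintro ⟨m, _⟩ ⟨⟨e, he, rfl⟩, h⟩
    change _ = HT.L v q (fun j => (m j : ℝ)) + HT.L v q e at h
    rw [← HT.L_add] at h
    have h' := hinj h
    have hce : ∀ j, e j = c j - m j := fun j => by rw [h']; simp
    have hmn : m = n := by
      ext j
      have h1 := he.1 j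
      have h2 := he.2 j (Finset.mem_univ _)
      rw [hce] at h1 h2
      exact le_antisymm (HT.nat_le (hn2 j) h1) (HT.nat_le h2 (hn1 j))
    subst hmn
    have : e = fun j => c j - m j := funext hce
    rw [this]
end
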